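/- There exists a constant C > 0, depending only on T, α, β, K and δ, such that for every classical solution (v,u,θ,w,b) of the planar compressible MHD system on ℝ × [0,T] with (K,δ)-admissible initial data, one has sup_{0≤t≤T} ∫_ℝ ( (θ(x,t) − 2)₊ )² dx + ∫₀^T ∫_ℝ θ^β θ_x² dx dt ≤ C, where (θ − 2)₊ := max{θ − 2, 0}. -/

import Mathlib

open MeasureTheory Set Filter

noncomputable section

/-- Viscosity function `μ(z) = 1 + α z^(−α)` (here `μ̃₁ = 1`, `μ̃₂ = α`). -/
def visc (α z : ℝ) : ℝ := 1 + α * z ^ (-α)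

/-- Squared Euclidean norm on `ℝ × ℝ` (used for the transverse fields `w, b ∈ ℝ²`). -/
def sq2 (p : ℝ × ℝ) : ℝ := p.1 ^ 2 + p.2 ^ 2

/-- Partial derivative with respect to the first (spatial) variable. -/
def pdx {E : Type*} [NormedAddCommGroup E] [NormedSpace ℝ E]
    (f : ℝ → ℝ → E) (x t : ℝ) : E := deriv (fun y => f y t) x

/-- Partial derivative with respect to the second (time) variable, taken within `[0, T]`
(so it is one-sided at the endpoints). -/
def pdt (T : ℝ) {E : Type*} [NormedAddCommGroup E] [NormedSpace ℝ E]
    (f : ℝ → ℝ → E) (x t : ℝ) : E := derivWithin (fun s => f x s) (Icc 0 T) t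

/-- A classical solution of the planar compressible MHD system (in Lagrangian coordinates,
with all physical constants normalized to `1` and `μ̃₂ = α`) on `ℝ × [0,T]`:
all the derivatives appearing in the equations exist and are continuous, `v, θ > 0`,
the five equations hold pointwise, the solution tends to `(1,0,1,0,0)` as `|x| → ∞`
uniformly in `t ∈ [0,T]`, and `v−1, u, θ−1, b, w` and their first spatial derivatives
are square-integrable in `x` for each `t ∈ [0,T]`. -/
structure IsClassicalSolution (α β T : ℝ) (v u θ : ℝ → ℝ → ℝ)
    (w b : ℝ → ℝ → ℝ × ℝ) : Prop where
  v_pos : ∀ x : ℝ, ∀ t ∈ Icc (0:ℝ) T, 0 < v x t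
  θ_pos : ∀ x : ℝ, ∀ t ∈ Icc (0:ℝ) T, 0 < θ x t
  diff_x : ∀ x : ℝ, ∀ t ∈ Icc (0:ℝ) T,
    DifferentiableAt ℝ (fun y => v y t) x ∧ DifferentiableAt ℝ (fun y => u y t) x ∧
    DifferentiableAt ℝ (fun y => θ y t) x ∧ DifferentiableAt ℝ (fun y => w y t) x ∧
    DifferentiableAt ℝ (fun y => b y t) x
  diff_xx : ∀ x : ℝ, ∀ t ∈ Icc (0:ℝ) T,
    DifferentiableAt ℝ (fun y => pdx u y t) x ∧ DifferentiableAt ℝ (fun y => pdx θ y t) x ∧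
    DifferentiableAt ℝ (fun y => pdx w y t) x ∧ DifferentiableAt ℝ (fun y => pdx b y t) x
  diff_t : ∀ x : ℝ, ∀ t ∈ Icc (0:ℝ) T,
    DifferentiableWithinAt ℝ (fun s => v x s) (Icc 0 T) t ∧
    DifferentiableWithinAt ℝ (fun s => u x s) (Icc 0 T) t ∧
    DifferentiableWithinAt ℝ (fun s => θ x s) (Icc 0 T) t ∧
    DifferentiableWithinAt ℝ (fun s => w x s) (Icc 0 T) t ∧
    DifferentiableWithinAt ℝ (fun s => b x s) (Icc 0 T) t
  cont : ContinuousOn (fun p : ℝ × ℝ =>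
      (v p.1 p.2, u p.1 p.2, θ p.1 p.2, w p.1 p.2, b p.1 p.2)) (univ ×ˢ Icc 0 T)
  cont_dx : ContinuousOn (fun p : ℝ × ℝ =>
      (pdx v p.1 p.2, pdx u p.1 p.2, pdx θ p.1 p.2, pdx w p.1 p.2, pdx b p.1 p.2))
      (univ ×ˢ Icc 0 T)
  cont_dxx : ContinuousOn (fun p : ℝ × ℝ =>
      (pdx (pdx u) p.1 p.2, pdx (pdx θ) p.1 p.2, pdx (pdx w) p.1 p.2, pdx (pdx b) p.1 p.2))
      (univ ×ˢ Icc 0 T)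
  cont_dt : ContinuousOn (fun p : ℝ × ℝ =>
      (pdt T v p.1 p.2, pdt T u p.1 p.2, pdt T θ p.1 p.2, pdt T w p.1 p.2, pdt T b p.1 p.2))
      (univ ×ˢ Icc 0 T)
  eq_mass : ∀ x : ℝ, ∀ t ∈ Icc (0:ℝ) T, pdt T v x t = pdx u x t
  eq_mom : ∀ x : ℝ, ∀ t ∈ Icc (0:ℝ) T,
    pdt T u x t + pdx (fun y s => θ y s / v y s + sq2 (b y s) / 2) x t
      = pdx (fun y s => visc α (v y s) * pdx u y s / v y s) x t
  eq_w : ∀ x : ℝ, ∀ t ∈ Icc (0:ℝ) T,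
    pdt T w x t - pdx b x t = pdx (fun y s => (v y s)⁻¹ • pdx w y s) x t
  eq_b : ∀ x : ℝ, ∀ t ∈ Icc (0:ℝ) T,
    pdt T (fun y s => v y s • b y s) x t - pdx w x t
      = pdx (fun y s => (v y s)⁻¹ • pdx b y s) x t
  eq_temp : ∀ x : ℝ, ∀ t ∈ Icc (0:ℝ) T,
    pdt T θ x t + θ x t / v x t * pdx u x t
      = pdx (fun y s => θ y s ^ β * pdx θ y s / v y s) x t
        + (visc α (v x t) * pdx u x t ^ 2 + sq2 (pdx w x t) + sq2 (pdx b x t)) / v x t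
  farfield : ∀ ε > (0:ℝ), ∃ M : ℝ, ∀ x : ℝ, ∀ t ∈ Icc (0:ℝ) T, M ≤ |x| →
    |v x t - 1| < ε ∧ |u x t| < ε ∧ |θ x t - 1| < ε ∧
    Real.sqrt (sq2 (b x t)) < ε ∧ Real.sqrt (sq2 (w x t)) < ε
  sq_int : ∀ t ∈ Icc (0:ℝ) T,
    Integrable (fun x => (v x t - 1) ^ 2) ∧ Integrable (fun x => (u x t) ^ 2) ∧
    Integrable (fun x => (θ x t - 1) ^ 2) ∧ Integrable (fun x => sq2 (b x t)) ∧
    Integrable (fun x => sq2 (w x t)) ∧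
    Integrable (fun x => (pdx v x t) ^ 2) ∧ Integrable (fun x => (pdx u x t) ^ 2) ∧
    Integrable (fun x => (pdx θ x t) ^ 2) ∧ Integrable (fun x => sq2 (pdx b x t)) ∧
    Integrable (fun x => sq2 (pdx w x t))

/-- The initial data of a solution are `(K, δ)`-admissible: the `H¹`-type norm of
`(v₀−1, u₀, θ₀−1, b₀, w₀)` is at most `K²` and `v₀ ≥ δ`, `θ₀ ≥ δ`. -/
def Admissible (K δ : ℝ) (v u θ : ℝ → ℝ → ℝ) (w b : ℝ → ℝ → ℝ × ℝ) : Prop :=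
  (∫ x : ℝ, ((v x 0 - 1) ^ 2 + (u x 0) ^ 2 + (θ x 0 - 1) ^ 2 + sq2 (b x 0) + sq2 (w x 0)
      + (pdx v x 0) ^ 2 + (pdx u x 0) ^ 2 + (pdx θ x 0) ^ 2
      + sq2 (pdx b x 0) + sq2 (pdx w x 0))) ≤ K ^ 2 ∧
  (∀ x : ℝ, δ ≤ v x 0) ∧ (∀ x : ℝ, δ ≤ θ x 0)

section Calculus

lemma integral_mono_cont {a b : ℝ} (hab : a ≤ b) {f g : ℝ → ℝ} (hf : Continuous f)
    (hg : Continuous g) (h : ∀ x ∈ Icc a b, f x ≤ g x) :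
    ∫ x in a..b, f x ≤ ∫ x in a..b, g x :=
  intervalIntegral.integral_mono_on hab (hf.intervalIntegrable _ _) (hg.intervalIntegrable _ _) h

lemma integral_nonneg_Icc {a b : ℝ} (hab : a ≤ b) {f : ℝ → ℝ} (h : ∀ x ∈ Icc a b, 0 ≤ f x) :
    0 ≤ ∫ x in a..b, f x :=
  intervalIntegral.integral_nonneg hab h

lemma integral_mono_domain {a b c d : ℝ} (hca : c ≤ a) (hab : a ≤ b) (hbd : b ≤ d) {f : ℝ → ℝ}
    (hf : Continuous f) (h : ∀ x, 0 ≤ f x) :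
    ∫ x in a..b, f x ≤ ∫ x in c..d, f x :=
  intervalIntegral.integral_mono_interval hca hab hbd (Eventually.of_forall h)
    (hf.intervalIntegrable _ _)

lemma continuous_integral_left {a b : ℝ} {f : ℝ → ℝ → ℝ}
    (hf : Continuous fun p : ℝ × ℝ => f p.1 p.2) :
    Continuous fun t => ∫ x in a..b, f x t :=
  intervalIntegral.continuous_parametric_intervalIntegral_of_continuous'
    (f := fun t x => f x t) (hf.comp (continuous_snd.prodMk continuous_fst)) a b

/-- Differentiation under the integral sign over a compact interval. -/
lemma hasDerivAt_integral_param {c d a b : ℝ} {f ft : ℝ → ℝ → ℝ}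
    (hf : Continuous fun p : ℝ × ℝ => f p.1 p.2) (hft : Continuous fun p : ℝ × ℝ => ft p.1 p.2)
    {t : ℝ} (ht : t ∈ Ioo c d)
    (h : ∀ x, ∀ s ∈ Ioo c d, HasDerivAt (fun r => f x r) (ft x s) s) :
    HasDerivAt (fun s => ∫ x in a..b, f x s) (∫ x in a..b, ft x t) t := by
  obtain ⟨B, hB⟩ := (isCompact_uIcc (a := a) (b := b)).prod (isCompact_Icc (a := c) (b := d))
    |>.exists_bound_of_continuousOn hft.continuousOn
  refine (intervalIntegral.hasDerivAt_integral_of_dominated_loc_of_deriv_le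
    (F := fun s x => f x s) (F' := fun s x => ft x s) (bound := fun _ => B)
    (Ioo_mem_nhds ht.1 ht.2) ?_ ?_ ?_ ?_ ?_ ?_).2
  · refine Eventually.of_forall fun s => Continuous.aestronglyMeasurable ?_
    exact hf.comp (continuous_id.prodMk continuous_const)
  · exact (hf.comp (continuous_id.prodMk continuous_const)).intervalIntegrable _ _
  · exact (hft.comp (continuous_id.prodMk continuous_const)).aestronglyMeasurable
  · refine Eventually.of_forall fun x hx s hs => hB (x, s) ⟨uIoc_subset_uIcc hx, ?_⟩
    exact Ioo_subset_Icc_self hs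
  · exact intervalIntegrable_const
  · exact Eventually.of_forall fun x _ s hs => h x s hs

lemma integral_of_hasDerivAt {a b : ℝ} {f f' : ℝ → ℝ} (h : ∀ x, HasDerivAt f (f' x) x)
    (hf' : Continuous f') : ∫ x in a..b, f' x = f b - f a :=
  intervalIntegral.integral_eq_sub_of_hasDerivAt (fun x _ => h x) (hf'.intervalIntegrable _ _)

lemma hasDerivAt_integral_upper {f : ℝ → ℝ} (hf : Continuous f) (a t : ℝ) :
    HasDerivAt (fun s => ∫ r in a..s, f r) (f t) t :=
  (hf.integral_hasStrictDerivAt a t).hasDerivAt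

/-- Grönwall's inequality with an integrable (continuous) coefficient and a dissipation term. -/
lemma gronwall_dissipative {T M : ℝ} (hT : 0 ≤ T) {y d g : ℝ → ℝ} (hy : Continuous y)
    (hd : Continuous d) (hg : Continuous g) (hd0 : ∀ t, 0 ≤ d t) (hg0 : ∀ t, 0 ≤ g t)
    (hy0 : ∀ t, 0 ≤ y t)
    (hder : ∀ t ∈ Ioo 0 T, ∃ y', HasDerivAt y y' t ∧ y' + d t ≤ g t * (1 + y t))
    (hM : ∫ t in (0:ℝ)..T, g t ≤ M) :
    ∀ t ∈ Icc 0 T, y t + ∫ s in (0:ℝ)..t, d s ≤ (1 + y 0) * Real.exp M := by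
  set G : ℝ → ℝ := fun t => ∫ s in (0:ℝ)..t, g s with hG
  have hGd : ∀ t, HasDerivAt G (g t) t := fun t => hasDerivAt_integral_upper hg 0 t
  have hGc : Continuous G := continuous_iff_continuousAt.2 fun t => (hGd t).continuousAt
  set P : ℝ → ℝ := fun t => (1 + y t) * Real.exp (-G t) + ∫ s in (0:ℝ)..t, d s * Real.exp (-G s)
    with hP
  have hdc : Continuous fun s => d s * Real.exp (-G s) := by fun_prop
  have hPd : ∀ t ∈ Ioo 0 T, ∃ p, HasDerivAt P p t ∧ p ≤ 0 := by
    intro t ht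
    obtain ⟨y', hy', hle⟩ := hder t ht
    refine ⟨_, ((hy'.const_add 1).mul (hGd t).neg.exp).add (hasDerivAt_integral_upper hdc 0 t), ?_⟩
    have h0 := Real.exp_pos (-G t)
    simp only [Pi.neg_apply]
    nlinarith
  have hPc : Continuous P := by
    refine Continuous.add (by fun_prop) ?_
    exact continuous_iff_continuousAt.2 fun t => (hasDerivAt_integral_upper hdc 0 t).continuousAt
  have hanti : AntitoneOn P (Icc 0 T) := by
    refine antitoneOn_of_deriv_nonpos (convex_Icc 0 T) hPc.continuousOn ?_ ?_
    · intro t ht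
      rw [interior_Icc] at ht
      obtain ⟨p, hp, _⟩ := hPd t ht
      exact hp.differentiableAt.differentiableWithinAt
    · intro t ht
      rw [interior_Icc] at ht
      obtain ⟨p, hp, h0⟩ := hPd t ht
      rwa [hp.deriv]
  intro t ht
  have h1 := hanti (left_mem_Icc.2 hT) ht ht.1
  have hGM : ∀ s ∈ Icc 0 T, Real.exp (-M) ≤ Real.exp (-G s) := by
    intro s hs
    refine Real.exp_le_exp.2 (neg_le_neg ?_)
    exact (integral_mono_domain le_rfl hs.1 hs.2 hg hg0).trans hM
  have h2 : (∫ s in (0:ℝ)..t, d s) * Real.exp (-M) ≤ ∫ s in (0:ℝ)..t, d s * Real.exp (-G s) := by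
    rw [← intervalIntegral.integral_mul_const]
    refine integral_mono_cont ht.1 (by fun_prop) hdc fun s hs => ?_
    exact mul_le_mul_of_nonneg_left (hGM s ⟨hs.1, hs.2.trans ht.2⟩) (hd0 s)
  have h3 : P 0 = 1 + y 0 := by simp [hP, hG]
  have h4 : (y t + ∫ s in (0:ℝ)..t, d s) * Real.exp (-M) ≤ 1 + y 0 := by
    rw [← h3]
    refine le_trans ?_ h1
    have := hGM t ht
    have h5 := mul_le_mul_of_nonneg_left this (by linarith [hy0 t] : 0 ≤ 1 + y t)
    have := Real.exp_pos (-M)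
    simp only [hP]
    nlinarith
  calc y t + ∫ s in (0:ℝ)..t, d s
      = (y t + ∫ s in (0:ℝ)..t, d s) * Real.exp (-M) * Real.exp M := by
        rw [mul_assoc, ← Real.exp_add]; simp
    _ ≤ _ := mul_le_mul_of_nonneg_right h4 (Real.exp_pos M).le

lemma integral_mul_sq_le {a b : ℝ} (hab : a ≤ b) {f g : ℝ → ℝ} (hf : Continuous f)
    (hg : Continuous g) :
    (∫ x in a..b, f x * g x) ^ 2 ≤ (∫ x in a..b, f x ^ 2) * ∫ x in a..b, g x ^ 2 := by
  have key : ∀ r : ℝ, 0 ≤ (∫ x in a..b, g x ^ 2) * (r * r) + (2 * ∫ x in a..b, f x * g x) * r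
      + ∫ x in a..b, f x ^ 2 := by
    intro r
    have h0 : 0 ≤ ∫ x in a..b, (f x + r * g x) ^ 2 :=
      integral_nonneg_Icc hab fun x _ => sq_nonneg _
    have : ∫ x in a..b, (f x + r * g x) ^ 2 = (∫ x in a..b, g x ^ 2) * (r * r)
        + (2 * ∫ x in a..b, f x * g x) * r + ∫ x in a..b, f x ^ 2 := by
      rw [← intervalIntegral.integral_mul_const, ← intervalIntegral.integral_const_mul,
        ← intervalIntegral.integral_mul_const, ← intervalIntegral.integral_add,
        ← intervalIntegral.integral_add]
      · congr 1; ext x; ring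
      all_goals exact Continuous.intervalIntegrable (by fun_prop) _ _
    linarith
  have := discrim_le_zero key
  rw [discrim] at this
  linarith

/-- One-dimensional weighted Sobolev inequality on a bounded interval. -/
lemma sq_le_of_weighted {a b : ℝ} {r r' g : ℝ → ℝ} (hr : ∀ x, HasDerivAt r (r' x) x)
    (hr' : Continuous r') (hg : Continuous g) (hg0 : ∀ x, 0 < g x) {x y : ℝ}
    (hx : x ∈ Icc a b) (hy : y ∈ Icc a b) :
    r x ^ 2 ≤ 2 * r y ^ 2 + 2 * ((∫ z in a..b, r' z ^ 2 / g z) * ∫ z in a..b, g z) := by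
  have hab : a ≤ b := hx.1.trans hx.2
  have h1 : r x - r y = ∫ z in y..x, r' z := (integral_of_hasDerivAt hr hr').symm
  have h2 : |r x - r y| ≤ ∫ z in a..b, |r' z| := by
    rw [h1]
    refine (intervalIntegral.norm_integral_le_abs_integral_norm (f := r')).trans ?_
    simp only [Real.norm_eq_abs]
    have hc : Continuous fun z => |r' z| := hr'.abs
    rcases le_total y x with h | h
    · rw [abs_of_nonneg (integral_nonneg_Icc h fun _ _ => abs_nonneg _)]
      exact integral_mono_domain hy.1 h hx.2 hc fun _ => abs_nonneg _
    · rw [intervalIntegral.integral_symm, abs_neg,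
        abs_of_nonneg (integral_nonneg_Icc h fun _ _ => abs_nonneg _)]
      exact integral_mono_domain hx.1 h hy.2 hc fun _ => abs_nonneg _
  have hne : ∀ z, √(g z) ≠ 0 := fun z => (Real.sqrt_pos.2 (hg0 z)).ne'
  have hcd : Continuous fun z => |r' z| / √(g z) := hr'.abs.div hg.sqrt hne
  have h3 : (∫ z in a..b, |r' z|) ^ 2 ≤ (∫ z in a..b, r' z ^ 2 / g z) * ∫ z in a..b, g z := by
    have := integral_mul_sq_le hab hcd hg.sqrt
    convert this using 3
    · ext z; field_simp [hne z]
    · ext z; rw [div_pow, sq_abs, Real.sq_sqrt (hg0 z).le]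
    · ext z; rw [Real.sq_sqrt (hg0 z).le]
  have h4 : (r x - r y) ^ 2 ≤ (∫ z in a..b, |r' z|) ^ 2 := by
    rw [← sq_abs (r x - r y)]
    gcongr
  nlinarith [sq_nonneg (r x - 2 * r y)]

lemma exists_le_of_integral_le {a : ℝ} {s : ℝ → ℝ} (hs : Continuous s) {C : ℝ}
    (h : ∫ x in a..(a + 1), s x ≤ C) : ∃ y ∈ Icc a (a + 1), s y ≤ C := by
  by_contra! hcon
  obtain ⟨z, hz, hmin⟩ := (isCompact_Icc (a := a) (b := a + 1)).exists_isMinOn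
    ⟨a, by constructor <;> linarith⟩ hs.continuousOn
  have h1 : ∫ _ in a..(a + 1), s z ≤ ∫ x in a..(a + 1), s x :=
    integral_mono_cont (by linarith) (by fun_prop) hs fun x hx => hmin hx
  simp at h1
  linarith [hcon z hz]

/-- A `C¹` cutoff function which is `1` on `[-N, N]` and `0` outside `[-N-1, N+1]`. -/
structure Cutoff (c₀ N : ℝ) where
  φ : ℝ → ℝ
  φ' : ℝ → ℝ
  hasDerivAt : ∀ x, HasDerivAt φ (φ' x) x
  cont' : Continuous φ'
  nonneg : ∀ x, 0 ≤ φ x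
  le_one : ∀ x, φ x ≤ 1
  eq_one : ∀ x, |x| ≤ N → φ x = 1
  eq_zero : ∀ x, N + 1 ≤ |x| → φ x = 0
  deriv_eq_zero : ∀ x, |x| ≤ N → φ' x = 0
  deriv_le : ∀ x, |φ' x| ≤ c₀
  integral_le : (∫ x in (-(N + 1))..(N + 1), (|φ' x| + φ' x ^ 2)) ≤ c₀

lemma Cutoff.cont {c₀ N : ℝ} (c : Cutoff c₀ N) : Continuous c.φ :=
  continuous_iff_continuousAt.2 fun x => (c.hasDerivAt x).continuousAt

lemma exists_cutoff : ∃ c₀ : ℝ, 0 < c₀ ∧ ∀ N : ℝ, 0 ≤ N → Nonempty (Cutoff c₀ N) := by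
  set s := Real.smoothTransition with hs
  have hsd : ContDiff ℝ 1 s := Real.smoothTransition.contDiff (n := 1)
  have hd : ∀ x, HasDerivAt s (deriv s x) x := fun x =>
    (hsd.differentiable (by norm_num) x).hasDerivAt
  have hdc : Continuous (deriv s) := hsd.continuous_deriv (by norm_num)
  obtain ⟨B, hB⟩ := (isCompact_Icc (a := (0:ℝ)) (b := 1)).exists_bound_of_continuousOn
    hdc.continuousOn
  have hlow : ∀ x ≤ 0, s x = 0 := fun x hx => Real.smoothTransition.zero_of_nonpos hx
  have hhigh : ∀ x, 1 ≤ x → s x = 1 := fun x hx => Real.smoothTransition.one_of_one_le hx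
  have hmin : ∀ x, s x = 0 → deriv s x = 0 := fun x hx =>
    IsLocalMin.deriv_eq_zero (Eventually.of_forall fun y => by
      rw [hx]; exact Real.smoothTransition.nonneg y)
  have hmax : ∀ x, s x = 1 → deriv s x = 0 := fun x hx =>
    IsLocalMax.deriv_eq_zero (Eventually.of_forall fun y => by
      rw [hx]; exact Real.smoothTransition.le_one y)
  have hB' : ∀ x, |deriv s x| ≤ |B| := by
    intro x
    rcases le_total x 0 with h | h
    · rw [hmin x (hlow x h)]; simp
    rcases le_total 1 x with h' | h'
    · rw [hmax x (hhigh x h')]; simp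
    · exact (hB x ⟨h, h'⟩).trans (le_abs_self B)
  refine ⟨4 * (2 * |B| + 4 * B ^ 2) + 2 * |B| + 1, by positivity, fun N hN => ?_⟩
  set φ : ℝ → ℝ := fun x => s (N + 1 - x) * s (N + 1 + x) with hφ
  set φ' : ℝ → ℝ := fun x => (-deriv s (N + 1 - x)) * s (N + 1 + x)
    + s (N + 1 - x) * deriv s (N + 1 + x) with hφ'
  have hs1 : ∀ x, |s x| ≤ 1 := fun x => by
    rw [abs_of_nonneg (Real.smoothTransition.nonneg x)]; exact Real.smoothTransition.le_one x
  have hφd : ∀ x, HasDerivAt φ (φ' x) x := by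
    intro x
    have h1 : HasDerivAt (fun y => s (N + 1 - y)) (-deriv s (N + 1 - x)) x := by
      simpa [Function.comp_def] using
        (hd (N + 1 - x)).comp x ((hasDerivAt_id' x).const_sub (N + 1))
    have h2 : HasDerivAt (fun y => s (N + 1 + y)) (deriv s (N + 1 + x)) x := by
      simpa [Function.comp_def] using
        (hd (N + 1 + x)).comp x ((hasDerivAt_id' x).const_add (N + 1))
    exact h1.mul h2
  have hsc : Continuous s := hsd.continuous
  have hφ'c : Continuous φ' := by fun_prop
  have hφ'b : ∀ x, |φ' x| ≤ 2 * |B| := by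
    intro x
    refine (abs_add_le _ _).trans ?_
    rw [abs_mul, abs_mul, abs_neg]
    nlinarith [hB' (N + 1 - x), hB' (N + 1 + x), hs1 (N + 1 - x), hs1 (N + 1 + x),
      abs_nonneg (deriv s (N + 1 - x)), abs_nonneg (deriv s (N + 1 + x)),
      abs_nonneg (s (N + 1 - x)), abs_nonneg (s (N + 1 + x)), abs_nonneg B]
  have hz : ∀ x, |x| ≤ N → φ' x = 0 := by
    intro x hx
    obtain ⟨h1, h2⟩ := abs_le.1 hx
    simp only [hφ']
    rw [hmax _ (hhigh _ (by linarith)), hmax _ (hhigh _ (by linarith))]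
    simp
  refine ⟨⟨φ, φ', hφd, hφ'c, fun x => mul_nonneg (Real.smoothTransition.nonneg _)
    (Real.smoothTransition.nonneg _), fun x => ?_, ?_, ?_, hz, ?_, ?_⟩⟩
  · exact mul_le_one₀ (Real.smoothTransition.le_one _) (Real.smoothTransition.nonneg _)
      (Real.smoothTransition.le_one _)
  · intro x hx
    obtain ⟨h1, h2⟩ := abs_le.1 hx
    simp only [hφ]
    rw [hhigh _ (by linarith), hhigh _ (by linarith)]; simp
  · intro x hx
    simp only [hφ]
    rcases le_abs.1 hx with h | h
    · rw [hlow (N + 1 - x) (by linarith)]; simp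
    · rw [hlow (N + 1 + x) (by linarith)]; simp
  · intro x
    have := hφ'b x
    nlinarith [abs_nonneg B, sq_nonneg B]
  · set ω : ℝ → ℝ := fun x => |φ' x| + φ' x ^ 2 with hω
    have hωc : Continuous ω := by fun_prop
    have hωb : ∀ x, ω x ≤ 2 * |B| + 4 * B ^ 2 := by
      intro x
      have h1 := hφ'b x
      have h2 : φ' x ^ 2 ≤ (2 * |B|) ^ 2 := by rw [← sq_abs (φ' x)]; gcongr
      have h3 : (2 * |B|) ^ 2 = 4 * B ^ 2 := by rw [mul_pow, sq_abs]; norm_num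
      simp only [hω]; linarith
    have hi : ∀ a b, IntervalIntegrable ω volume a b := fun a b => hωc.intervalIntegrable _ _
    have h0 : ∫ x in (-N)..N, ω x = 0 := by
      rw [intervalIntegral.integral_congr (g := fun _ => (0:ℝ))]
      · simp
      · intro x hx
        rw [uIcc_of_le (by linarith)] at hx
        simp [hω, hz x (abs_le.2 hx)]
    have h1 : ∫ x in (-(N + 1))..(-N), ω x ≤ 2 * |B| + 4 * B ^ 2 := by
      refine (integral_mono_cont (by linarith) hωc continuous_const fun x _ => hωb x).trans ?_
      simp
    have h2 : ∫ x in N..(N + 1), ω x ≤ 2 * |B| + 4 * B ^ 2 := by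
      refine (integral_mono_cont (by linarith) hωc continuous_const fun x _ => hωb x).trans ?_
      simp
    rw [← intervalIntegral.integral_add_adjacent_intervals (hi _ (-N)) (hi _ _),
      ← intervalIntegral.integral_add_adjacent_intervals (hi (-N) N) (hi _ _), h0]
    nlinarith [abs_nonneg B, sq_nonneg B]

end Calculus

/-- A `C^{2,1}` scalar field on `ℝ × ℝ` with its derivatives; time derivatives are required
on `(0, T)` only. -/
structure SmoothField (T : ℝ) where
  f : ℝ → ℝ → ℝ
  fx : ℝ → ℝ → ℝ
  fxx : ℝ → ℝ → ℝ
  ft : ℝ → ℝ → ℝ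
  cont_f : Continuous fun p : ℝ × ℝ => f p.1 p.2
  cont_fx : Continuous fun p : ℝ × ℝ => fx p.1 p.2
  cont_fxx : Continuous fun p : ℝ × ℝ => fxx p.1 p.2
  cont_ft : Continuous fun p : ℝ × ℝ => ft p.1 p.2
  hasDerivAt_x : ∀ x t, HasDerivAt (fun y => f y t) (fx x t) x
  hasDerivAt_xx : ∀ x t, HasDerivAt (fun y => fx y t) (fxx x t) x
  hasDerivAt_t : ∀ x, ∀ t ∈ Ioo 0 T, HasDerivAt (fun s => f x s) (ft x t) t

namespace SmoothField

variable {T : ℝ} (F : SmoothField T) {X : Type*} [TopologicalSpace X] {g h : X → ℝ}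

@[fun_prop]
lemma continuous_f (hg : Continuous g) (hh : Continuous h) :
    Continuous fun x => F.f (g x) (h x) := F.cont_f.comp (hg.prodMk hh)

@[fun_prop]
lemma continuous_fx (hg : Continuous g) (hh : Continuous h) :
    Continuous fun x => F.fx (g x) (h x) := F.cont_fx.comp (hg.prodMk hh)

@[fun_prop]
lemma continuous_fxx (hg : Continuous g) (hh : Continuous h) :
    Continuous fun x => F.fxx (g x) (h x) := F.cont_fxx.comp (hg.prodMk hh)

@[fun_prop]
lemma continuous_ft (hg : Continuous g) (hh : Continuous h) :
    Continuous fun x => F.ft (g x) (h x) := F.cont_ft.comp (hg.prodMk hh)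

end SmoothField

/-- A classical solution of the scalar form of the planar MHD system, in flux form. -/
structure MHDFlow (α β T : ℝ) where
  v : ℝ → ℝ → ℝ
  vx : ℝ → ℝ → ℝ
  u : SmoothField T
  θ : SmoothField T
  w₁ : SmoothField T
  w₂ : SmoothField T
  b₁ : SmoothField T
  b₂ : SmoothField T
  cont_v : Continuous fun p : ℝ × ℝ => v p.1 p.2
  cont_vx : Continuous fun p : ℝ × ℝ => vx p.1 p.2
  v_pos : ∀ x t, 0 < v x t
  θ_pos : ∀ x t, 0 < θ.f x t
  hasDerivAt_vx : ∀ x t, HasDerivAt (fun y => v y t) (vx x t) x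
  hasDerivAt_vt : ∀ x, ∀ t ∈ Ioo 0 T, HasDerivAt (fun s => v x s) (u.fx x t) t
  momentum : ∀ x t, HasDerivAt (fun y => visc α (v y t) * u.fx y t / v y t - θ.f y t / v y t
    - (b₁.f y t ^ 2 + b₂.f y t ^ 2) / 2) (u.ft x t) x
  transverse₁ : ∀ x t, HasDerivAt (fun y => w₁.fx y t / v y t + b₁.f y t) (w₁.ft x t) x
  transverse₂ : ∀ x t, HasDerivAt (fun y => w₂.fx y t / v y t + b₂.f y t) (w₂.ft x t) x
  magnetic₁ : ∀ x t, HasDerivAt (fun y => b₁.fx y t / v y t + w₁.f y t)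
    (u.fx x t * b₁.f x t + v x t * b₁.ft x t) x
  magnetic₂ : ∀ x t, HasDerivAt (fun y => b₂.fx y t / v y t + w₂.f y t)
    (u.fx x t * b₂.f x t + v x t * b₂.ft x t) x
  temperature : ∀ x t, HasDerivAt (fun y => θ.f y t ^ β * θ.fx y t / v y t)
    (θ.ft x t + θ.f x t / v x t * u.fx x t - (visc α (v x t) * u.fx x t ^ 2
      + w₁.fx x t ^ 2 + w₂.fx x t ^ 2 + b₁.fx x t ^ 2 + b₂.fx x t ^ 2) / v x t) x
  far : ∃ N, 1 ≤ N ∧ ∀ x t, N ≤ |x| → |v x t - 1| ≤ 1 / 2 ∧ |θ.f x t - 1| ≤ 1 / 2 ∧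
    |u.f x t| ≤ 1 ∧ |w₁.f x t| ≤ 1 ∧ |w₂.f x t| ≤ 1 ∧ |b₁.f x t| ≤ 1 ∧ |b₂.f x t| ≤ 1

namespace MHDFlow

/-- Outside `[-N, N]` the flow is close to the equilibrium state. -/
def FarFrom {α β T : ℝ} (S : MHDFlow α β T) (N : ℝ) : Prop :=
  ∀ x t, N ≤ |x| → |S.v x t - 1| ≤ 1 / 2 ∧ |S.θ.f x t - 1| ≤ 1 / 2 ∧
    |S.u.f x t| ≤ 1 ∧ |S.w₁.f x t| ≤ 1 ∧ |S.w₂.f x t| ≤ 1 ∧ |S.b₁.f x t| ≤ 1 ∧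
    |S.b₂.f x t| ≤ 1

variable {α β T : ℝ} (S : MHDFlow α β T) {X : Type*} [TopologicalSpace X] {g h : X → ℝ}

@[fun_prop]
lemma continuous_v (hg : Continuous g) (hh : Continuous h) :
    Continuous fun x => S.v (g x) (h x) := S.cont_v.comp (hg.prodMk hh)

@[fun_prop]
lemma continuous_vx (hg : Continuous g) (hh : Continuous h) :
    Continuous fun x => S.vx (g x) (h x) := S.cont_vx.comp (hg.prodMk hh)

/-- The viscosity along the flow. -/
def mu (x t : ℝ) : ℝ := visc α (S.v x t)

@[fun_prop]
lemma continuous_mu (hg : Continuous g) (hh : Continuous h) :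
    Continuous fun x => S.mu (g x) (h x) := by
  unfold mu visc
  exact continuous_const.add (continuous_const.mul
    ((S.continuous_v hg hh).rpow_const fun _ => Or.inl (S.v_pos _ _).ne'))

lemma one_le_mu (hα : 0 ≤ α) (x t : ℝ) : 1 ≤ S.mu x t := by
  have := Real.rpow_nonneg (S.v_pos x t).le (-α)
  unfold mu visc
  nlinarith [mul_nonneg hα this]

/-- A power of the temperature. -/
def thp (p x t : ℝ) : ℝ := S.θ.f x t ^ p

@[fun_prop]
lemma continuous_thp (p : ℝ) (hg : Continuous g) (hh : Continuous h) :
    Continuous fun x => S.thp p (g x) (h x) := by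
  unfold thp
  exact (S.θ.continuous_f hg hh).rpow_const fun _ => Or.inl (S.θ_pos _ _).ne'

lemma thp_pos (p x t : ℝ) : 0 < S.thp p x t := Real.rpow_pos_of_pos (S.θ_pos x t) p

/-- A function of the temperature. -/
def thf (k : ℝ → ℝ) (x t : ℝ) : ℝ := k (S.θ.f x t)

@[fun_prop]
lemma continuous_thf {k : ℝ → ℝ} (hk : ContinuousOn k (Ioi 0)) (hg : Continuous g)
    (hh : Continuous h) : Continuous fun x => S.thf k (g x) (h x) :=
  hk.comp_continuous (by fun_prop) fun _ => S.θ_pos _ _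

/-- The sum of the squared gradients of the magnetic and velocity fields, weighted by the
viscosity. -/
def diss (x t : ℝ) : ℝ := (S.mu x t * S.u.fx x t ^ 2 + S.w₁.fx x t ^ 2 + S.w₂.fx x t ^ 2
  + S.b₁.fx x t ^ 2 + S.b₂.fx x t ^ 2) / S.v x t

/-- The heat flux. -/
def heat (x t : ℝ) : ℝ := S.thp β x t * S.θ.fx x t / S.v x t

/-- The density `u² + |w|² + v|b|²`. -/
def kin (x t : ℝ) : ℝ := S.u.f x t ^ 2 + S.w₁.f x t ^ 2 + S.w₂.f x t ^ 2
  + S.v x t * (S.b₁.f x t ^ 2 + S.b₂.f x t ^ 2)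

@[fun_prop]
lemma continuous_diss (hg : Continuous g) (hh : Continuous h) :
    Continuous fun x => S.diss (g x) (h x) := by
  unfold diss
  fun_prop (disch := intro _; exact (S.v_pos _ _).ne')

@[fun_prop]
lemma continuous_heat (hg : Continuous g) (hh : Continuous h) :
    Continuous fun x => S.heat (g x) (h x) := by
  unfold heat
  fun_prop (disch := intro _; exact (S.v_pos _ _).ne')

@[fun_prop]
lemma continuous_kin (hg : Continuous g) (hh : Continuous h) :
    Continuous fun x => S.kin (g x) (h x) := by
  unfold kin
  fun_prop

lemma diss_nonneg (hα : 0 ≤ α) (x t : ℝ) : 0 ≤ S.diss x t := by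
  have := S.one_le_mu hα x t
  have := S.v_pos x t
  unfold diss
  positivity

lemma kin_nonneg (x t : ℝ) : 0 ≤ S.kin x t := by
  have := S.v_pos x t
  unfold kin
  positivity

/-- The spatial flux of the density `A/2 * kin + H(θ)` with `H' = h`. -/
def flux (A : ℝ) (k : ℝ → ℝ) (x t : ℝ) : ℝ :=
  A * (S.u.f x t * (S.mu x t * S.u.fx x t / S.v x t - S.θ.f x t / S.v x t
      - (S.b₁.f x t ^ 2 + S.b₂.f x t ^ 2) / 2 + 1)
    + S.w₁.f x t * (S.w₁.fx x t / S.v x t + S.b₁.f x t)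
    + S.w₂.f x t * (S.w₂.fx x t / S.v x t + S.b₂.f x t)
    + S.b₁.f x t * (S.b₁.fx x t / S.v x t) + S.b₂.f x t * (S.b₂.fx x t / S.v x t))
  + S.heat x t * S.thf k x t

/-- The time derivative of the density `A/2 * kin + H(θ) + c (v - 1 - log v)`, where `H' = h`. -/
def densT (A c : ℝ) (k : ℝ → ℝ) (x t : ℝ) : ℝ :=
  A * (S.u.f x t * S.u.ft x t + S.w₁.f x t * S.w₁.ft x t + S.w₂.f x t * S.w₂.ft x t
    + S.u.fx x t * (S.b₁.f x t ^ 2 + S.b₂.f x t ^ 2) / 2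
    + S.v x t * (S.b₁.f x t * S.b₁.ft x t + S.b₂.f x t * S.b₂.ft x t))
  + S.thf k x t * S.θ.ft x t + c * (S.u.fx x t * (1 - 1 / S.v x t))

lemma hasDerivAt_dens (A c : ℝ) {k H : ℝ → ℝ} (hH : ∀ y, 0 < y → HasDerivAt H (k y) y)
    (x : ℝ) {t : ℝ} (ht : t ∈ Ioo 0 T) :
    HasDerivAt (fun s => A / 2 * S.kin x s + S.thf H x s + c * (S.v x s - 1 - Real.log (S.v x s)))
      (S.densT A c k x t) t := by
  have hv := S.hasDerivAt_vt x t ht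
  have hv0 := (S.v_pos x t).ne'
  have h1 := (((((S.u.hasDerivAt_t x t ht).pow 2).add ((S.w₁.hasDerivAt_t x t ht).pow 2)).add
    ((S.w₂.hasDerivAt_t x t ht).pow 2)).add (hv.mul (((S.b₁.hasDerivAt_t x t ht).pow 2).add
    ((S.b₂.hasDerivAt_t x t ht).pow 2)))).const_mul (A / 2)
  have h2 := (hH _ (S.θ_pos x t)).comp t (S.θ.hasDerivAt_t x t ht)
  have h3 := ((hv.sub_const 1).sub (hv.log hv0)).const_mul c
  refine ((h1.add h2).add h3).congr_deriv ?_
  simp only [densT, thf, Pi.add_apply, Pi.pow_apply]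
  field_simp
  ring

lemma hasDerivAt_flux (A c : ℝ) {k k' : ℝ → ℝ} (hk : ∀ y, 0 < y → HasDerivAt k (k' y) y)
    (x t : ℝ) :
    HasDerivAt (fun y => S.flux A k y t)
      (S.densT A c k x t + (A - S.thf k x t) * S.diss x t
        + S.heat x t * (S.thf k' x t * S.θ.fx x t)
        + S.u.fx x t * (A * (1 - S.θ.f x t / S.v x t) + S.thf k x t * S.θ.f x t / S.v x t
          - c * (1 - 1 / S.v x t))) x := by
  have hv0 := (S.v_pos x t).ne'
  have h1 := (S.u.hasDerivAt_x x t).mul ((S.momentum x t).add_const 1)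
  have h2 := (S.w₁.hasDerivAt_x x t).mul (S.transverse₁ x t)
  have h3 := (S.w₂.hasDerivAt_x x t).mul (S.transverse₂ x t)
  have h4 := (S.b₁.hasDerivAt_x x t).mul ((S.magnetic₁ x t).sub (S.w₁.hasDerivAt_x x t))
  have h5 := (S.b₂.hasDerivAt_x x t).mul ((S.magnetic₂ x t).sub (S.w₂.hasDerivAt_x x t))
  have h6 := (S.temperature x t).mul ((hk _ (S.θ_pos x t)).comp x (S.θ.hasDerivAt_x x t))
  have h := (((((h1.add h2).add h3).add h4).add h5).const_mul A).add h6
  refine (h.congr_of_eventuallyEq (Eventually.of_forall fun y => ?_)).congr_deriv ?_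
  · simp only [flux, thf, heat, thp, mu, Pi.add_apply, Pi.mul_apply, Pi.sub_apply, Function.comp_apply]
    ring
  · simp only [densT, thf, diss, heat, thp, mu, Pi.sub_apply, Function.comp_apply]
    field_simp
    ring

end MHDFlow

lemma neg_two_mul_le {φ φ' s y P : ℝ} (hP : 0 < P) :
    -(2 * φ * φ' * (s * y)) ≤ φ ^ 2 * (P * y ^ 2) + φ' ^ 2 * (s ^ 2 / P) := by
  have h : 0 ≤ (φ * P * y + φ' * s) ^ 2 / P := by positivity
  have e : (φ * P * y + φ' * s) ^ 2 / P
      = φ ^ 2 * (P * y ^ 2) + φ' ^ 2 * (s ^ 2 / P) + 2 * φ * φ' * (s * y) := by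
    field_simp
    ring
  linarith

lemma visc_le {α v : ℝ} (hα : 0 ≤ α) (hv : 1 / 2 ≤ v) : visc α v ≤ 1 + α * (1 / 2) ^ (-α) := by
  have := Real.rpow_le_rpow_of_nonpos (by norm_num) hv (neg_nonpos.2 hα)
  unfold visc
  gcongr

lemma one_le_visc {α v : ℝ} (hα : 0 ≤ α) (hv : 0 < v) : 1 ≤ visc α v := by
  have := Real.rpow_nonneg hv.le (-α)
  unfold visc
  nlinarith [mul_nonneg hα this]

namespace MHDFlow

lemma FarFrom.mono {α β T : ℝ} {S : MHDFlow α β T} {N M : ℝ} (h : S.FarFrom N) (hNM : N ≤ M) :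
    S.FarFrom M := fun x t hx => h x t (hNM.trans hx)

lemma exists_farFrom {α β T : ℝ} (S : MHDFlow α β T) : ∃ N, 1 ≤ N ∧ S.FarFrom N := S.far

lemma continuous_densT {α β T : ℝ} (S : MHDFlow α β T) (A c : ℝ) {k : ℝ → ℝ}
    (hk : ContinuousOn k (Ioi 0)) :
    Continuous fun p : ℝ × ℝ => S.densT A c k p.1 p.2 := by
  unfold densT
  fun_prop (disch := intro _; exact (S.v_pos _ _).ne')

set_option maxHeartbeats 1000000 in
/-- Pointwise absorption of the flux in the far field. -/
lemma neg_flux_le {α β : ℝ} (hα : 0 ≤ α) {A : ℝ} (hA : 0 ≤ A) {k k' : ℝ → ℝ}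
    (hk : ContinuousOn k (Ioi 0)) (hk' : ContinuousOn k' (Ioi 0)) (hpos : ∀ y, 0 < y → 0 < k' y) :
    ∃ C, 0 ≤ C ∧ ∀ (T : ℝ) (S : MHDFlow α β T) (N : ℝ), S.FarFrom N → ∀ x t, N ≤ |x| →
      ∀ φ φ' : ℝ, 0 ≤ φ → φ ≤ 1 →
      -(2 * φ * φ' * S.flux A k x t) ≤ φ ^ 2 * (S.diss x t / (1 + S.θ.f x t)
        + 1 / 2 * (S.heat x t * (S.thf k' x t * S.θ.fx x t))) + C * (|φ'| + φ' ^ 2) := by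
  have hcont : ContinuousOn (fun y : ℝ => y ^ β * k y ^ 2 / k' y) (Icc (1 / 2) (3 / 2)) := by
    have hsub : Icc (1 / 2 : ℝ) (3 / 2) ⊆ Ioi 0 := fun y hy => lt_of_lt_of_le (by norm_num) hy.1
    refine ((ContinuousOn.rpow_const continuousOn_id fun y hy =>
      Or.inl (hsub hy).ne').mul ((hk.mono hsub).pow 2)).div (hk'.mono hsub) fun y hy => ?_
    exact (hpos y (hsub hy)).ne'
  obtain ⟨B, hB⟩ := isCompact_Icc.exists_bound_of_continuousOn hcont
  have hB0 : 0 ≤ B := (norm_nonneg _).trans (hB 1 (by norm_num))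
  set m := 1 + α * (1 / 2 : ℝ) ^ (-α) with hm
  have hm1 : 1 ≤ m := by
    have := Real.rpow_nonneg (show (0:ℝ) ≤ 1 / 2 by norm_num) (-α)
    nlinarith [mul_nonneg hα this]
  refine ⟨14 * A + 5 * A ^ 2 * (m + 4) + 4 * B, by positivity, ?_⟩
  intro T S N hN x t hx φ φ' hφ0 hφ1
  obtain ⟨hv, hθ, hu, hw1, hw2, hb1, hb2⟩ := hN x t hx
  have hv0 := S.v_pos x t
  have hθ0 := S.θ_pos x t
  have hmu1 : 1 ≤ S.mu x t := S.one_le_mu hα x t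
  have hmum : S.mu x t ≤ m := visc_le hα (by linarith [(abs_le.1 hv).1])
  have hBt := hB (S.θ.f x t) ⟨by linarith [(abs_le.1 hθ).1], by linarith [(abs_le.1 hθ).2]⟩
  have hk0 := hpos _ hθ0
  have hp0 := S.thp_pos β x t
  change ‖S.thp β x t * _ / _‖ ≤ B at hBt
  rw [Real.norm_of_nonneg (by positivity)] at hBt
  unfold flux heat diss thf
  generalize S.v x t = v at *
  generalize S.θ.f x t = θ at *
  generalize S.u.f x t = u at *
  generalize S.w₁.f x t = w₁ at *
  generalize S.w₂.f x t = w₂ at *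
  generalize S.b₁.f x t = b₁ at *
  generalize S.b₂.f x t = b₂ at *
  generalize S.mu x t = μ at *
  generalize S.thp β x t = p at *
  generalize S.u.fx x t = ux at *
  generalize S.w₁.fx x t = w₁x at *
  generalize S.w₂.fx x t = w₂x at *
  generalize S.b₁.fx x t = b₁x at *
  generalize S.b₂.fx x t = b₂x at *
  generalize S.θ.fx x t = θx at *
  generalize k θ = κ at *
  generalize k' θ = κ' at *
  rw [abs_le] at hv hθ
  have hvl : 1 / 2 ≤ v := by linarith
  have hθu : θ ≤ 3 / 2 := by linarith
  have hr : (1 + θ) / v ≤ 5 := by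
    rw [div_le_iff₀ hv0]; linarith
  have hsq : ∀ z : ℝ, |z| ≤ 1 → z ^ 2 ≤ 1 := fun z hz => by
    rw [← sq_abs]; exact pow_le_one₀ (abs_nonneg _) hz
  have hbound : ∀ z : ℝ, |z| ≤ 1 → φ' ^ 2 * ((A * z / v) ^ 2 / (1 / (v * (1 + θ))))
      ≤ 5 * A ^ 2 * φ' ^ 2 := by
    intro z hz
    have e : (A * z / v) ^ 2 / (1 / (v * (1 + θ))) = A ^ 2 * z ^ 2 * ((1 + θ) / v) := by
      field_simp
    rw [e]
    have : A ^ 2 * z ^ 2 * ((1 + θ) / v) ≤ A ^ 2 * 1 * 5 := by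
      have := hsq z hz
      gcongr
    have := mul_le_mul_of_nonneg_left this (sq_nonneg φ')
    linarith
  have t1 := neg_two_mul_le (φ := φ) (φ' := φ') (s := A * μ * u / v) (y := ux)
    (P := μ / (v * (1 + θ))) (by positivity)
  have t1' : φ' ^ 2 * ((A * μ * u / v) ^ 2 / (μ / (v * (1 + θ)))) ≤ 5 * A ^ 2 * m * φ' ^ 2 := by
    have e : (A * μ * u / v) ^ 2 / (μ / (v * (1 + θ))) = A ^ 2 * u ^ 2 * ((1 + θ) / v) * μ := by
      field_simp
    rw [e]
    have : A ^ 2 * u ^ 2 * ((1 + θ) / v) * μ ≤ A ^ 2 * 1 * 5 * m := by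
      have := hsq u hu
      gcongr
    have := mul_le_mul_of_nonneg_left this (sq_nonneg φ')
    linarith
  have t2 := neg_two_mul_le (φ := φ) (φ' := φ') (s := A * w₁ / v) (y := w₁x)
    (P := 1 / (v * (1 + θ))) (by positivity)
  have t3 := neg_two_mul_le (φ := φ) (φ' := φ') (s := A * w₂ / v) (y := w₂x)
    (P := 1 / (v * (1 + θ))) (by positivity)
  have t4 := neg_two_mul_le (φ := φ) (φ' := φ') (s := A * b₁ / v) (y := b₁x)
    (P := 1 / (v * (1 + θ))) (by positivity)
  have t5 := neg_two_mul_le (φ := φ) (φ' := φ') (s := A * b₂ / v) (y := b₂x)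
    (P := 1 / (v * (1 + θ))) (by positivity)
  have t6 := neg_two_mul_le (φ := φ) (φ' := φ') (s := p * κ / v) (y := θx)
    (P := 1 / 2 * (p * κ' / v)) (by positivity)
  have t6' : φ' ^ 2 * ((p * κ / v) ^ 2 / (1 / 2 * (p * κ' / v))) ≤ 4 * B * φ' ^ 2 := by
    have e : (p * κ / v) ^ 2 / (1 / 2 * (p * κ' / v)) = p * κ ^ 2 / κ' * (2 / v) := by
      field_simp
    rw [e]
    have h2 : 2 / v ≤ 4 := by rw [div_le_iff₀ hv0]; linarith
    have : p * κ ^ 2 / κ' * (2 / v) ≤ B * 4 := by gcongr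
    have := mul_le_mul_of_nonneg_left this (sq_nonneg φ')
    linarith
  have t7 : -(2 * φ * φ' * (A * (u * (1 - θ / v - (b₁ ^ 2 + b₂ ^ 2) / 2) + w₁ * b₁ + w₂ * b₂)))
      ≤ 14 * A * |φ'| := by
    have hq : |1 - θ / v - (b₁ ^ 2 + b₂ ^ 2) / 2| ≤ 3 := by
      have h1 : θ / v ≤ 3 := by rw [div_le_iff₀ hv0]; linarith
      have h2 : 0 ≤ θ / v := by positivity
      have h3 := hsq b₁ hb1
      have h4 := hsq b₂ hb2
      rw [abs_le]
      constructor <;> linarith only [h1, h2, h3, h4, sq_nonneg b₁, sq_nonneg b₂]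
    have hz : |u * (1 - θ / v - (b₁ ^ 2 + b₂ ^ 2) / 2) + w₁ * b₁ + w₂ * b₂| ≤ 7 := by
      have i1 : |u * (1 - θ / v - (b₁ ^ 2 + b₂ ^ 2) / 2)| ≤ 1 * 3 := by
        rw [abs_mul]; gcongr
      have i2 : |w₁ * b₁| ≤ 1 * 1 := by rw [abs_mul]; gcongr
      have i3 : |w₂ * b₂| ≤ 1 * 1 := by rw [abs_mul]; gcongr
      exact (abs_add_three _ _ _).trans (by linarith only [i1, i2, i3])
    refine (neg_le_abs _).trans ?_
    rw [abs_mul, abs_mul, abs_mul, abs_mul, abs_of_nonneg hφ0, abs_of_nonneg hA, abs_two]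
    calc 2 * φ * |φ'| * (A * |u * (1 - θ / v - (b₁ ^ 2 + b₂ ^ 2) / 2) + w₁ * b₁ + w₂ * b₂|)
        ≤ 2 * 1 * |φ'| * (A * 7) := by gcongr
      _ = _ := by ring
  have e1 := hbound w₁ hw1
  have e2 := hbound w₂ hw2
  have e3 := hbound b₁ hb1
  have e4 := hbound b₂ hb2
  have e5 : 0 ≤ 14 * A * φ' ^ 2 := by positivity
  have e6 : 0 ≤ (5 * A ^ 2 * (m + 4) + 4 * B) * |φ'| := by positivity
  have el : -(2 * φ * φ' * (A * (u * (μ * ux / v - θ / v - (b₁ ^ 2 + b₂ ^ 2) / 2 + 1)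
      + w₁ * (w₁x / v + b₁) + w₂ * (w₂x / v + b₂) + b₁ * (b₁x / v) + b₂ * (b₂x / v))
      + p * θx / v * κ))
      = -(2 * φ * φ' * (A * μ * u / v * ux)) + -(2 * φ * φ' * (A * w₁ / v * w₁x))
        + -(2 * φ * φ' * (A * w₂ / v * w₂x)) + -(2 * φ * φ' * (A * b₁ / v * b₁x))
        + -(2 * φ * φ' * (A * b₂ / v * b₂x)) + -(2 * φ * φ' * (p * κ / v * θx))
        + -(2 * φ * φ' * (A * (u * (1 - θ / v - (b₁ ^ 2 + b₂ ^ 2) / 2) + w₁ * b₁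
          + w₂ * b₂))) := by ring
  have er : φ ^ 2 * ((μ * ux ^ 2 + w₁x ^ 2 + w₂x ^ 2 + b₁x ^ 2 + b₂x ^ 2) / v / (1 + θ)
      + 1 / 2 * (p * θx / v * (κ' * θx)))
      = φ ^ 2 * (μ / (v * (1 + θ)) * ux ^ 2) + φ ^ 2 * (1 / (v * (1 + θ)) * w₁x ^ 2)
        + φ ^ 2 * (1 / (v * (1 + θ)) * w₂x ^ 2) + φ ^ 2 * (1 / (v * (1 + θ)) * b₁x ^ 2)
        + φ ^ 2 * (1 / (v * (1 + θ)) * b₂x ^ 2) + φ ^ 2 * (1 / 2 * (p * κ' / v) * θx ^ 2) := by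
    field_simp
  rw [el, er]
  linarith only [t1, t1', t2, t3, t4, t5, t6, t6', t7, e1, e2, e3, e4, e5, e6]

set_option maxHeartbeats 1000000 in
/-- The localized energy inequality obtained by testing the equations with
`A u, A w, A b, h(θ)` and `c (1 - 1 / v)`. -/
lemma energy_inequality {α β : ℝ} (hα : 0 ≤ α) (c₀ : ℝ) {A : ℝ} (hA : 0 ≤ A) (c : ℝ)
    {k k' H : ℝ → ℝ} (hk : ∀ y, 0 < y → HasDerivAt k (k' y) y) (hk' : ContinuousOn k' (Ioi 0))
    (hpos : ∀ y, 0 < y → 0 < k' y) (hH : ∀ y, 0 < y → HasDerivAt H (k y) y) :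
    ∃ C, 0 ≤ C ∧ ∀ (T : ℝ) (S : MHDFlow α β T) (N : ℝ), 0 ≤ N → S.FarFrom N →
      ∀ χ : Cutoff c₀ N, ∀ t ∈ Ioo 0 T, ∃ y',
      HasDerivAt (fun s => ∫ x in (-(N + 1))..(N + 1), χ.φ x ^ 2 * (A / 2 * S.kin x s
        + S.thf H x s + c * (S.v x s - 1 - Real.log (S.v x s)))) y' t ∧
      y' + ∫ x in (-(N + 1))..(N + 1), χ.φ x ^ 2 * ((A - S.thf k x t - 1 / (1 + S.θ.f x t))
          * S.diss x t + 1 / 2 * (S.heat x t * (S.thf k' x t * S.θ.fx x t)))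
        ≤ C + ∫ x in (-(N + 1))..(N + 1), χ.φ x ^ 2 * (-S.u.fx x t *
          (A * (1 - S.θ.f x t / S.v x t) + S.thf k x t * S.θ.f x t / S.v x t
            - c * (1 - 1 / S.v x t))) := by
  have hkc : ContinuousOn k (Ioi 0) := fun y hy => (hk y hy).continuousAt.continuousWithinAt
  have hHc : ContinuousOn H (Ioi 0) := fun y hy => (hH y hy).continuousAt.continuousWithinAt
  obtain ⟨C, hC0, hC⟩ := neg_flux_le (β := β) hα hA hkc hk' hpos
  refine ⟨C * |c₀|, by positivity, ?_⟩
  intro T S N hN0 hN χ t ht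
  have hv0 : ∀ x s, S.v x s ≠ 0 := fun x s => (S.v_pos x s).ne'
  have hχ := χ.cont
  have hχ' := χ.cont'
  have cD := S.continuous_densT A c hkc
  have cDt : Continuous fun x => S.densT A c k x t := cD.comp (by fun_prop : Continuous fun x => (x, t))
  have cθ : ∀ x, 1 + S.θ.f x t ≠ 0 := fun x => by linarith [S.θ_pos x t]
  refine ⟨∫ x in (-(N + 1))..(N + 1), χ.φ x ^ 2 * S.densT A c k x t, ?_, ?_⟩
  · refine hasDerivAt_integral_param (c := 0) (d := T) (f := fun x s => χ.φ x ^ 2 * (A / 2 * S.kin x s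
        + S.thf H x s + c * (S.v x s - 1 - Real.log (S.v x s))))
      (ft := fun x s => χ.φ x ^ 2 * S.densT A c k x s) ?_ ?_ ht ?_
    · fun_prop (disch := intro _; exact hv0 _ _)
    · fun_prop
    · intro x s hs
      exact (S.hasDerivAt_dens A c hH x hs).const_mul _
  · set R : ℝ → ℝ := fun x => (A - S.thf k x t) * S.diss x t
        + S.heat x t * (S.thf k' x t * S.θ.fx x t)
        + S.u.fx x t * (A * (1 - S.θ.f x t / S.v x t) + S.thf k x t * S.θ.f x t / S.v x t
          - c * (1 - 1 / S.v x t)) with hR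
    have hRc : Continuous R := by
      rw [hR]
      fun_prop (disch := intro _; exact hv0 _ _)
    have hder : ∀ x, HasDerivAt (fun y => χ.φ y ^ 2 * S.flux A k y t)
        (2 * χ.φ x * χ.φ' x * S.flux A k x t + χ.φ x ^ 2 * (S.densT A c k x t + R x)) x := by
      intro x
      refine (((χ.hasDerivAt x).pow 2).mul (S.hasDerivAt_flux A c hk x t)).congr_deriv ?_
      simp only [hR, Pi.pow_apply]
      ring
    have cF : Continuous fun x => S.flux A k x t :=
      continuous_iff_continuousAt.2 fun x => (S.hasDerivAt_flux A c hk x t).continuousAt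
    have h0 := integral_of_hasDerivAt (a := -(N + 1)) (b := N + 1) hder (by fun_prop)
    rw [χ.eq_zero (N + 1) (le_abs_self _), χ.eq_zero (-(N + 1)) (by
      rw [abs_neg]; exact le_abs_self _)] at h0
    have hI : ∀ f : ℝ → ℝ, Continuous f → IntervalIntegrable f volume (-(N + 1)) (N + 1) :=
      fun f hf => hf.intervalIntegrable _ _
    have key : ∫ x in (-(N + 1))..(N + 1), (χ.φ x ^ 2 * S.densT A c k x t
          + χ.φ x ^ 2 * ((A - S.thf k x t - 1 / (1 + S.θ.f x t))
          * S.diss x t + 1 / 2 * (S.heat x t * (S.thf k' x t * S.θ.fx x t)))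
          - χ.φ x ^ 2 * (-S.u.fx x t *
          (A * (1 - S.θ.f x t / S.v x t) + S.thf k x t * S.θ.f x t / S.v x t
            - c * (1 - 1 / S.v x t))))
        ≤ ∫ x in (-(N + 1))..(N + 1), ((2 * χ.φ x * χ.φ' x * S.flux A k x t
          + χ.φ x ^ 2 * (S.densT A c k x t + R x)) + C * (|χ.φ' x| + χ.φ' x ^ 2)) := by
      refine integral_mono_cont (by linarith) ?_ (by fun_prop) fun x _ => ?_
      · fun_prop (disch := intro _; first | exact hv0 _ _ | exact cθ _)
      · have : -(2 * χ.φ x * χ.φ' x * S.flux A k x t) ≤ χ.φ x ^ 2 * (S.diss x t / (1 + S.θ.f x t)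
            + 1 / 2 * (S.heat x t * (S.thf k' x t * S.θ.fx x t)))
            + C * (|χ.φ' x| + χ.φ' x ^ 2) := by
          rcases le_total |x| N with hx | hx
          · rw [χ.deriv_eq_zero x hx]
            have h1 := S.diss_nonneg hα x t
            have h2 := S.θ_pos x t
            have h3 := hpos _ h2
            have h4 : 0 ≤ S.heat x t * (S.thf k' x t * S.θ.fx x t) := by
              have := S.thp_pos β x t
              have := S.v_pos x t
              have e : S.heat x t * (S.thf k' x t * S.θ.fx x t)
                = S.thp β x t * S.thf k' x t * S.θ.fx x t ^ 2 / S.v x t := by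
                unfold heat; ring
              rw [e]; positivity
            simp
            positivity
          · exact hC T S N hN x t hx _ _ (χ.nonneg x) (χ.le_one x)
        have e : (A - S.thf k x t - 1 / (1 + S.θ.f x t)) * S.diss x t
          = (A - S.thf k x t) * S.diss x t - S.diss x t / (1 + S.θ.f x t) := by ring
        rw [e]
        simp only [hR]
        linarith
    rw [intervalIntegral.integral_add (hI _ (by fun_prop)) (hI _ (by fun_prop)), h0,
      intervalIntegral.integral_const_mul, intervalIntegral.integral_sub
        (hI _ ?_) (hI _ ?_), intervalIntegral.integral_add (hI _ ?_) (hI _ ?_)] at key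
    · have h5 : C * (∫ x in (-(N + 1))..(N + 1), (|χ.φ' x| + χ.φ' x ^ 2)) ≤ C * |c₀| := by
        gcongr
        exact χ.integral_le.trans (le_abs_self _)
      linarith
    all_goals fun_prop (disch := intro _; first | exact hv0 _ _ | exact cθ _)

end MHDFlow

lemma sub_one_sub_log_nonneg {y : ℝ} (hy : 0 < y) : 0 ≤ y - 1 - Real.log y := by
  linarith [Real.log_le_sub_one_of_pos hy]

lemma sub_one_sub_log_le {y δ : ℝ} (hδ : 0 < δ) (hy : δ ≤ y) :
    y - 1 - Real.log y ≤ (y - 1) ^ 2 / δ := by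
  have hy0 : 0 < y := hδ.trans_le hy
  have h1 := Real.one_sub_inv_le_log_of_pos hy0
  have h2 : (y - 1) ^ 2 / y ≤ (y - 1) ^ 2 / δ := by gcongr
  have h3 : (y - 1) ^ 2 / y = y - 1 - (1 - y⁻¹) := by
    field_simp
  linarith

lemma Cutoff.integral_le_of_abs_le {c₀ N : ℝ} (χ : Cutoff c₀ N) {a b : ℝ} (hab : a ≤ b)
    (ha : |a| ≤ N) (hb : |b| ≤ N) {f : ℝ → ℝ} (hf : Continuous f) (h0 : ∀ x, 0 ≤ f x) :
    ∫ x in a..b, f x ≤ ∫ x in (-(N + 1))..(N + 1), χ.φ x ^ 2 * f x := by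
  rw [abs_le] at ha hb
  have hc := χ.cont
  calc ∫ x in a..b, f x = ∫ x in a..b, χ.φ x ^ 2 * f x := by
        refine intervalIntegral.integral_congr fun x hx => ?_
        rw [uIcc_of_le hab] at hx
        rw [χ.eq_one x (abs_le.2 ⟨by linarith [hx.1], by linarith [hx.2]⟩)]
        ring
    _ ≤ _ := integral_mono_domain (by linarith) hab (by linarith) (by fun_prop)
        fun x => mul_nonneg (sq_nonneg _) (h0 x)

namespace MHDFlow

variable {α β T : ℝ}

/-- The sum of the squared first derivatives of `u, w, b`. -/
def grad (S : MHDFlow α β T) (x t : ℝ) : ℝ := S.u.fx x t ^ 2 + S.w₁.fx x t ^ 2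
  + S.w₂.fx x t ^ 2 + S.b₁.fx x t ^ 2 + S.b₂.fx x t ^ 2

/-- The squared norm of the transverse magnetic field. -/
def bsq (S : MHDFlow α β T) (x t : ℝ) : ℝ := S.b₁.f x t ^ 2 + S.b₂.f x t ^ 2

section

variable (S : MHDFlow α β T) {X : Type*} [TopologicalSpace X] {g h : X → ℝ}

@[fun_prop]
lemma continuous_grad (hg : Continuous g) (hh : Continuous h) :
    Continuous fun x => S.grad (g x) (h x) := by
  unfold grad
  fun_prop

@[fun_prop]
lemma continuous_bsq (hg : Continuous g) (hh : Continuous h) :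
    Continuous fun x => S.bsq (g x) (h x) := by
  unfold bsq
  fun_prop

lemma grad_nonneg (x t : ℝ) : 0 ≤ S.grad x t := by
  unfold grad
  positivity

lemma bsq_nonneg (x t : ℝ) : 0 ≤ S.bsq x t := by
  unfold bsq
  positivity

end

/-- Admissibility of the initial data of a flow. -/
structure Adm (S : MHDFlow α β T) (K δ : ℝ) : Prop where
  bound : ∀ a b, a ≤ b → ∫ x in a..b, ((S.v x 0 - 1) ^ 2 + S.u.f x 0 ^ 2 + (S.θ.f x 0 - 1) ^ 2
    + S.bsq x 0 + (S.w₁.f x 0 ^ 2 + S.w₂.f x 0 ^ 2) + S.vx x 0 ^ 2 + S.θ.fx x 0 ^ 2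
    + S.grad x 0) ≤ K ^ 2
  le_v : ∀ x, δ ≤ S.v x 0
  le_θ : ∀ x, δ ≤ S.θ.f x 0

/-- The entropy density. -/
def ent (S : MHDFlow α β T) (x t : ℝ) : ℝ := 1 / 2 * S.kin x t
  + (S.θ.f x t - 1 - Real.log (S.θ.f x t)) + 1 * (S.v x t - 1 - Real.log (S.v x t))

@[fun_prop]
lemma continuous_ent (S : MHDFlow α β T) {X : Type*} [TopologicalSpace X] {g h : X → ℝ}
    (hg : Continuous g) (hh : Continuous h) : Continuous fun x => S.ent (g x) (h x) := by
  unfold ent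
  fun_prop (disch := intro _; first | exact (S.v_pos _ _).ne' | exact (S.θ_pos _ _).ne')

lemma ent_nonneg (S : MHDFlow α β T) (x t : ℝ) : 0 ≤ S.ent x t := by
  have h1 := S.kin_nonneg x t
  have h2 := sub_one_sub_log_nonneg (S.v_pos x t)
  have h3 := sub_one_sub_log_nonneg (S.θ_pos x t)
  unfold ent
  positivity

lemma Adm.v_le {S : MHDFlow α β T} {K δ : ℝ} (hS : S.Adm K δ) (hK : 0 < K) (x : ℝ) :
    S.v x 0 ≤ 1 + 2 * K := by
  have hI : ∀ f : ℝ → ℝ, Continuous f → (∀ z, f z ≤ (S.v z 0 - 1) ^ 2 + S.u.f z 0 ^ 2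
      + (S.θ.f z 0 - 1) ^ 2 + S.bsq z 0 + (S.w₁.f z 0 ^ 2 + S.w₂.f z 0 ^ 2) + S.vx z 0 ^ 2
      + S.θ.fx z 0 ^ 2 + S.grad z 0) → ∫ z in x..(x + 1), f z ≤ K ^ 2 := fun f hf h =>
    (integral_mono_cont (by linarith) hf (by fun_prop) fun z _ => h z).trans
      (hS.bound x (x + 1) (by linarith))
  have hpos : ∀ z, 0 ≤ S.bsq z 0 ∧ 0 ≤ S.grad z 0 := fun z =>
    ⟨S.bsq_nonneg z 0, S.grad_nonneg z 0⟩
  have h1 := hI (fun z => (S.v z 0 - 1) ^ 2) (by fun_prop) fun z => by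
    have := hpos z
    nlinarith [sq_nonneg (S.u.f z 0), sq_nonneg (S.θ.f z 0 - 1), sq_nonneg (S.w₁.f z 0),
      sq_nonneg (S.w₂.f z 0), sq_nonneg (S.vx z 0), sq_nonneg (S.θ.fx z 0)]
  have h2 := hI (fun z => S.vx z 0 ^ 2 / 1) (by fun_prop) fun z => by
    have := hpos z
    nlinarith [sq_nonneg (S.u.f z 0), sq_nonneg (S.θ.f z 0 - 1), sq_nonneg (S.w₁.f z 0),
      sq_nonneg (S.w₂.f z 0), sq_nonneg (S.v z 0 - 1), sq_nonneg (S.θ.fx z 0)]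
  obtain ⟨y, hy, hy1⟩ := exists_le_of_integral_le (by fun_prop) h1
  have h3 := sq_le_of_weighted (r := fun z => S.v z 0 - 1) (r' := fun z => S.vx z 0)
    (g := fun _ => 1) (fun z => (S.hasDerivAt_vx z 0).sub_const 1) (by fun_prop) (by fun_prop)
    (fun _ => one_pos) (x := x) ⟨le_rfl, by linarith⟩ hy
  simp only [intervalIntegral.integral_const, add_sub_cancel_left, smul_eq_mul, mul_one] at h3
  have h4 : (S.v x 0 - 1) ^ 2 ≤ (2 * K) ^ 2 := by nlinarith
  linarith [abs_le_of_sq_le_sq' h4 (by positivity)]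

/-- The basic entropy estimate. -/
lemma exists_entropy_bound (hα : 0 ≤ α) (hT : 0 < T) {K δ : ℝ} (hK : 0 < K) (hδ : 0 < δ) :
    ∃ E, 1 ≤ E ∧ ∀ S : MHDFlow α β T, S.Adm K δ → ∀ t ∈ Icc 0 T, ∀ a b, a ≤ b →
      ∫ x in a..b, S.ent x t ≤ E := by
  obtain ⟨c₀, hc₀, hcut⟩ := exists_cutoff
  have hk : ∀ y : ℝ, 0 < y → HasDerivAt (fun y => 1 - y⁻¹) (y ^ 2)⁻¹ y := fun y hy =>
    ((hasDerivAt_inv hy.ne').const_sub 1).congr_deriv (neg_neg _)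
  have hH : ∀ y : ℝ, 0 < y → HasDerivAt (fun y => y - 1 - Real.log y) (1 - y⁻¹) y :=
    fun y hy => ((hasDerivAt_id y).sub_const 1).sub (Real.hasDerivAt_log hy.ne')
  have hk' : ContinuousOn (fun y : ℝ => (y ^ 2)⁻¹) (Ioi 0) :=
    (continuousOn_pow 2).inv₀ fun y hy => pow_ne_zero 2 (ne_of_gt hy)
  obtain ⟨C, hC0, hC⟩ := energy_inequality (β := β) hα c₀ zero_le_one 1 hk
    hk' (fun y hy => by positivity) hH
  refine ⟨(1 + (1 + 2 * K + 1 / δ) * K ^ 2) * Real.exp (C * T), ?_, ?_⟩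
  · have := Real.one_le_exp (show 0 ≤ C * T by positivity)
    have : 0 ≤ (1 + 2 * K + 1 / δ) * K ^ 2 := by positivity
    nlinarith
  intro S hS t ht a b hab
  obtain ⟨N₀, hN₀, hfar⟩ := S.exists_farFrom
  set N := max N₀ (max |a| |b|) with hN
  have hNN : N₀ ≤ N := le_max_left _ _
  obtain ⟨χ⟩ := hcut N (by linarith)
  have hχ := χ.cont
  have main := gronwall_dissipative (M := C * T) hT.le
    (y := fun s => ∫ x in (-(N + 1))..(N + 1), χ.φ x ^ 2 * S.ent x s)
    (d := fun _ => 0) (g := fun _ => C) (continuous_integral_left (by fun_prop)) (by fun_prop)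
    (by fun_prop) (fun _ => le_rfl) (fun _ => hC0)
    (fun s => integral_nonneg_Icc (by linarith) fun x _ =>
      mul_nonneg (sq_nonneg _) (S.ent_nonneg x s)) (fun s hs => by
      obtain ⟨y', h1, h2⟩ := hC T S N (by linarith) (hfar.mono hNN) χ s hs
      refine ⟨y', h1, ?_⟩
      have e1 : ∫ x in (-(N + 1))..(N + 1), χ.φ x ^ 2 * (-S.u.fx x s *
          (1 * (1 - S.θ.f x s / S.v x s) + S.thf (fun y => 1 - y⁻¹) x s * S.θ.f x s / S.v x s
            - 1 * (1 - 1 / S.v x s))) = 0 := by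
        rw [← intervalIntegral.integral_zero (a := -(N + 1)) (b := N + 1)]
        refine intervalIntegral.integral_congr fun x _ => ?_
        have := (S.v_pos x s).ne'
        have := (S.θ_pos x s).ne'
        simp only [thf]
        field_simp
        ring
      have e2 : 0 ≤ ∫ x in (-(N + 1))..(N + 1), χ.φ x ^ 2 * ((1 - S.thf (fun y => 1 - y⁻¹) x s
          - 1 / (1 + S.θ.f x s)) * S.diss x s
          + 1 / 2 * (S.heat x s * (S.thf (fun y => (y ^ 2)⁻¹) x s * S.θ.fx x s))) := by
        refine integral_nonneg_Icc (by linarith) fun x _ => ?_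
        have h3 := S.θ_pos x s
        have h4 := S.diss_nonneg hα x s
        have h5 : 0 ≤ 1 - S.thf (fun y => 1 - y⁻¹) x s - 1 / (1 + S.θ.f x s) := by
          have : 1 / (1 + S.θ.f x s) ≤ 1 / S.θ.f x s :=
            one_div_le_one_div_of_le h3 (by linarith)
          rw [one_div (S.θ.f x s)] at this
          simp only [thf]
          linarith
        have h6 : 0 ≤ S.heat x s * (S.thf (fun y => (y ^ 2)⁻¹) x s * S.θ.fx x s) := by
          have := S.thp_pos β x s
          have := S.v_pos x s
          have e : S.heat x s * (S.thf (fun y => (y ^ 2)⁻¹) x s * S.θ.fx x s)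
            = S.thp β x s * S.θ.fx x s ^ 2 / (S.v x s * S.θ.f x s ^ 2) := by
            unfold heat thf
            field_simp
          rw [e]
          positivity
        positivity
      have e3 : 0 ≤ ∫ x in (-(N + 1))..(N + 1), χ.φ x ^ 2 * S.ent x s :=
        integral_nonneg_Icc (by linarith) fun x _ =>
          mul_nonneg (sq_nonneg _) (S.ent_nonneg x s)
      nlinarith) (by simp [mul_comm]) t ht
  simp only [intervalIntegral.integral_zero, add_zero] at main
  have ha : |a| ≤ N := (le_max_left _ _).trans (le_max_right _ _)
  have hb : |b| ≤ N := (le_max_right _ _).trans (le_max_right _ _)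
  refine (χ.integral_le_of_abs_le hab ha hb (by fun_prop) fun x => S.ent_nonneg x t).trans
    (main.trans ?_)
  gcongr
  calc ∫ x in (-(N + 1))..(N + 1), χ.φ x ^ 2 * S.ent x 0
      ≤ ∫ x in (-(N + 1))..(N + 1), (1 + 2 * K + 1 / δ) * ((S.v x 0 - 1) ^ 2 + S.u.f x 0 ^ 2
        + (S.θ.f x 0 - 1) ^ 2 + S.bsq x 0 + (S.w₁.f x 0 ^ 2 + S.w₂.f x 0 ^ 2) + S.vx x 0 ^ 2
        + S.θ.fx x 0 ^ 2 + S.grad x 0) := by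
        refine integral_mono_cont (by linarith) (by fun_prop) (by fun_prop) fun x _ => ?_
        have h1 : χ.φ x ^ 2 * S.ent x 0 ≤ S.ent x 0 :=
          mul_le_of_le_one_left (S.ent_nonneg x 0) (pow_le_one₀ (χ.nonneg x) (χ.le_one x))
        refine h1.trans ?_
        have h2 := sub_one_sub_log_le hδ (hS.le_v x)
        have h3 := sub_one_sub_log_le hδ (hS.le_θ x)
        have h4 : S.v x 0 * S.bsq x 0 ≤ (1 + 2 * K) * S.bsq x 0 :=
          mul_le_mul_of_nonneg_right (hS.v_le hK x) (S.bsq_nonneg x 0)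
        have h5 := S.grad_nonneg x 0
        have h6 := S.bsq_nonneg x 0
        have h7 : 0 < 1 / δ := by positivity
        unfold ent kin
        rw [← bsq]
        rw [div_eq_mul_one_div] at h2 h3
        generalize 1 / δ = r at *
        have q1 : 0 ≤ r * (S.u.f x 0 ^ 2 + S.bsq x 0 + (S.w₁.f x 0 ^ 2 + S.w₂.f x 0 ^ 2)
          + S.vx x 0 ^ 2 + S.θ.fx x 0 ^ 2 + S.grad x 0) := by positivity
        have q2 : 0 ≤ (1 + 2 * K) * ((S.v x 0 - 1) ^ 2 + (S.θ.f x 0 - 1) ^ 2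
          + S.vx x 0 ^ 2 + S.θ.fx x 0 ^ 2 + S.grad x 0) := by positivity
        have q3 : 0 ≤ (1 + 4 * K) * (S.u.f x 0 ^ 2 + (S.w₁.f x 0 ^ 2 + S.w₂.f x 0 ^ 2)) := by
          positivity
        have q4 : 0 ≤ (1 + 2 * K) * S.bsq x 0 := by positivity
        linarith
    _ ≤ _ := by
        rw [intervalIntegral.integral_const_mul]
        gcongr
        exact hS.bound _ _ (by linarith)

end MHDFlow

lemma le_two_mul_sub_log {y : ℝ} (hy : 0 < y) : y ≤ 2 * (y - 1 - Real.log y) + 2 := by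
  have h1 := Real.log_le_sub_one_of_pos (show 0 < y / 2 by positivity)
  have h2 := Real.log_two_lt_d9
  rw [Real.log_div hy.ne' two_ne_zero] at h1
  linarith

namespace MHDFlow

variable {α β T : ℝ}

/-- The sum of the thermal and the magnetic pressure. -/
def press (S : MHDFlow α β T) (x t : ℝ) : ℝ := S.θ.f x t / S.v x t + S.bsq x t / 2

/-- The time integral of the pressure. -/
def pot (S : MHDFlow α β T) (x t : ℝ) : ℝ := ∫ s in (0:ℝ)..t, S.press x s

/-- A primitive of `μ(v) / v`. -/
def lv (S : MHDFlow α β T) (x t : ℝ) : ℝ := Real.log (S.v x t) - S.v x t ^ (-α)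

section

variable (S : MHDFlow α β T) {X : Type*} [TopologicalSpace X] {g h : X → ℝ}

@[fun_prop]
lemma continuous_press (hg : Continuous g) (hh : Continuous h) :
    Continuous fun x => S.press (g x) (h x) := by
  unfold press
  fun_prop (disch := intro _; exact (S.v_pos _ _).ne')

@[fun_prop]
lemma continuous_pot (hg : Continuous g) (hh : Continuous h) :
    Continuous fun x => S.pot (g x) (h x) :=
  intervalIntegral.continuous_parametric_intervalIntegral_of_continuous
    (f := fun x s => S.press (g x) s) (by unfold Function.uncurry; fun_prop) hh

@[fun_prop]
lemma continuous_lv (hg : Continuous g) (hh : Continuous h) :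
    Continuous fun x => S.lv (g x) (h x) := by
  have := (S.continuous_v hg hh).rpow_const (p := -α) fun _ => Or.inl (S.v_pos _ _).ne'
  unfold lv
  fun_prop (disch := intro _; exact (S.v_pos _ _).ne')

lemma press_nonneg (x t : ℝ) : 0 ≤ S.press x t := by
  have := S.v_pos x t
  have := S.θ_pos x t
  have := S.bsq_nonneg x t
  unfold press
  positivity

lemma pot_nonneg (x : ℝ) {t : ℝ} (ht : 0 ≤ t) : 0 ≤ S.pot x t :=
  integral_nonneg_Icc ht fun _ _ => S.press_nonneg _ _

lemma pot_zero (x : ℝ) : S.pot x 0 = 0 := intervalIntegral.integral_same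

lemma hasDerivAt_pot (x t : ℝ) : HasDerivAt (fun s => S.pot x s) (S.press x t) t :=
  hasDerivAt_integral_upper (by fun_prop) 0 t

lemma hasDerivAt_lv (x : ℝ) {t : ℝ} (ht : t ∈ Ioo 0 T) :
    HasDerivAt (fun s => S.lv x s) (S.mu x t * S.u.fx x t / S.v x t) t := by
  have hv := S.hasDerivAt_vt x t ht
  have hv0 := (S.v_pos x t).ne'
  refine ((hv.log hv0).sub (hv.rpow_const (p := -α) (Or.inl hv0))).congr_deriv ?_
  rw [Real.rpow_sub_one hv0, mu, visc]
  field_simp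
  ring

lemma exp_lv (x t : ℝ) : Real.exp (S.lv x t) = S.v x t * Real.exp (-S.v x t ^ (-α)) := by
  rw [lv, sub_eq_add_neg, Real.exp_add, Real.exp_log (S.v_pos x t)]

lemma exp_lv_le (x t : ℝ) : Real.exp (S.lv x t) ≤ S.v x t := by
  rw [exp_lv]
  refine mul_le_of_le_one_right (S.v_pos x t).le (Real.exp_le_one_iff.2 ?_)
  linarith [Real.rpow_nonneg (S.v_pos x t).le (-α)]

/-- The conservation law behind the representation of the specific volume. -/
lemma lv_sub_pot_eq (x y : ℝ) {t : ℝ} (ht : t ∈ Icc 0 T) :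
    (S.lv y t - S.pot y t) - (S.lv x t - S.pot x t) - ∫ z in x..y, S.u.f z t
      = S.lv y 0 - S.lv x 0 - ∫ z in x..y, S.u.f z 0 := by
  set q : ℝ → ℝ := fun s => (S.lv y s - S.pot y s) - (S.lv x s - S.pot x s)
    - ∫ z in x..y, S.u.f z s with hq
  have hc : Continuous q := by
    have : Continuous fun s => ∫ z in x..y, S.u.f z s := continuous_integral_left (by fun_prop)
    fun_prop
  have hd : ∀ s ∈ Ioo 0 T, HasDerivAt q 0 s := by
    intro s hs
    have h1 := ((((S.hasDerivAt_lv y hs).sub (S.hasDerivAt_pot y s)).sub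
      ((S.hasDerivAt_lv x hs).sub (S.hasDerivAt_pot x s))).sub
      (hasDerivAt_integral_param (a := x) (b := y) (by fun_prop) (by fun_prop) hs
        fun z r hr => S.u.hasDerivAt_t z r hr))
    refine h1.congr_deriv ?_
    rw [integral_of_hasDerivAt (fun z => S.momentum z s) (by fun_prop)]
    simp only [press, mu, bsq]
    ring
  have h2 : ∀ s ∈ Icc 0 T, q s = q 0 := by
    refine constant_of_has_deriv_right_zero hc.continuousOn ?_
    intro s hs
    rcases eq_or_lt_of_le hs.1 with h | h
    · subst h
      have hT := hs.2
      refine (hasDerivWithinAt_Ioi_iff_Ici.1 ?_)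
      refine hasDerivWithinAt_Ioi_iff_Ici.2 (hasDerivWithinAt_Ici_of_tendsto_deriv (s := Ioo 0 T)
        (fun r hr => (hd r hr).differentiableAt.differentiableWithinAt) hc.continuousWithinAt
        (Ioo_mem_nhdsGT hT) ?_)
      refine tendsto_const_nhds.congr' ?_
      filter_upwards [Ioo_mem_nhdsGT hT] with r hr
      exact (hd r hr).deriv.symm
    · exact (hd s ⟨h, hs.2⟩).hasDerivWithinAt
  have h3 := h2 t ht
  simp only [hq, pot_zero, sub_zero] at h3
  exact h3

lemma theta_le (x t : ℝ) : S.θ.f x t ≤ 2 * S.ent x t + 2 := by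
  have := le_two_mul_sub_log (S.θ_pos x t)
  have := S.kin_nonneg x t
  have := sub_one_sub_log_nonneg (S.v_pos x t)
  unfold ent
  linarith

lemma v_le (x t : ℝ) : S.v x t ≤ 2 * S.ent x t + 2 := by
  have := le_two_mul_sub_log (S.v_pos x t)
  have := S.kin_nonneg x t
  have := sub_one_sub_log_nonneg (S.θ_pos x t)
  unfold ent
  linarith

lemma u_sq_le (x t : ℝ) : S.u.f x t ^ 2 ≤ 2 * S.ent x t := by
  have := sub_one_sub_log_nonneg (S.v_pos x t)
  have := sub_one_sub_log_nonneg (S.θ_pos x t)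
  have := mul_nonneg (S.v_pos x t).le (S.bsq_nonneg x t)
  unfold ent kin
  rw [← bsq]
  nlinarith [sq_nonneg (S.w₁.f x t), sq_nonneg (S.w₂.f x t)]

lemma v_mul_bsq_le (x t : ℝ) : S.v x t * S.bsq x t ≤ 2 * S.ent x t := by
  have := sub_one_sub_log_nonneg (S.v_pos x t)
  have := sub_one_sub_log_nonneg (S.θ_pos x t)
  unfold ent kin
  rw [← bsq]
  nlinarith [sq_nonneg (S.w₁.f x t), sq_nonneg (S.w₂.f x t), sq_nonneg (S.u.f x t)]

lemma exp_lv_ge (hα : 0 ≤ α) {E : ℝ} (hE : 0 < E) (x t : ℝ) :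
    Real.exp (-(1 + 2 * E)) * Real.exp (-Real.exp (-(1 + 2 * E)) ^ (-α))
      * (1 - S.ent x t / (2 * E)) ≤ Real.exp (S.lv x t) := by
  set c := Real.exp (-(1 + 2 * E)) with hc
  have hc0 : 0 < c := Real.exp_pos _
  have hv := S.v_pos x t
  rcases le_total c (S.v x t) with h | h
  · rw [exp_lv]
    have h1 : S.v x t ^ (-α) ≤ c ^ (-α) := Real.rpow_le_rpow_of_nonpos hc0 h (neg_nonpos.2 hα)
    have h2 : 1 - S.ent x t / (2 * E) ≤ 1 := by
      have := S.ent_nonneg x t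
      have : 0 ≤ S.ent x t / (2 * E) := by positivity
      linarith
    calc _ ≤ c * Real.exp (-c ^ (-α)) * 1 := by gcongr
      _ ≤ _ := by rw [mul_one]; gcongr
  · have h1 : 1 - S.ent x t / (2 * E) ≤ 0 := by
      rw [sub_nonpos, le_div_iff₀ (by positivity)]
      have h2 := Real.log_le_log hv h
      rw [hc, Real.log_exp] at h2
      have := S.kin_nonneg x t
      have := sub_one_sub_log_nonneg (S.θ_pos x t)
      unfold ent
      linarith
    exact (mul_nonpos_of_nonneg_of_nonpos (by positivity) h1).trans (Real.exp_pos _).le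

end

/-- The spatial oscillation of the modified potential is bounded on unit intervals. -/
lemma exists_lv_osc_bound (hα : 0 ≤ α) (hT : 0 < T) {K δ : ℝ} (hK : 0 < K) (hδ : 0 < δ) :
    ∃ lam, 0 ≤ lam ∧ ∀ S : MHDFlow α β T, S.Adm K δ → ∀ t ∈ Icc 0 T, ∀ x y,
      y ∈ Icc x (x + 1) →
      |(S.lv y t - S.pot y t) - (S.lv x t - S.pot x t)| ≤ lam := by
  obtain ⟨E, hE1, hE⟩ := exists_entropy_bound (β := β) hα hT hK hδ
  have hd0 : 0 < δ ^ (-α) := Real.rpow_pos_of_pos hδ _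
  set B := |Real.log δ| + |Real.log (1 + 2 * K)| + δ ^ (-α) with hB
  refine ⟨2 * B + (1 + 2 * E), by positivity, ?_⟩
  intro S hS t ht x y hy
  have h1 := S.lv_sub_pot_eq x y ht
  have h2 : ∀ z, |S.lv z 0| ≤ B := by
    intro z
    have hv := S.v_pos z 0
    have i1 := Real.log_le_log hδ (hS.le_v z)
    have i2 := Real.log_le_log hv (hS.v_le hK z)
    have i3 := Real.rpow_le_rpow_of_nonpos hδ (hS.le_v z) (neg_nonpos.2 hα)
    have i4 := Real.rpow_nonneg hv.le (-α)
    have i5 := neg_abs_le (Real.log δ)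
    have i6 := le_abs_self (Real.log (1 + 2 * K))
    have i7 := abs_nonneg (Real.log δ)
    have i8 := abs_nonneg (Real.log (1 + 2 * K))
    rw [abs_le, lv]
    constructor <;> linarith
  have h3 : ∀ s ∈ Icc 0 T, |∫ z in x..y, S.u.f z s| ≤ 1 / 2 * (1 + 2 * E) := by
    intro s hs
    have e1 := hE S hS s hs x y hy.1
    have e2 : |∫ z in x..y, S.u.f z s| ≤ ∫ z in x..y, |S.u.f z s| :=
      intervalIntegral.abs_integral_le_integral_abs hy.1
    have e3 : ∫ z in x..y, |S.u.f z s| ≤ ∫ z in x..y, (1 / 2 + S.ent z s) := by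
      refine integral_mono_cont hy.1 (by fun_prop) (by fun_prop) fun z _ => ?_
      have := S.u_sq_le z s
      nlinarith [sq_nonneg (|S.u.f z s| - 1), sq_abs (S.u.f z s)]
    rw [intervalIntegral.integral_add (by simp) (Continuous.intervalIntegrable (by fun_prop) _ _),
      intervalIntegral.integral_const, smul_eq_mul] at e3
    have := hy.2
    linarith
  have h4 := h3 t ht
  have h5 := h3 0 ⟨le_rfl, hT.le⟩
  have h6 := h2 x
  have h7 := h2 y
  rw [abs_le] at *
  constructor <;> linarith

/-- Pointwise lower bound of the specific volume and its comparison with the exponential of the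
time-integrated pressure. -/
lemma exists_v_bound (hα : 0 ≤ α) (hT : 0 < T) {K δ : ℝ} (hK : 0 < K) (hδ : 0 < δ) :
    ∃ C, 1 ≤ C ∧ ∀ S : MHDFlow α β T, S.Adm K δ → ∀ t ∈ Icc 0 T, ∀ x,
      1 ≤ C * S.v x t ∧ S.v x t ≤ C * Real.exp (S.pot x t)
        ∧ Real.exp (S.pot x t) ≤ C * S.v x t := by
  obtain ⟨E, hE1, hE⟩ := exists_entropy_bound (β := β) hα hT hK hδ
  obtain ⟨lam, hlam, hosc⟩ := exists_lv_osc_bound (β := β) hα hT hK hδ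
  set c₁ := Real.exp (-(1 + 2 * E)) * Real.exp (-Real.exp (-(1 + 2 * E)) ^ (-α)) with hc₁
  have hc₁0 : 0 < c₁ := by positivity
  set L := Real.exp lam with hL
  have hL1 : 1 ≤ L := Real.one_le_exp hlam
  set G := L * (3 * E + 2) * (2 * L / c₁) with hG
  set M := 2 * Real.exp (G * T) * (2 * L / c₁) with hM
  have hM0 : 0 < M := by positivity
  set M₁ := L * (2 * E + 2) with hM₁
  set M₂ := M₁ * Real.exp ((M⁻¹) ^ (-α)) with hM₂
  have main : ∀ S : MHDFlow α β T, S.Adm K δ → ∀ t ∈ Icc 0 T, ∀ x,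
      1 ≤ M * Real.exp (S.lv x t - S.pot x t) ∧ Real.exp (S.lv x t - S.pot x t) ≤ M₁ := by
    intro S hS t ht x
    have hx1 : x ≤ x + 1 := by linarith
    have hent : ∀ s ∈ Icc 0 T, ∫ z in x..(x + 1), S.ent z s ≤ E := fun s hs =>
      hE S hS s hs x (x + 1) hx1
    have hlin : ∀ s ∈ Icc 0 T, ∀ p q : ℝ, 0 ≤ p → ∫ z in x..(x + 1), (p * S.ent z s + q) ≤ p * E + q := by
      intro s hs p q hp
      rw [intervalIntegral.integral_add (Continuous.intervalIntegrable (by fun_prop) _ _) (by simp),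
        intervalIntegral.integral_const_mul, intervalIntegral.integral_const]
      simp only [add_sub_cancel_left, smul_eq_mul, one_mul]
      gcongr
      exact hent s hs
    have hup : ∀ s ∈ Icc 0 T, ∀ z ∈ Icc x (x + 1),
        Real.exp (S.lv z s - S.pot z s) ≤ L * Real.exp (S.lv x s - S.pot x s) := by
      intro s hs z hz
      rw [hL, ← Real.exp_add]
      have := (abs_le.1 (hosc S hS s hs x z hz)).2
      exact Real.exp_le_exp.2 (by linarith)
    have hlo : ∀ s ∈ Icc 0 T, ∀ z ∈ Icc x (x + 1),
        Real.exp (S.lv x s - S.pot x s) ≤ L * Real.exp (S.lv z s - S.pot z s) := by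
      intro s hs z hz
      rw [hL, ← Real.exp_add]
      have := (abs_le.1 (hosc S hS s hs x z hz)).1
      exact Real.exp_le_exp.2 (by linarith)
    have hsplit : ∀ z s, Real.exp (S.lv z s)
        = Real.exp (S.lv z s - S.pot z s) * Real.exp (S.pot z s) := fun z s => by
      rw [← Real.exp_add]; ring_nf
    have hI : ∀ s ∈ Icc 0 T, 1 ≤ 2 * L / c₁ * Real.exp (S.lv x s - S.pot x s)
        * ∫ z in x..(x + 1), Real.exp (S.pot z s) := by
      intro s hs
      have e1 : ∫ z in x..(x + 1), c₁ * (1 - S.ent z s / (2 * E))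
          ≤ ∫ z in x..(x + 1), L * Real.exp (S.lv x s - S.pot x s) * Real.exp (S.pot z s) := by
        refine integral_mono_cont hx1 (by fun_prop) (by fun_prop) fun z hz => ?_
        refine (S.exp_lv_ge hα (by linarith) z s).trans ?_
        rw [hsplit]
        gcongr
        exact hup s hs z hz
      rw [intervalIntegral.integral_const_mul, intervalIntegral.integral_const_mul,
        intervalIntegral.integral_sub (by simp) (Continuous.intervalIntegrable (by fun_prop) _ _),
        intervalIntegral.integral_const, intervalIntegral.integral_div] at e1
      simp only [add_sub_cancel_left, smul_eq_mul, one_mul] at e1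
      have e2 : (∫ z in x..(x + 1), S.ent z s) / (2 * E) ≤ 1 / 2 := by
        rw [div_le_iff₀ (by linarith)]
        linarith [hent s hs]
      have e3 : c₁ * (1 / 2) ≤ c₁ * (1 - (∫ z in x..(x + 1), S.ent z s) / (2 * E)) := by
        gcongr
        linarith
      have e4 : 2 * L / c₁ * Real.exp (S.lv x s - S.pot x s)
        * ∫ z in x..(x + 1), Real.exp (S.pot z s) = 2 / c₁ * (L * Real.exp (S.lv x s - S.pot x s)
        * ∫ z in x..(x + 1), Real.exp (S.pot z s)) := by ring
      rw [e4]
      calc (1:ℝ) = 2 / c₁ * (c₁ * (1 / 2)) := by field_simp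
        _ ≤ _ := mul_le_mul_of_nonneg_left (e3.trans e1) (by positivity)
    have hS : ∀ s ∈ Icc 0 T, ∫ z in x..(x + 1), Real.exp (S.pot z s) ≤ 2 * Real.exp (G * T) := by
      intro s hs
      have hcy : Continuous fun s => ∫ z in x..(x + 1), Real.exp (S.pot z s) :=
        continuous_integral_left (by fun_prop)
      have hy0 : ∀ s, 0 ≤ ∫ z in x..(x + 1), Real.exp (S.pot z s) := fun s =>
        integral_nonneg_Icc hx1 fun z _ => (Real.exp_pos _).le
      have h := gronwall_dissipative (M := G * T) hT.le
        (y := fun s => ∫ z in x..(x + 1), Real.exp (S.pot z s)) (d := fun _ => 0) (g := fun _ => G)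
        hcy (by fun_prop) (by fun_prop) (fun _ => le_rfl) (fun _ => by positivity) hy0
        (fun r hr => ?_) (by simp [mul_comm]) s hs
      · simp only [intervalIntegral.integral_zero, add_zero, pot_zero, Real.exp_zero,
          intervalIntegral.integral_const, add_sub_cancel_left, smul_eq_mul, mul_one] at h
        linarith
      · have hr' : r ∈ Icc 0 T := ⟨hr.1.le, hr.2.le⟩
        refine ⟨∫ z in x..(x + 1), Real.exp (S.pot z r) * S.press z r,
          hasDerivAt_integral_param (by fun_prop) (by fun_prop) hr
            fun z q _ => (S.hasDerivAt_pot z q).exp, ?_⟩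
        have hm := Real.exp_pos (S.lv x r - S.pot x r)
        have e1 : Real.exp (S.lv x r - S.pot x r)
            * ∫ z in x..(x + 1), Real.exp (S.pot z r) * S.press z r ≤ L * (3 * E + 2) := by
          rw [← intervalIntegral.integral_const_mul]
          calc _ ≤ ∫ z in x..(x + 1), (L * 3 * S.ent z r + L * 2) := by
                refine integral_mono_cont hx1 (by fun_prop) (by fun_prop) fun z hz => ?_
                have i1 := hlo r hr' z hz
                have i2 := S.press_nonneg z r
                have i3 : S.v z r * S.press z r ≤ 3 * S.ent z r + 2 := by
                  have := S.theta_le z r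
                  have := S.v_mul_bsq_le z r
                  have hv := (S.v_pos z r).ne'
                  have e : S.v z r * S.press z r = S.θ.f z r + S.v z r * S.bsq z r / 2 := by
                    unfold press
                    field_simp
                  rw [e]
                  linarith
                calc Real.exp (S.lv x r - S.pot x r) * (Real.exp (S.pot z r) * S.press z r)
                    ≤ L * Real.exp (S.lv z r - S.pot z r)
                      * (Real.exp (S.pot z r) * S.press z r) := by gcongr
                  _ = L * (Real.exp (S.lv z r) * S.press z r) := by rw [hsplit]; ring
                  _ ≤ L * (S.v z r * S.press z r) := by
                    gcongr
                    exact S.exp_lv_le z r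
                  _ ≤ L * (3 * S.ent z r + 2) := by gcongr
                  _ = _ := by ring
            _ ≤ L * 3 * E + L * 2 := hlin r hr' _ _ (by positivity)
            _ = _ := by ring
        have e2 := hI r hr'
        set I := ∫ z in x..(x + 1), Real.exp (S.pot z r) with hIdef
        set J := ∫ z in x..(x + 1), Real.exp (S.pot z r) * S.press z r with hJdef
        set m := Real.exp (S.lv x r - S.pot x r) with hmdef
        have hI0 : 0 ≤ I := hy0 r
        have hJ0 : 0 ≤ J := integral_nonneg_Icc hx1 fun z _ =>
          mul_nonneg (Real.exp_pos _).le (S.press_nonneg z r)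
        calc J + 0 ≤ J * (2 * L / c₁ * m * I) := by nlinarith
          _ = (m * J) * (2 * L / c₁ * I) := by ring
          _ ≤ L * (3 * E + 2) * (2 * L / c₁ * I) := by gcongr
          _ = G * I := by rw [hG]; ring
          _ ≤ G * (1 + I) := by
            gcongr
            linarith
    have hm := Real.exp_pos (S.lv x t - S.pot x t)
    constructor
    · have h1 := hI t ht
      have h2 := hS t ht
      refine h1.trans ?_
      rw [hM]
      calc _ ≤ 2 * L / c₁ * Real.exp (S.lv x t - S.pot x t) * (2 * Real.exp (G * T)) := by gcongr
        _ = _ := by ring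
    · have e1 : ∫ _ in x..(x + 1), Real.exp (S.lv x t - S.pot x t)
          ≤ ∫ z in x..(x + 1), (L * 2 * S.ent z t + L * 2) := by
        refine integral_mono_cont hx1 (by fun_prop) (by fun_prop) fun z hz => ?_
        calc Real.exp (S.lv x t - S.pot x t) ≤ L * Real.exp (S.lv z t - S.pot z t) := hlo t ht z hz
          _ ≤ L * Real.exp (S.lv z t) := by
            gcongr
            linarith [S.pot_nonneg z ht.1]
          _ ≤ L * (2 * S.ent z t + 2) := by
            gcongr
            exact (S.exp_lv_le z t).trans (S.v_le z t)
          _ = _ := by ring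
      have e2 := hlin t ht (L * 2) (L * 2) (by positivity)
      simp only [intervalIntegral.integral_const, add_sub_cancel_left, smul_eq_mul, one_mul] at e1
      rw [hM₁]
      linarith
  refine ⟨1 + M + M₂, by have : 0 ≤ M₂ := by positivity
                         linarith, ?_⟩
  intro S hS t ht x
  obtain ⟨h1, h2⟩ := main S hS t ht x
  have hA := Real.one_le_exp (S.pot_nonneg x ht.1)
  have hv := S.v_pos x t
  have hsplit : Real.exp (S.lv x t)
        = Real.exp (S.lv x t - S.pot x t) * Real.exp (S.pot x t) := by
      rw [← Real.exp_add]; ring_nf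
  have h3 : Real.exp (S.pot x t) ≤ M * S.v x t := by
    calc Real.exp (S.pot x t) = 1 * Real.exp (S.pot x t) := (one_mul _).symm
      _ ≤ M * Real.exp (S.lv x t - S.pot x t) * Real.exp (S.pot x t) := by gcongr
      _ = M * Real.exp (S.lv x t) := by rw [hsplit]; ring
      _ ≤ _ := by
        gcongr
        exact S.exp_lv_le x t
  have h4 : M⁻¹ ≤ S.v x t := by
    rw [inv_le_iff_one_le_mul₀ hM0]
    linarith
  have h5 : S.v x t ≤ M₂ * Real.exp (S.pot x t) := by
    have e1 : S.v x t = Real.exp (S.lv x t) * Real.exp (S.v x t ^ (-α)) := by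
      rw [exp_lv, mul_assoc, ← Real.exp_add]
      simp
    have e2 : S.v x t ^ (-α) ≤ (M⁻¹) ^ (-α) :=
      Real.rpow_le_rpow_of_nonpos (by positivity) h4 (neg_nonpos.2 hα)
    rw [e1, hsplit, hM₂]
    calc _ ≤ M₁ * Real.exp (S.pot x t) * Real.exp ((M⁻¹) ^ (-α)) := by gcongr
      _ = _ := by ring
  have hM2 : 0 ≤ M₂ := by positivity
  have hMv : 0 ≤ M₂ * S.v x t := by positivity
  have hMp : 0 ≤ M * Real.exp (S.pot x t) := by positivity
  refine ⟨?_, ?_, ?_⟩ <;> linarith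

end MHDFlow

lemma sq_sub_one_le {y : ℝ} (hy : 0 < y) :
    (y - 1) ^ 2 ≤ 2 * (1 + y) * (y - 1 - Real.log y) := by
  set s := Real.sqrt y with hs
  have hs0 : 0 < s := Real.sqrt_pos.2 hy
  have hsy : y = s ^ 2 := (Real.sq_sqrt hy.le).symm
  have h1 := Real.log_le_sub_one_of_pos hs0
  have h2 : Real.log y = 2 * Real.log s := by
    rw [hsy, Real.log_pow]; norm_num
  rw [h2, hsy]
  have h3 : (s - 1) ^ 2 ≤ s ^ 2 - 1 - 2 * Real.log s := by linarith
  calc (s ^ 2 - 1) ^ 2 = (s - 1) ^ 2 * (s + 1) ^ 2 := by ring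
    _ ≤ (s - 1) ^ 2 * (2 * (1 + s ^ 2)) := by
      gcongr
      nlinarith [sq_nonneg (s - 1)]
    _ ≤ (s ^ 2 - 1 - 2 * Real.log s) * (2 * (1 + s ^ 2)) := by gcongr
    _ = _ := by ring

lemma one_sub_rpow_neg_le {p y : ℝ} (hp : 0 ≤ p) (hy : 1 ≤ y) :
    1 - y ^ (-p) ≤ (1 + p) * (1 - y⁻¹) := by
  have hy0 : 0 < y := by linarith
  have h1 : y⁻¹ ≤ 1 := inv_le_one_of_one_le₀ hy
  have h2 := one_add_mul_self_le_rpow_one_add (s := y⁻¹ - 1) (p := 1 + p)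
    (by linarith [inv_pos.2 hy0]) (by linarith)
  have h3 : (1 + (y⁻¹ - 1)) ^ (1 + p) = y ^ (-(1 + p)) := by
    rw [add_sub_cancel, Real.inv_rpow hy0.le, Real.rpow_neg hy0.le]
  rw [h3] at h2
  have h4 : y ^ (-(1 + p)) ≤ y ^ (-p) := Real.rpow_le_rpow_of_exponent_le hy (by linarith)
  linarith

/-- The multiplier of the temperature equation in the weighted energy estimate. -/
def mult (β y : ℝ) : ℝ := 1 - (y ^ (-(β / 2)) + y ^ (-β)) / 2

/-- The derivative of `mult β`. -/
def multDeriv (β y : ℝ) : ℝ := (β / 2 * y ^ (-(β / 2) - 1) + β * y ^ (-β - 1)) / 2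

/-- The primitive of `mult β` vanishing at `1`. -/
def multPrim (β y : ℝ) : ℝ := ∫ z in (1:ℝ)..y, mult β z

lemma hasDerivAt_mult {β y : ℝ} (hy : 0 < y) : HasDerivAt (mult β) (multDeriv β y) y := by
  have h1 := Real.hasDerivAt_rpow_const (x := y) (p := -(β / 2)) (Or.inl hy.ne')
  have h2 := Real.hasDerivAt_rpow_const (x := y) (p := -β) (Or.inl hy.ne')
  refine (((h1.add h2).div_const 2).const_sub 1).congr_deriv ?_
  unfold multDeriv
  ring

lemma continuousOn_mult (β : ℝ) : ContinuousOn (mult β) (Ioi 0) := fun _ hy =>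
  (hasDerivAt_mult hy).continuousAt.continuousWithinAt

lemma continuousOn_multDeriv (β : ℝ) : ContinuousOn (multDeriv β) (Ioi 0) := by
  have h : ∀ p : ℝ, ContinuousOn (fun y : ℝ => y ^ p) (Ioi 0) := fun p =>
    continuousOn_id.rpow_const fun y hy => Or.inl (ne_of_gt hy)
  exact ((continuousOn_const.mul (h _)).add (continuousOn_const.mul (h _))).div_const 2

lemma multDeriv_pos {β y : ℝ} (hβ : 0 < β) (hy : 0 < y) : 0 < multDeriv β y := by
  have := Real.rpow_pos_of_pos hy (-(β / 2) - 1)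
  have := Real.rpow_pos_of_pos hy (-β - 1)
  unfold multDeriv
  positivity

lemma multDeriv_anti {β x y : ℝ} (hβ : 0 < β) (hx : 0 < x) (hxy : x ≤ y) :
    multDeriv β y ≤ multDeriv β x := by
  have h1 := Real.rpow_le_rpow_of_nonpos (z := -(β / 2) - 1) hx hxy (by linarith)
  have h2 := Real.rpow_le_rpow_of_nonpos (z := -β - 1) hx hxy (by linarith)
  unfold multDeriv
  gcongr

lemma mult_mono {β x y : ℝ} (hβ : 0 < β) (hx : 0 < x) (hxy : x ≤ y) : mult β x ≤ mult β y := by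
  have h1 := Real.rpow_le_rpow_of_nonpos (z := -(β / 2)) hx hxy (by linarith)
  have h2 := Real.rpow_le_rpow_of_nonpos (z := -β) hx hxy (by linarith)
  unfold mult
  linarith

lemma mult_one (β : ℝ) : mult β 1 = 0 := by simp [mult]

lemma mult_lt_one {β y : ℝ} (hy : 0 < y) : mult β y < 1 := by
  have := Real.rpow_pos_of_pos hy (-(β / 2))
  have := Real.rpow_pos_of_pos hy (-β)
  unfold mult
  linarith

lemma intervalIntegrable_mult {β x y : ℝ} (hx : 0 < x) (hy : 0 < y) :
    IntervalIntegrable (mult β) volume x y :=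
  ((continuousOn_mult β).mono fun _ hz => (lt_min hx hy).trans_le hz.1).intervalIntegrable

lemma hasDerivAt_multPrim {β y : ℝ} (hy : 0 < y) : HasDerivAt (multPrim β) (mult β y) y :=
  intervalIntegral.integral_hasDerivAt_right (intervalIntegrable_mult one_pos hy)
    ((continuousOn_mult β).stronglyMeasurableAtFilter isOpen_Ioi y hy)
    (hasDerivAt_mult hy).continuousAt

lemma multPrim_nonneg {β y : ℝ} (hβ : 0 < β) (hy : 0 < y) : 0 ≤ multPrim β y := by
  unfold multPrim
  rcases le_total 1 y with h | h
  · refine integral_nonneg_Icc h fun x hx => ?_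
    rw [← mult_one β]
    exact mult_mono hβ one_pos hx.1
  · rw [intervalIntegral.integral_symm, ← intervalIntegral.integral_neg]
    refine integral_nonneg_Icc h fun x hx => neg_nonneg.2 ?_
    rw [← mult_one β]
    exact mult_mono hβ (hy.trans_le hx.1) hx.2

lemma multPrim_le {β δ y : ℝ} (hβ : 0 < β) (hδ : 0 < δ) (hδ1 : δ ≤ 1) (hy : δ ≤ y) :
    multPrim β y ≤ multDeriv β δ * (y - 1) ^ 2 := by
  have hM := (multDeriv_pos hβ hδ).le
  have h1 : ∀ z, δ ≤ z → |mult β z| ≤ multDeriv β δ * |z - 1| := by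
    intro z hz
    have := (convex_Ici δ).norm_image_sub_le_of_norm_hasDerivWithin_le (f := mult β)
      (C := multDeriv β δ) (fun x hx => (hasDerivAt_mult (hδ.trans_le hx)).hasDerivWithinAt)
      (fun x hx => by
        rw [Real.norm_of_nonneg (multDeriv_pos hβ (hδ.trans_le hx)).le]
        exact multDeriv_anti hβ hδ hx) hδ1 hz
    rwa [mult_one, sub_zero] at this
  have h2 := intervalIntegral.norm_integral_le_of_norm_le_const (a := 1) (b := y) (f := mult β)
    (C := multDeriv β δ * |y - 1|) fun z hz => by
      rw [uIoc, mem_Ioc] at hz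
      refine (h1 z ((le_min hδ1 hy).trans hz.1.le)).trans ?_
      refine mul_le_mul_of_nonneg_left ?_ hM
      rcases le_total 1 y with h | h
      · rw [min_eq_left h, max_eq_right h] at hz
        rw [abs_of_nonneg (by linarith [hz.1]), abs_of_nonneg (by linarith)]
        linarith [hz.2]
      · rw [min_eq_right h, max_eq_left h] at hz
        rw [abs_of_nonpos (by linarith [hz.2]), abs_of_nonpos (by linarith)]
        linarith [hz.1]
  calc multPrim β y ≤ ‖multPrim β y‖ := Real.le_norm_self _
    _ ≤ _ := h2
    _ = _ := by rw [mul_assoc, abs_mul_abs_self, sq]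

lemma sq_mult_le_of_le_one {β y : ℝ} (hβ : 0 < β) (hy : 0 < y) (hy1 : y ≤ 1) :
    y ^ 2 * mult β y ^ 2 / (1 - mult β y) ≤ 2 * β * multPrim β y := by
  set D : ℝ → ℝ := fun z => 2 * β * multPrim β z - z ^ 2 * mult β z ^ 2 / (1 - mult β z) with hD
  have hpos : ∀ z, z ∈ Icc y 1 → 0 < z := fun z hz => hy.trans_le hz.1
  have hne : ∀ z, z ∈ Icc y 1 → 1 - mult β z ≠ 0 := fun z hz =>
    (by linarith [mult_lt_one (β := β) (hpos z hz)] : 0 < 1 - mult β z).ne'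
  have hder : ∀ z ∈ Icc y 1, HasDerivAt D (2 * β * mult β z
      - ((2 * z * mult β z ^ 2 + z ^ 2 * (2 * mult β z * multDeriv β z)) * (1 - mult β z)
        + z ^ 2 * mult β z ^ 2 * multDeriv β z) / (1 - mult β z) ^ 2) z := by
    intro z hz
    have h1 := hasDerivAt_mult (β := β) (hpos z hz)
    have h2 := (((hasDerivAt_id z).pow 2).mul (h1.pow 2)).div (h1.const_sub 1) (hne z hz)
    refine (((hasDerivAt_multPrim (hpos z hz)).const_mul (2 * β)).sub h2).congr_deriv ?_
    simp only [Pi.mul_apply, Pi.pow_apply, id]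
    ring
  have hanti : AntitoneOn D (Icc y 1) := by
    refine antitoneOn_of_deriv_nonpos (convex_Icc y 1)
      (fun z hz => (hder z hz).continuousAt.continuousWithinAt) (fun z hz => ?_) fun z hz => ?_
    · exact (hder z (interior_subset hz)).differentiableAt.differentiableWithinAt
    · have hz' := interior_subset hz
      rw [(hder z hz').deriv]
      have hz0 := hpos z hz'
      have h1 : mult β z ≤ 0 := by
        rw [← mult_one β]
        exact mult_mono hβ hz0 hz'.2
      have h2 := (multDeriv_pos hβ hz0).le
      have h3 : z * multDeriv β z ≤ β * (1 - mult β z) := by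
        have e1 : z * z ^ (-(β / 2) - 1) = z ^ (-(β / 2)) := by
          rw [Real.rpow_sub_one hz0.ne']; field_simp
        have e2 : z * z ^ (-β - 1) = z ^ (-β) := by
          rw [Real.rpow_sub_one hz0.ne']; field_simp
        have e3 := Real.rpow_pos_of_pos hz0 (-(β / 2))
        have e4 : z * multDeriv β z = (β / 2 * (z * z ^ (-(β / 2) - 1))
          + β * (z * z ^ (-β - 1))) / 2 := by
          unfold multDeriv; ring
        rw [e4, e1, e2, mult]
        nlinarith [mul_pos hβ e3]
      obtain ⟨q, hq⟩ : ∃ q, q = -mult β z := ⟨_, rfl⟩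
      have hm : mult β z = -q := by linarith
      rw [hm] at h3 ⊢
      have hq0 : 0 ≤ q := by linarith
      have hz1 := hz'.2
      have h4 : 0 < 1 - -q := by linarith
      rw [sub_nonpos, le_div_iff₀ (by positivity)]
      set p := multDeriv β z
      have h5 : 2 * z * q * (1 + q) * (z * p) ≤ 2 * z * q * (1 + q) * (β * (1 + q)) :=
        mul_le_mul_of_nonneg_left (by linarith) (by positivity)
      have h6 : z * (2 * q * (1 + q) * (β * (1 + q))) ≤ 1 * (2 * q * (1 + q) * (β * (1 + q))) := by
        gcongr
      have h7 : 0 ≤ 2 * z * q ^ 2 * (1 + q) := by positivity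
      have h8 : 0 ≤ z ^ 2 * q ^ 2 * p := by positivity
      nlinarith
  have h := hanti (left_mem_Icc.2 hy1) (right_mem_Icc.2 hy1) hy1
  simp only [hD, mult_one, multPrim, intervalIntegral.integral_same] at h
  norm_num at h
  exact h

lemma sq_mult_le {β y : ℝ} (hβ : 0 < β) (hy : 0 < y) :
    (y * mult β y) ^ 2 / (1 + |mult β y|)
      ≤ 2 * β * multPrim β y + 2 * (1 + β) ^ 2 * ((1 + y) * (y - 1 - Real.log y)) := by
  have h0 := multPrim_nonneg hβ hy
  have h1 := sub_one_sub_log_nonneg hy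
  rcases le_total 1 y with h | h
  · have hm : 0 ≤ mult β y := by
      rw [← mult_one β]
      exact mult_mono hβ one_pos h
    have h2 : (y * mult β y) ^ 2 / (1 + |mult β y|) ≤ (y * mult β y) ^ 2 :=
      div_le_self (sq_nonneg _) (by linarith [abs_nonneg (mult β y)])
    have h3 : y * mult β y ≤ (1 + β) * (y - 1) := by
      have e1 := one_sub_rpow_neg_le (p := β / 2) (by positivity) h
      have e2 := one_sub_rpow_neg_le (p := β) (by positivity) h
      have e3 : y⁻¹ ≤ 1 := inv_le_one_of_one_le₀ h
      have e4 : mult β y ≤ (1 + β) * (1 - y⁻¹) := by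
        unfold mult
        nlinarith
      calc y * mult β y ≤ y * ((1 + β) * (1 - y⁻¹)) := by gcongr
        _ = _ := by field_simp
    have h4 : (y * mult β y) ^ 2 ≤ ((1 + β) * (y - 1)) ^ 2 := by gcongr
    have h5 : ((1 + β) * (y - 1)) ^ 2 ≤ (1 + β) ^ 2 * (2 * (1 + y) * (y - 1 - Real.log y)) := by
      rw [mul_pow]
      gcongr
      exact sq_sub_one_le hy
    have : 0 ≤ 2 * β * multPrim β y := by positivity
    linarith
  · have hm : mult β y ≤ 0 := by
      rw [← mult_one β]
      exact mult_mono hβ hy h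
    have h2 := sq_mult_le_of_le_one hβ hy h
    rw [abs_of_nonpos hm, mul_pow, ← sub_eq_add_neg]
    have : 0 ≤ 2 * (1 + β) ^ 2 * ((1 + y) * (y - 1 - Real.log y)) := by positivity
    linarith

lemma le_mul_rpow_add {ε p y : ℝ} (hε : 0 < ε) (hp : 0 < p) (hy : 0 < y) :
    y ≤ ε * y ^ (1 + p) + ε⁻¹ ^ (p⁻¹) := by
  have hc : 0 < ε⁻¹ ^ (p⁻¹) := by positivity
  rcases le_total y (ε⁻¹ ^ (p⁻¹)) with h | h
  · have : 0 ≤ ε * y ^ (1 + p) := by positivity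
    linarith
  · have h1 := Real.rpow_le_rpow hc.le h hp.le
    rw [← Real.rpow_mul (by positivity), inv_mul_cancel₀ hp.ne', Real.rpow_one] at h1
    have h2 : y ≤ ε * y ^ (1 + p) := by
      rw [Real.rpow_add hy, Real.rpow_one]
      calc y = ε * (y * ε⁻¹) := by field_simp
        _ ≤ _ := by gcongr
    linarith

lemma sq_rpow_half {y : ℝ} (hy : 0 < y) (q : ℝ) : (y ^ q) ^ 2 = y ^ (q * 2) := by
  rw [← Real.rpow_mul_natCast hy.le]
  norm_num

namespace MHDFlow

variable {α β T : ℝ}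

/-- Weighted squared temperature gradient. -/
def dth (S : MHDFlow α β T) (x t : ℝ) : ℝ :=
  S.thp (β / 2 - 1) x t * S.θ.fx x t ^ 2 / S.v x t + S.thp (-1) x t * S.θ.fx x t ^ 2 / S.v x t

section

variable (S : MHDFlow α β T) {X : Type*} [TopologicalSpace X] {g h : X → ℝ}

@[fun_prop]
lemma continuous_dth (hg : Continuous g) (hh : Continuous h) :
    Continuous fun x => S.dth (g x) (h x) := by
  unfold dth
  fun_prop (disch := intro _; exact (S.v_pos _ _).ne')

lemma dth_nonneg (x t : ℝ) : 0 ≤ S.dth x t := by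
  have := S.v_pos x t
  have := S.thp_pos (β / 2 - 1) x t
  have := S.thp_pos (-1) x t
  unfold dth
  positivity

lemma hasDerivAt_thp (q x t : ℝ) :
    HasDerivAt (fun y => S.thp q y t) (q * S.thp (q - 1) x t * S.θ.fx x t) x := by
  refine ((S.θ.hasDerivAt_x x t).rpow_const (p := q) (Or.inl (S.θ_pos x t).ne')).congr_deriv ?_
  unfold thp
  ring

end

/-- Integrals of the density bounded through the entropy. -/
lemma integral_le_of_le_ent {S : MHDFlow α β T} {E t a : ℝ} {f : ℝ → ℝ} (hf : Continuous f)
    (hE : ∫ x in a..(a + 1), S.ent x t ≤ E) (h : ∀ x, f x ≤ 2 * S.ent x t + 2) :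
    ∫ x in a..(a + 1), f x ≤ 2 * E + 2 := by
  refine (integral_mono_cont (by linarith) hf (g := fun x => 2 * S.ent x t + 2) (by fun_prop)
    fun x _ => h x).trans ?_
  rw [intervalIntegral.integral_add (Continuous.intervalIntegrable (by fun_prop) _ _) (by simp),
    intervalIntegral.integral_const_mul, intervalIntegral.integral_const]
  simp only [add_sub_cancel_left, smul_eq_mul, one_mul]
  linarith

/-- The temperature is controlled by a small multiple of the local weighted gradient. -/
lemma exists_theta_le (hα : 0 ≤ α) (hβ : 0 < β) (hT : 0 < T) {K δ : ℝ} (hK : 0 < K) (hδ : 0 < δ)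
    {ε : ℝ} (hε : 0 < ε) :
    ∃ C, 2 ≤ C ∧ ∀ S : MHDFlow α β T, S.Adm K δ → ∀ t ∈ Icc 0 T, ∀ x,
      S.θ.f x t ≤ ε * (∫ z in x..(x + 1), S.dth z t) + C := by
  obtain ⟨E, hE1, hE⟩ := exists_entropy_bound (β := β) hα hT hK hδ
  set q := 1 / 2 + β / 4 with hq
  have hq0 : 0 < q := by positivity
  set L := 2 * E + 2 with hL
  have hL0 : 0 < L := by positivity
  set ε' := ε / (2 * q ^ 2 * L) with hε'
  have hε'0 : 0 < ε' := by positivity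
  set c := ε'⁻¹ ^ ((β / 2)⁻¹) with hc
  have hc0 : 0 < c := by positivity
  refine ⟨2 + c + ε' * (2 * (L ^ q) ^ 2), ?_, ?_⟩
  · have : 0 ≤ ε' * (2 * (L ^ q) ^ 2) := by positivity
    linarith
  intro S hS t ht x
  have hEt := hE S hS t ht x (x + 1) (by linarith)
  have h1 : ∫ z in x..(x + 1), S.v z t ≤ L :=
    integral_le_of_le_ent (by fun_prop) hEt fun z => S.v_le z t
  have h2 : ∫ z in x..(x + 1), S.θ.f z t ≤ L :=
    integral_le_of_le_ent (by fun_prop) hEt fun z => S.theta_le z t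
  obtain ⟨y, hy, hyL⟩ := exists_le_of_integral_le (by fun_prop) h2
  have h3 := sq_le_of_weighted (r := fun z => S.thp q z t) (g := fun z => S.v z t)
    (fun z => S.hasDerivAt_thp q z t) (by fun_prop) (by fun_prop) (fun z => S.v_pos z t)
    (x := x) ⟨le_rfl, by linarith⟩ hy
  have h4 : S.thp q y t ^ 2 ≤ (L ^ q) ^ 2 := by
    have := (S.thp_pos q y t).le
    have : S.thp q y t ≤ L ^ q := Real.rpow_le_rpow (S.θ_pos y t).le hyL hq0.le
    gcongr
  have h5 : ∫ z in x..(x + 1), (q * S.thp (q - 1) z t * S.θ.fx z t) ^ 2 / S.v z t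
      ≤ ∫ z in x..(x + 1), q ^ 2 * S.dth z t := by
    refine integral_mono_cont (by linarith)
      (by fun_prop (disch := intro _; exact (S.v_pos _ _).ne')) (by fun_prop) fun z _ => ?_
    have hv := S.v_pos z t
    have e1 : S.thp (q - 1) z t ^ 2 = S.thp (β / 2 - 1) z t := by
      unfold thp
      rw [sq_rpow_half (S.θ_pos z t)]
      congr 1
      rw [hq]
      ring
    have e2 : (q * S.thp (q - 1) z t * S.θ.fx z t) ^ 2 / S.v z t
        = q ^ 2 * (S.thp (β / 2 - 1) z t * S.θ.fx z t ^ 2 / S.v z t) := by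
      rw [← e1]
      ring
    have e3 : 0 ≤ S.thp (-1) z t * S.θ.fx z t ^ 2 / S.v z t := by
      have := S.thp_pos (-1) z t
      positivity
    rw [e2, dth]
    gcongr
    linarith
  rw [intervalIntegral.integral_const_mul] at h5
  set D := ∫ z in x..(x + 1), S.dth z t with hD
  have hD0 : 0 ≤ D := integral_nonneg_Icc (by linarith) fun z _ => S.dth_nonneg z t
  have h6 := le_mul_rpow_add hε'0 (show 0 < β / 2 by positivity) (S.θ_pos x t)
  have h7 : S.θ.f x t ^ (1 + β / 2) = S.thp q x t ^ 2 := by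
    unfold thp
    rw [sq_rpow_half (S.θ_pos x t)]
    congr 1
    rw [hq]
    ring
  rw [h7] at h6
  have h8 : S.thp q x t ^ 2 ≤ 2 * (L ^ q) ^ 2 + 2 * (q ^ 2 * D * L) := by
    refine h3.trans ?_
    have : 0 ≤ ∫ z in x..(x + 1), S.v z t :=
      integral_nonneg_Icc (by linarith) fun z _ => (S.v_pos z t).le
    gcongr
  have h9 : ε' * (2 * (q ^ 2 * D * L)) = ε * D := by
    rw [hε']
    field_simp
  have h10 := mul_le_mul_of_nonneg_left h8 hε'0.le
  rw [mul_add, h9] at h10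
  linarith

end MHDFlow

lemma integral_sub_add_add {a b c d : ℝ} {f g h k : ℝ → ℝ} (hf : Continuous f)
    (hg : Continuous g) (hh : Continuous h) (hk : Continuous k) :
    ∫ x in a..b, (f x - g x + c * h x + d * k x)
      = (∫ x in a..b, f x) - (∫ x in a..b, g x) + c * (∫ x in a..b, h x)
        + d * ∫ x in a..b, k x := by
  rw [intervalIntegral.integral_add (Continuous.intervalIntegrable (by fun_prop) _ _)
      (Continuous.intervalIntegrable (by fun_prop) _ _),
    intervalIntegral.integral_add (Continuous.intervalIntegrable (by fun_prop) _ _)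
      (Continuous.intervalIntegrable (by fun_prop) _ _),
    intervalIntegral.integral_sub (Continuous.intervalIntegrable (by fun_prop) _ _)
      (Continuous.intervalIntegrable (by fun_prop) _ _),
    intervalIntegral.integral_const_mul, intervalIntegral.integral_const_mul]

lemma continuousOn_multPrim (β : ℝ) : ContinuousOn (multPrim β) (Ioi 0) := fun _ hy =>
  (hasDerivAt_multPrim hy).continuousAt.continuousWithinAt

/-- Young's inequality for the work of the pressure. -/
lemma neg_mul_press_le {v y h s : ℝ} (hv : 0 < v) :
    -s * (4 * (1 - y / v) + h * y / v) ≤ 1 / 2 * (1 + |h|) * (s ^ 2 / v) + 16 * (v - y) ^ 2 / v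
      + (y * h) ^ 2 / (1 + |h|) / v := by
  have hh := abs_nonneg h
  have h0 : 0 < 1 + |h| := by positivity
  have e1 : 0 ≤ (s / 2 + 4 * (v - y)) ^ 2 / v := by positivity
  have e2 : 0 ≤ ((1 + |h|) * s / 2 + y * h) ^ 2 / ((1 + |h|) * v) := by positivity
  have e3 : 0 ≤ |h| * (s ^ 2 / v) := by positivity
  have e4 : (s / 2 + 4 * (v - y)) ^ 2 / v
      = 1 / 4 * (s ^ 2 / v) + 4 * s * (1 - y / v) + 16 * (v - y) ^ 2 / v := by
    field_simp
    ring
  have e5 : ((1 + |h|) * s / 2 + y * h) ^ 2 / ((1 + |h|) * v)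
      = 1 / 4 * (1 + |h|) * (s ^ 2 / v) + s * (h * y / v) + (y * h) ^ 2 / (1 + |h|) / v := by
    field_simp
    ring
  linarith

lemma work_le {β v y C : ℝ} (hβ : 0 < β) (hv : 0 < v) (hy : 0 < y) (hC : 1 ≤ C * v) :
    16 * (v - y) ^ 2 / v + (y * mult β y) ^ 2 / (1 + |mult β y|) / v
      ≤ 64 * (1 + C) * (v - 1 - Real.log v)
        + (64 * C + 2 * C * (1 + β) ^ 2) * ((1 + y) * (y - 1 - Real.log y))
        + 2 * β * C * multPrim β y := by
  have hC' : 1 / v ≤ C := by rwa [div_le_iff₀ hv]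
  have hC0 : 0 < C := by
    by_contra! h
    nlinarith
  have h1 := sq_sub_one_le hv
  have h2 := sq_sub_one_le hy
  have h3 := sq_mult_le hβ hy
  have h4 := sub_one_sub_log_nonneg hv
  have h5 := sub_one_sub_log_nonneg hy
  have e1 : 16 * (v - y) ^ 2 / v ≤ 32 * ((v - 1) ^ 2 / v) + 32 * (1 / v * (y - 1) ^ 2) := by
    have : 0 ≤ 16 * (v - 1 + (y - 1)) ^ 2 / v := by positivity
    have e : 32 * ((v - 1) ^ 2 / v) + 32 * (1 / v * (y - 1) ^ 2) - 16 * (v - y) ^ 2 / v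
      = 16 * (v - 1 + (y - 1)) ^ 2 / v := by
      field_simp
      ring
    linarith
  have e2 : (v - 1) ^ 2 / v ≤ 2 * (1 + C) * (v - 1 - Real.log v) := by
    calc (v - 1) ^ 2 / v ≤ 2 * (1 + v) * (v - 1 - Real.log v) / v := by gcongr
      _ = 2 * (1 + 1 / v) * (v - 1 - Real.log v) := by
        field_simp
        ring
      _ ≤ _ := by gcongr
  have e3 : 1 / v * (y - 1) ^ 2 ≤ C * (2 * (1 + y) * (y - 1 - Real.log y)) := by gcongr
  have e4 : (y * mult β y) ^ 2 / (1 + |mult β y|) / v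
      ≤ C * (2 * β * multPrim β y + 2 * (1 + β) ^ 2 * ((1 + y) * (y - 1 - Real.log y))) := by
    have : 0 ≤ (y * mult β y) ^ 2 / (1 + |mult β y|) := by positivity
    rw [div_eq_mul_inv, mul_comm, ← one_div]
    gcongr
  nlinarith

namespace MHDFlow

variable {α β T : ℝ}

lemma le_half_heat (S : MHDFlow α β T) (hβ : 0 < β) (x t : ℝ) :
    β / 8 * S.dth x t ≤ 1 / 2 * (S.heat x t * (S.thf (multDeriv β) x t * S.θ.fx x t)) := by
  have hv := S.v_pos x t
  have hθ := S.θ_pos x t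
  have e1 : S.thp β x t * S.θ.f x t ^ (-(β / 2) - 1) = S.thp (β / 2 - 1) x t := by
    unfold thp
    rw [← Real.rpow_add hθ]
    congr 1
    ring
  have e2 : S.thp β x t * S.θ.f x t ^ (-β - 1) = S.thp (-1) x t := by
    unfold thp
    rw [← Real.rpow_add hθ]
    congr 1
    ring
  have e3 : 1 / 2 * (S.heat x t * (S.thf (multDeriv β) x t * S.θ.fx x t))
      = β / 8 * ((S.thp β x t * S.θ.f x t ^ (-(β / 2) - 1)) * S.θ.fx x t ^ 2 / S.v x t)
        + β / 4 * ((S.thp β x t * S.θ.f x t ^ (-β - 1)) * S.θ.fx x t ^ 2 / S.v x t) := by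
    unfold heat thf multDeriv
    ring
  have h4 : 0 ≤ β / 8 * (S.thp (-1) x t * S.θ.fx x t ^ 2 / S.v x t) := by
    have := S.thp_pos (-1) x t
    positivity
  rw [e3, e1, e2, dth]
  linarith

/-- Pointwise form of the weighted energy estimate. -/
lemma weighted_energy_pointwise (S : MHDFlow α β T) (hα : 0 ≤ α) (hβ : 0 < β) {C Θ : ℝ}
    (hC1 : 0 ≤ C) {x t : ℝ} (hC : 1 ≤ C * S.v x t) (hΘ : S.θ.f x t ≤ Θ) :
    -S.u.fx x t * (4 * (1 - S.θ.f x t / S.v x t) + S.thf (mult β) x t * S.θ.f x t / S.v x t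
      - 0 * (1 - 1 / S.v x t)) ≤ ((4 - S.thf (mult β) x t - 1 / (1 + S.θ.f x t)) * S.diss x t
      + 1 / 2 * (S.heat x t * (S.thf (multDeriv β) x t * S.θ.fx x t)))
      - (1 / 2 * S.diss x t + β / 8 * S.dth x t)
      + 2 * β * C * (4 / 2 * S.kin x t + S.thf (multPrim β) x t
        + 0 * (S.v x t - 1 - Real.log (S.v x t)))
      + (64 * (1 + C) + (64 * C + 2 * C * (1 + β) ^ 2)) * (1 + Θ) * S.ent x t := by
  have hv := S.v_pos x t
  have hθ := S.θ_pos x t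
  have h1 := neg_mul_press_le (y := S.θ.f x t) (h := mult β (S.θ.f x t)) (s := S.u.fx x t) hv
  have h2 := work_le hβ hv hθ hC
  have h3 := S.le_half_heat hβ x t
  have hk := S.kin_nonneg x t
  have hd := S.diss_nonneg hα x t
  have n1 := sub_one_sub_log_nonneg hv
  have n2 := sub_one_sub_log_nonneg hθ
  have hm := mult_lt_one (β := β) hθ
  have h4 : S.u.fx x t ^ 2 / S.v x t ≤ S.diss x t := by
    have := S.one_le_mu hα x t
    unfold diss
    gcongr
    nlinarith [sq_nonneg (S.u.fx x t), sq_nonneg (S.w₁.fx x t), sq_nonneg (S.w₂.fx x t),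
      sq_nonneg (S.b₁.fx x t), sq_nonneg (S.b₂.fx x t)]
  have h5 : 1 / (1 + S.θ.f x t) ≤ 1 := by
    rw [div_le_one (by linarith)]
    linarith
  have h6 : (1 + |mult β (S.θ.f x t)|) ≤ 4 - mult β (S.θ.f x t) - 1 / (1 + S.θ.f x t) := by
    rcases abs_cases (mult β (S.θ.f x t)) with h | h <;> linarith
  have h7 := mul_le_mul_of_nonneg_right h6 hd
  have h8 : 1 / 2 * (1 + |mult β (S.θ.f x t)|) * (S.u.fx x t ^ 2 / S.v x t)
      ≤ 1 / 2 * (1 + |mult β (S.θ.f x t)|) * S.diss x t := by gcongr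
  have h9 : 0 ≤ |mult β (S.θ.f x t)| * S.diss x t := by positivity
  have hv1 : S.v x t - 1 - Real.log (S.v x t) ≤ S.ent x t := by
    unfold ent
    linarith
  have hθ1 : S.θ.f x t - 1 - Real.log (S.θ.f x t) ≤ S.ent x t := by
    unfold ent
    linarith
  have he := S.ent_nonneg x t
  have hΘ0 : 0 ≤ Θ := hθ.le.trans hΘ
  have h10 : 64 * (1 + C) * (S.v x t - 1 - Real.log (S.v x t))
      ≤ 64 * (1 + C) * ((1 + Θ) * S.ent x t) := by
    gcongr
    nlinarith
  have h11 : (64 * C + 2 * C * (1 + β) ^ 2)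
        * ((1 + S.θ.f x t) * (S.θ.f x t - 1 - Real.log (S.θ.f x t)))
      ≤ (64 * C + 2 * C * (1 + β) ^ 2) * ((1 + Θ) * S.ent x t) := by gcongr
  have h12 : 0 ≤ 2 * β * C * (4 / 2 * S.kin x t) := by positivity
  simp only [thf] at h3 ⊢
  linarith

set_option maxHeartbeats 1000000 in
/-- Space-time bound of the dissipation and of the weighted temperature gradient. -/
lemma exists_gradient_bound (hα : 0 ≤ α) (hβ : 0 < β) (hT : 0 < T) {K δ : ℝ} (hK : 0 < K)
    (hδ : 0 < δ) (hδ1 : δ ≤ 1) :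
    ∃ C, 1 ≤ C ∧ ∀ S : MHDFlow α β T, S.Adm K δ → ∀ a b, a ≤ b →
      ∫ t in (0:ℝ)..T, ∫ x in a..b, (S.diss x t + S.dth x t) ≤ C := by
  obtain ⟨E, hE1, hE⟩ := exists_entropy_bound (β := β) hα hT hK hδ
  obtain ⟨C, hC1, hC⟩ := exists_v_bound (β := β) hα hT hK hδ
  obtain ⟨c₀, hc₀, hcut⟩ := exists_cutoff
  have hk := continuousOn_mult β
  have hk' := continuousOn_multDeriv β
  have hH := continuousOn_multPrim β
  obtain ⟨C₀, hC₀0, hen⟩ := energy_inequality (β := β) hα c₀ (show (0:ℝ) ≤ 4 by norm_num) 0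
    (fun y hy => hasDerivAt_mult (β := β) hy) hk' (fun y hy => multDeriv_pos hβ hy)
    (fun y hy => hasDerivAt_multPrim hy)
  set M := 64 * (1 + C) + (64 * C + 2 * C * (1 + β) ^ 2) with hM
  have hM0 : 0 < M := by positivity
  set ε := β / (16 * M * E) with hε
  have hε0 : 0 < ε := by positivity
  obtain ⟨L, hL2, hL⟩ := exists_theta_le (α := α) (β := β) hα hβ hT hK hδ hε0
  set G := C₀ + M * (1 + L) * E + 2 * β * C with hG
  have hG0 : 0 ≤ G := by positivity
  set I₀ := (2 + 2 * (1 + 2 * K) + multDeriv β δ) * K ^ 2 with hI₀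
  have hmd := multDeriv_pos hβ hδ
  have hI₀0 : 0 ≤ I₀ := by positivity
  refine ⟨1 + (2 + 16 / β) * ((1 + I₀) * Real.exp (G * T)), ?_, ?_⟩
  · have : 0 ≤ (2 + 16 / β) * ((1 + I₀) * Real.exp (G * T)) := by positivity
    linarith
  intro S hS a b hab
  obtain ⟨N₀, hN₀, hfar⟩ := S.exists_farFrom
  set N := max (N₀ + 1) (max |a| |b|) with hN
  have hNN : N₀ + 1 ≤ N := le_max_left _ _
  have hNpos : -(N + 1) ≤ N + 1 := by linarith
  obtain ⟨χ⟩ := hcut N (by linarith)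
  have hχ := χ.cont
  have hdn := S.diss_nonneg hα
  have main := gronwall_dissipative (M := G * T) hT.le
    (y := fun s => ∫ x in (-(N + 1))..(N + 1), χ.φ x ^ 2 * (4 / 2 * S.kin x s
      + S.thf (multPrim β) x s + 0 * (S.v x s - 1 - Real.log (S.v x s))))
    (d := fun s => ∫ x in (-(N + 1))..(N + 1), χ.φ x ^ 2 * (1 / 2 * S.diss x s
      + β / 16 * S.dth x s)) (g := fun _ => G)
    (continuous_integral_left (by
      fun_prop (disch := intro _; exact (S.v_pos _ _).ne')))
    (continuous_integral_left (by fun_prop)) (by fun_prop) (fun s => integral_nonneg_Icc hNpos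
      fun x _ => by
        have := hdn x s
        have := S.dth_nonneg x s
        positivity) (fun _ => hG0)
    (fun s => integral_nonneg_Icc hNpos fun x _ => by
        have := S.kin_nonneg x s
        have := multPrim_nonneg hβ (S.θ_pos x s)
        rw [zero_mul, add_zero, thf]
        positivity) (fun s hs => by
      have hs' : s ∈ Icc 0 T := ⟨hs.1.le, hs.2.le⟩
      obtain ⟨y', h1, h2⟩ := hen T S N (by linarith) (hfar.mono (by linarith)) χ s hs
      refine ⟨y', h1, ?_⟩
      set D := ∫ x in (-(N + 1))..(N + 1), χ.φ x ^ 2 * S.dth x s with hD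
      have hD0 : 0 ≤ D := integral_nonneg_Icc hNpos fun x _ =>
        mul_nonneg (sq_nonneg _) (S.dth_nonneg x s)
      have hΘ : ∀ x, S.θ.f x s ≤ ε * D + L := by
        intro x
        rcases le_total N₀ |x| with h | h
        · have h3 := (abs_le.1 (hfar x s h).2.1).2
          have : 0 ≤ ε * D := by positivity
          linarith
        · refine (hL S hS s hs' x).trans ?_
          have h3 := abs_le.1 h
          gcongr
          exact χ.integral_le_of_abs_le (by linarith) (by linarith)
            (abs_le.2 ⟨by linarith, by linarith⟩) (by fun_prop) fun z => S.dth_nonneg z s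
      have e1 := integral_mono_cont hNpos (f := fun x => χ.φ x ^ 2 * (-S.u.fx x s *
          (4 * (1 - S.θ.f x s / S.v x s) + S.thf (mult β) x s * S.θ.f x s / S.v x s
            - 0 * (1 - 1 / S.v x s))))
        (g := fun x => χ.φ x ^ 2 * ((4 - S.thf (mult β) x s - 1 / (1 + S.θ.f x s)) * S.diss x s
          + 1 / 2 * (S.heat x s * (S.thf (multDeriv β) x s * S.θ.fx x s)))
          - χ.φ x ^ 2 * (1 / 2 * S.diss x s + β / 8 * S.dth x s)
          + 2 * β * C * (χ.φ x ^ 2 * (4 / 2 * S.kin x s + S.thf (multPrim β) x s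
            + 0 * (S.v x s - 1 - Real.log (S.v x s))))
          + M * (1 + (ε * D + L)) * (χ.φ x ^ 2 * S.ent x s))
        (by fun_prop (disch := intro _; exact (S.v_pos _ _).ne'))
        (by fun_prop (disch := intro _; first | exact (S.v_pos _ _).ne' |
              exact (add_pos one_pos (S.θ_pos _ _)).ne')) fun x _ => by
          have := mul_le_mul_of_nonneg_left (S.weighted_energy_pointwise hα hβ
            (by linarith) (hC S hS s hs' x).1 (hΘ x)) (sq_nonneg (χ.φ x))
          linarith
      rw [integral_sub_add_add
        (by fun_prop (disch := intro _; first | exact (S.v_pos _ _).ne' |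
              exact (add_pos one_pos (S.θ_pos _ _)).ne')) (by fun_prop)
        (by fun_prop (disch := intro _; exact (S.v_pos _ _).ne')) (by fun_prop)] at e1
      set Y := ∫ x in (-(N + 1))..(N + 1), χ.φ x ^ 2 * (4 / 2 * S.kin x s
        + S.thf (multPrim β) x s + 0 * (S.v x s - 1 - Real.log (S.v x s))) with hY
      have hY0 : 0 ≤ Y := integral_nonneg_Icc hNpos fun x _ => by
        have := S.kin_nonneg x s
        have := multPrim_nonneg hβ (S.θ_pos x s)
        rw [zero_mul, add_zero, thf]
        positivity
      have e2 : ∫ x in (-(N + 1))..(N + 1), χ.φ x ^ 2 * S.ent x s ≤ E := by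
        refine (integral_mono_cont hNpos (by fun_prop) (by fun_prop) fun x _ => ?_).trans
          (hE S hS s hs' _ _ hNpos)
        exact mul_le_of_le_one_left (S.ent_nonneg x s) (pow_le_one₀ (χ.nonneg x) (χ.le_one x))
      have e3 : M * (1 + (ε * D + L)) * (∫ x in (-(N + 1))..(N + 1), χ.φ x ^ 2 * S.ent x s)
          ≤ M * (1 + L) * E + β / 16 * D := by
        calc _ ≤ M * (1 + (ε * D + L)) * E := by gcongr
          _ = _ := by
            rw [hε]
            field_simp
            ring
      have e4 : ∫ x in (-(N + 1))..(N + 1), χ.φ x ^ 2 * (1 / 2 * S.diss x s + β / 8 * S.dth x s)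
          = (∫ x in (-(N + 1))..(N + 1), χ.φ x ^ 2 * (1 / 2 * S.diss x s + β / 16 * S.dth x s))
            + β / 16 * D := by
        rw [hD, ← intervalIntegral.integral_const_mul, ← intervalIntegral.integral_add
          (Continuous.intervalIntegrable (by fun_prop) _ _)
          (Continuous.intervalIntegrable (by fun_prop) _ _)]
        refine intervalIntegral.integral_congr fun x _ => ?_
        ring
      rw [e4] at e1
      have e5 : (C₀ + M * (1 + L) * E) * 1 ≤ (C₀ + M * (1 + L) * E) * (1 + Y) := by
        gcongr
        linarith
      have e6 : 2 * β * C * Y ≤ 2 * β * C * (1 + Y) := by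
        gcongr
        linarith
      have e7 : G * (1 + Y) = (C₀ + M * (1 + L) * E) * (1 + Y) + 2 * β * C * (1 + Y) := by
        rw [hG]
        ring
      rw [e7]
      linarith) (by simp [mul_comm]) T ⟨hT.le, le_rfl⟩
  have ha : |a| ≤ N := (le_max_left _ _).trans (le_max_right _ _)
  have hb : |b| ≤ N := (le_max_right _ _).trans (le_max_right _ _)
  have hyT : 0 ≤ ∫ x in (-(N + 1))..(N + 1), χ.φ x ^ 2 * (4 / 2 * S.kin x T
      + S.thf (multPrim β) x T + 0 * (S.v x T - 1 - Real.log (S.v x T))) :=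
    integral_nonneg_Icc hNpos fun x _ => by
        have := S.kin_nonneg x T
        have := multPrim_nonneg hβ (S.θ_pos x T)
        rw [zero_mul, add_zero, thf]
        positivity
  have hy0 : ∫ x in (-(N + 1))..(N + 1), χ.φ x ^ 2 * (4 / 2 * S.kin x 0
      + S.thf (multPrim β) x 0 + 0 * (S.v x 0 - 1 - Real.log (S.v x 0))) ≤ I₀ := by
    calc _ ≤ ∫ x in (-(N + 1))..(N + 1), (2 + 2 * (1 + 2 * K) + multDeriv β δ)
        * ((S.v x 0 - 1) ^ 2 + S.u.f x 0 ^ 2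
        + (S.θ.f x 0 - 1) ^ 2 + S.bsq x 0 + (S.w₁.f x 0 ^ 2 + S.w₂.f x 0 ^ 2) + S.vx x 0 ^ 2
        + S.θ.fx x 0 ^ 2 + S.grad x 0) := by
          refine integral_mono_cont hNpos (by fun_prop (disch := intro _; exact (S.v_pos _ _).ne'))
            (by fun_prop) fun x _ => ?_
          have hk0 := S.kin_nonneg x 0
          have hp0 := multPrim_nonneg hβ (S.θ_pos x 0)
          have hp1 := multPrim_le hβ hδ hδ1 (hS.le_θ x)
          have h1 : χ.φ x ^ 2 * (4 / 2 * S.kin x 0 + S.thf (multPrim β) x 0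
              + 0 * (S.v x 0 - 1 - Real.log (S.v x 0)))
              ≤ 4 / 2 * S.kin x 0 + multPrim β (S.θ.f x 0) := by
            rw [zero_mul, add_zero]
            refine mul_le_of_le_one_left ?_ (pow_le_one₀ (χ.nonneg x) (χ.le_one x))
            unfold thf
            positivity
          refine h1.trans ?_
          have h4 : S.v x 0 * S.bsq x 0 ≤ (1 + 2 * K) * S.bsq x 0 :=
            mul_le_mul_of_nonneg_right (hS.v_le hK x) (S.bsq_nonneg x 0)
          have h5 := S.grad_nonneg x 0
          have h6 := S.bsq_nonneg x 0
          unfold kin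
          rw [← bsq]
          generalize multDeriv β δ = r at *
          have q1 : 0 ≤ r * ((S.v x 0 - 1) ^ 2 + S.u.f x 0 ^ 2 + S.bsq x 0
            + (S.w₁.f x 0 ^ 2 + S.w₂.f x 0 ^ 2)
            + S.vx x 0 ^ 2 + S.θ.fx x 0 ^ 2 + S.grad x 0) := by positivity
          have q2 : 0 ≤ 2 * (1 + 2 * K) * ((S.v x 0 - 1) ^ 2 + S.u.f x 0 ^ 2
            + (S.θ.f x 0 - 1) ^ 2 + (S.w₁.f x 0 ^ 2 + S.w₂.f x 0 ^ 2)
            + S.vx x 0 ^ 2 + S.θ.fx x 0 ^ 2 + S.grad x 0) := by positivity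
          have q3 : 0 ≤ 2 * ((S.v x 0 - 1) ^ 2 + (S.θ.f x 0 - 1) ^ 2 + S.bsq x 0
            + S.vx x 0 ^ 2 + S.θ.fx x 0 ^ 2 + S.grad x 0) := by positivity
          linarith
      _ ≤ I₀ := by
          rw [intervalIntegral.integral_const_mul, hI₀]
          gcongr
          exact hS.bound _ _ hNpos
  have e8 : ∫ t in (0:ℝ)..T, ∫ x in a..b, (S.diss x t + S.dth x t)
      ≤ ∫ t in (0:ℝ)..T, (2 + 16 / β) * ∫ x in (-(N + 1))..(N + 1),
        χ.φ x ^ 2 * (1 / 2 * S.diss x t + β / 16 * S.dth x t) := by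
    refine integral_mono_cont hT.le (continuous_integral_left (by fun_prop))
      (continuous_const.mul (continuous_integral_left (by fun_prop))) fun t _ => ?_
    rw [← intervalIntegral.integral_const_mul]
    refine (χ.integral_le_of_abs_le hab ha hb (by fun_prop) fun x => add_nonneg (hdn x t)
      (S.dth_nonneg x t)).trans ?_
    refine integral_mono_cont hNpos (by fun_prop) (by fun_prop) fun x _ => ?_
    have q1 := hdn x t
    have q2 := S.dth_nonneg x t
    have e9 : (2 + 16 / β) * (χ.φ x ^ 2 * (1 / 2 * S.diss x t + β / 16 * S.dth x t))
        = χ.φ x ^ 2 * (S.diss x t + S.dth x t)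
          + χ.φ x ^ 2 * (8 / β * S.diss x t + β / 8 * S.dth x t) := by
      field_simp
      ring
    rw [e9]
    have : 0 ≤ χ.φ x ^ 2 * (8 / β * S.diss x t + β / 8 * S.dth x t) := by positivity
    linarith
  rw [intervalIntegral.integral_const_mul] at e8
  refine e8.trans ?_
  have e10 : ∫ t in (0:ℝ)..T, ∫ x in (-(N + 1))..(N + 1),
        χ.φ x ^ 2 * (1 / 2 * S.diss x t + β / 16 * S.dth x t)
      ≤ (1 + I₀) * Real.exp (G * T) := by
    have : (1 + ∫ x in (-(N + 1))..(N + 1), χ.φ x ^ 2 * (4 / 2 * S.kin x 0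
      + S.thf (multPrim β) x 0 + 0 * (S.v x 0 - 1 - Real.log (S.v x 0)))) * Real.exp (G * T)
      ≤ (1 + I₀) * Real.exp (G * T) := by gcongr
    linarith
  have : (2 + 16 / β) * (∫ t in (0:ℝ)..T, ∫ x in (-(N + 1))..(N + 1),
        χ.φ x ^ 2 * (1 / 2 * S.diss x t + β / 16 * S.dth x t))
      ≤ (2 + 16 / β) * ((1 + I₀) * Real.exp (G * T)) := by gcongr
  linarith

end MHDFlow

namespace MHDFlow

variable {α β T : ℝ}

/-- Pointwise bounds of the temperature and the magnetic field through the local dissipation. -/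
lemma exists_pointwise_le (hα : 0 ≤ α) (hβ : 0 < β) (hT : 0 < T) {K δ : ℝ} (hK : 0 < K)
    (hδ : 0 < δ) :
    ∃ C, 1 ≤ C ∧ ∀ S : MHDFlow α β T, S.Adm K δ → ∀ t ∈ Icc 0 T, ∀ x,
      S.θ.f x t ≤ C * (1 + ∫ z in x..(x + 1), (S.diss z t + S.dth z t)) ∧
      S.bsq x t ≤ C * (1 + ∫ z in x..(x + 1), (S.diss z t + S.dth z t)) := by
  obtain ⟨E, hE1, hE⟩ := exists_entropy_bound (β := β) hα hT hK hδ
  obtain ⟨C, hC1, hC⟩ := exists_v_bound (β := β) hα hT hK hδ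
  obtain ⟨L, hL2, hL⟩ := exists_theta_le (α := α) (β := β) hα hβ hT hK hδ one_pos
  refine ⟨L + 4 * C * E + 2 * (2 * E + 2), by nlinarith, ?_⟩
  intro S hS t ht x
  have hx : x ≤ x + 1 := by linarith
  have hEt := hE S hS t ht x (x + 1) hx
  have hdn := S.diss_nonneg hα
  set G := ∫ z in x..(x + 1), (S.diss z t + S.dth z t) with hG
  have hG0 : 0 ≤ G := integral_nonneg_Icc hx fun z _ => add_nonneg (hdn z t) (S.dth_nonneg z t)
  have hCE : 0 ≤ C * E := by positivity
  constructor
  · have h1 : ∫ z in x..(x + 1), S.dth z t ≤ G :=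
      integral_mono_cont hx (by fun_prop) (by fun_prop) fun z _ => by linarith [hdn z t]
    have h2 := hL S hS t ht x
    nlinarith [mul_nonneg hCE hG0]
  · have h1 : ∫ z in x..(x + 1), S.v z t ≤ 2 * E + 2 :=
      integral_le_of_le_ent (by fun_prop) hEt fun z => S.v_le z t
    have h2 : ∫ z in x..(x + 1), S.bsq z t ≤ 2 * C * E := by
      calc _ ≤ ∫ z in x..(x + 1), 2 * C * S.ent z t := by
            refine integral_mono_cont hx (by fun_prop) (by fun_prop) fun z _ => ?_
            have e1 := (hC S hS t ht z).1
            have e2 := S.bsq_nonneg z t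
            have e3 := S.v_mul_bsq_le z t
            nlinarith
        _ ≤ _ := by
            rw [intervalIntegral.integral_const_mul]
            gcongr
    obtain ⟨y, hy, hyb⟩ := exists_le_of_integral_le (by fun_prop) h2
    have h3 := sq_le_of_weighted (r := fun z => S.b₁.f z t) (g := fun z => S.v z t)
      (fun z => S.b₁.hasDerivAt_x z t) (by fun_prop) (by fun_prop) (fun z => S.v_pos z t)
      (x := x) ⟨le_rfl, hx⟩ hy
    have h4 := sq_le_of_weighted (r := fun z => S.b₂.f z t) (g := fun z => S.v z t)
      (fun z => S.b₂.hasDerivAt_x z t) (by fun_prop) (by fun_prop) (fun z => S.v_pos z t)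
      (x := x) ⟨le_rfl, hx⟩ hy
    have h5 : (∫ z in x..(x + 1), S.b₁.fx z t ^ 2 / S.v z t)
        + (∫ z in x..(x + 1), S.b₂.fx z t ^ 2 / S.v z t) ≤ G := by
      rw [← intervalIntegral.integral_add
        (Continuous.intervalIntegrable (by fun_prop (disch := intro _; exact (S.v_pos _ _).ne')) _ _)
        (Continuous.intervalIntegrable (by fun_prop (disch := intro _; exact (S.v_pos _ _).ne')) _ _)]
      refine integral_mono_cont hx (by fun_prop (disch := intro _; exact (S.v_pos _ _).ne'))
        (by fun_prop) fun z _ => ?_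
      have e1 := S.dth_nonneg z t
      have e2 := S.one_le_mu hα z t
      have e3 := S.v_pos z t
      refine le_trans ?_ (le_add_of_nonneg_right e1)
      unfold diss
      rw [← add_div]
      gcongr
      have : 0 ≤ S.mu z t * S.u.fx z t ^ 2 := by positivity
      nlinarith [sq_nonneg (S.w₁.fx z t), sq_nonneg (S.w₂.fx z t)]
    have h6 : 0 ≤ ∫ z in x..(x + 1), S.v z t :=
      integral_nonneg_Icc hx fun z _ => (S.v_pos z t).le
    have h7 := mul_le_mul_of_nonneg_right h5 h6
    have h8 := mul_le_mul_of_nonneg_left h1 hG0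
    have h9 : S.bsq x t ≤ 2 * S.bsq y t + 2 * (G * (2 * E + 2)) := by
      simp only [bsq] at *
      linarith
    nlinarith [mul_nonneg hCE hG0]

/-- The specific volume is bounded. -/
lemma exists_v_le (hα : 0 ≤ α) (hβ : 0 < β) (hT : 0 < T) {K δ : ℝ} (hK : 0 < K)
    (hδ : 0 < δ) (hδ1 : δ ≤ 1) :
    ∃ C, 1 ≤ C ∧ ∀ S : MHDFlow α β T, S.Adm K δ → ∀ t ∈ Icc 0 T, ∀ x,
      1 ≤ C * S.v x t ∧ S.v x t ≤ C := by
  obtain ⟨C, hC1, hC⟩ := exists_v_bound (β := β) hα hT hK hδ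
  obtain ⟨L, hL1, hL⟩ := exists_pointwise_le (α := α) (β := β) hα hβ hT hK hδ
  obtain ⟨I, hI1, hI⟩ := exists_gradient_bound (α := α) (β := β) hα hβ hT hK hδ hδ1
  set R := (C + 1) * L with hR
  have hR0 : 0 < R := by positivity
  have hexp : 1 ≤ Real.exp (R * (T + I)) := Real.one_le_exp (by positivity)
  refine ⟨C * (2 * Real.exp (R * (T + I))), by nlinarith, ?_⟩
  intro S hS t ht x
  have hx : x ≤ x + 1 := by linarith
  obtain ⟨h1, h2, -⟩ := hC S hS t ht x
  have hv := S.v_pos x t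
  refine ⟨?_, h2.trans ?_⟩
  · calc 1 ≤ C * S.v x t := h1
      _ = C * 1 * S.v x t := by ring
      _ ≤ C * (2 * Real.exp (R * (T + I))) * S.v x t := by
        gcongr
        linarith
  have hcG : Continuous fun s => ∫ z in x..(x + 1), (S.diss z s + S.dth z s) :=
    continuous_integral_left (by fun_prop)
  have hG0 : ∀ s, 0 ≤ ∫ z in x..(x + 1), (S.diss z s + S.dth z s) := fun s =>
    integral_nonneg_Icc hx fun z _ => add_nonneg (S.diss_nonneg hα z s) (S.dth_nonneg z s)
  have main := gronwall_dissipative (M := R * (T + I)) hT.le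
    (y := fun s => Real.exp (S.pot x s)) (d := fun _ => 0)
    (g := fun s => R * (1 + ∫ z in x..(x + 1), (S.diss z s + S.dth z s)))
    (by fun_prop) (by fun_prop) (by fun_prop) (fun _ => le_rfl)
    (fun s => by have := hG0 s; positivity) (fun s => (Real.exp_pos _).le) (fun s hs => by
      have hs' : s ∈ Icc 0 T := ⟨hs.1.le, hs.2.le⟩
      refine ⟨_, (S.hasDerivAt_pot x s).exp, ?_⟩
      obtain ⟨-, -, e1⟩ := hC S hS s hs' x
      obtain ⟨e2, e3⟩ := hL S hS s hs' x
      have e4 := S.v_pos x s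
      have e5 := S.θ_pos x s
      have e6 := S.bsq_nonneg x s
      set Q := 1 + ∫ z in x..(x + 1), (S.diss z s + S.dth z s)
      have hQ : 0 ≤ Q := by linarith [hG0 s]
      have e7 : S.θ.f x s / S.v x s * Real.exp (S.pot x s) ≤ C * (L * Q) := by
        calc _ ≤ S.θ.f x s / S.v x s * (C * S.v x s) := by gcongr
          _ = C * S.θ.f x s := by field_simp
          _ ≤ _ := by gcongr
      have e8 := Real.exp_pos (S.pot x s)
      have e9 : S.bsq x s / 2 * Real.exp (S.pot x s) ≤ L * Q * Real.exp (S.pot x s) := by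
        gcongr
        linarith
      have e10 : 0 ≤ C * (L * Q) * Real.exp (S.pot x s) := by positivity
      have e11 : 0 ≤ L * Q := by positivity
      have e12 : R * Q * (1 + Real.exp (S.pot x s)) = C * (L * Q) + L * Q
        + C * (L * Q) * Real.exp (S.pot x s) + L * Q * Real.exp (S.pot x s) := by
        rw [hR]
        ring
      rw [e12, press]
      linarith) (by
      rw [intervalIntegral.integral_const_mul, intervalIntegral.integral_add (by simp)
        (hcG.intervalIntegrable _ _), intervalIntegral.integral_const]
      simp only [sub_zero, smul_eq_mul, mul_one]
      gcongr
      exact hI S hS x (x + 1) hx) t ht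
  simp only [intervalIntegral.integral_zero, add_zero, pot_zero, Real.exp_zero] at main
  gcongr
  linarith

section

variable (S : MHDFlow α β T)

lemma v_eq_integral (x : ℝ) {s t : ℝ} (hs : s ∈ Ioo 0 T) (ht : t ∈ Ioo 0 T) :
    S.v x t = S.v x s + ∫ r in s..t, S.u.fx x r := by
  have h : ∫ r in s..t, S.u.fx x r = S.v x t - S.v x s := by
    refine intervalIntegral.integral_eq_sub_of_hasDerivAt (f := fun r => S.v x r)
      (fun r hr => S.hasDerivAt_vt x r ?_) (Continuous.intervalIntegrable (by fun_prop) _ _)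
    have h1 : uIcc s t ⊆ Ioo 0 T := ordConnected_Ioo.uIcc_subset hs ht
    exact h1 hr
  linarith

lemma hasDerivAt_vx_t (x : ℝ) {t : ℝ} (ht : t ∈ Ioo 0 T) :
    HasDerivAt (fun s => S.vx x s) (S.u.fxx x t) t := by
  have key : ∀ s ∈ Ioo 0 T, S.vx x s = S.vx x t + ∫ r in t..s, S.u.fxx x r := by
    intro s hs
    have h1 := (S.hasDerivAt_vx x t).add
      (hasDerivAt_integral_param (f := fun r y => S.u.fx y r) (ft := fun r y => S.u.fxx y r)
        (a := t) (b := s) (by fun_prop) (by fun_prop) (c := x - 1) (d := x + 1) (t := x)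
        ⟨by linarith, by linarith⟩ fun r y _ => S.u.hasDerivAt_xx y r)
    refine (S.hasDerivAt_vx x s).unique (h1.congr_of_eventuallyEq
      (Eventually.of_forall fun y => ?_))
    exact S.v_eq_integral y ht hs
  have h2 := (hasDerivAt_integral_upper (f := fun r => S.u.fxx x r) (by fun_prop) t t).const_add
    (S.vx x t)
  refine h2.congr_of_eventuallyEq ?_
  filter_upwards [Ioo_mem_nhds ht.1 ht.2] with s hs
  exact key s hs

/-- The derivative of `v ↦ μ(v) / v`. -/
def dmu (x t : ℝ) : ℝ := (α * (-α * S.v x t ^ (-α - 1)) * S.v x t - S.mu x t) / S.v x t ^ 2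

lemma hasDerivAt_visc_div {v : ℝ} (hv : 0 < v) :
    HasDerivAt (fun y => visc α y / y)
      ((α * (-α * v ^ (-α - 1)) * v - visc α v) / v ^ 2) v := by
  have h := (((Real.hasDerivAt_rpow_const (x := v) (p := -α) (Or.inl hv.ne')).const_mul α).const_add
    1).div (hasDerivAt_id v) hv.ne'
  refine h.congr_deriv ?_
  simp [visc]

lemma ut_eq (x t : ℝ) :
    S.u.ft x t = S.mu x t / S.v x t * S.u.fxx x t + S.dmu x t * S.vx x t * S.u.fx x t
      - (S.θ.fx x t / S.v x t - S.θ.f x t * S.vx x t / S.v x t ^ 2)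
      - (S.b₁.f x t * S.b₁.fx x t + S.b₂.f x t * S.b₂.fx x t) := by
  have hv := (S.v_pos x t).ne'
  have h1 := ((hasDerivAt_visc_div (α := α) (S.v_pos x t)).comp x (S.hasDerivAt_vx x t)).mul
    (S.u.hasDerivAt_xx x t)
  have h2 := (S.θ.hasDerivAt_x x t).div (S.hasDerivAt_vx x t) hv
  have h3 := (((S.b₁.hasDerivAt_x x t).pow 2).add ((S.b₂.hasDerivAt_x x t).pow 2)).div_const 2
  have h4 := ((h1.sub h2).sub h3).congr_of_eventuallyEq (f₁ := fun y => visc α (S.v y t)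
    * S.u.fx y t / S.v y t - S.θ.f y t / S.v y t - (S.b₁.f y t ^ 2 + S.b₂.f y t ^ 2) / 2)
    (Eventually.of_forall fun y => by
      simp only [Pi.sub_apply, Pi.mul_apply, Pi.add_apply, Pi.pow_apply, Pi.div_apply, Function.comp_apply]
      ring)
  rw [(S.momentum x t).unique h4]
  simp only [dmu, mu, Function.comp_apply]
  field_simp
  ring

/-- The effective velocity `μ(v) v_x / v - u`. -/
def eff (x t : ℝ) : ℝ := S.mu x t / S.v x t * S.vx x t - S.u.f x t

/-- The spatial derivative of the total pressure. -/
def pressx (x t : ℝ) : ℝ := S.θ.fx x t / S.v x t - S.θ.f x t * S.vx x t / S.v x t ^ 2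
  + (S.b₁.f x t * S.b₁.fx x t + S.b₂.f x t * S.b₂.fx x t)

variable {X : Type*} [TopologicalSpace X] {g h : X → ℝ}

@[fun_prop]
lemma continuous_eff (hg : Continuous g) (hh : Continuous h) :
    Continuous fun x => S.eff (g x) (h x) := by
  unfold eff
  fun_prop (disch := intro _; exact (S.v_pos _ _).ne')

@[fun_prop]
lemma continuous_pressx (hg : Continuous g) (hh : Continuous h) :
    Continuous fun x => S.pressx (g x) (h x) := by
  unfold pressx
  fun_prop (disch := intro _; first | exact (S.v_pos _ _).ne' |
    exact (pow_pos (S.v_pos _ _) 2).ne')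

lemma hasDerivAt_eff (x : ℝ) {t : ℝ} (ht : t ∈ Ioo 0 T) :
    HasDerivAt (fun s => S.eff x s) (S.pressx x t) t := by
  have h1 := ((hasDerivAt_visc_div (α := α) (S.v_pos x t)).comp t (S.hasDerivAt_vt x t ht)).mul
    (S.hasDerivAt_vx_t x ht)
  refine (h1.sub (S.u.hasDerivAt_t x t ht)).congr_deriv ?_
  rw [ut_eq]
  simp only [dmu, mu, pressx, Function.comp_apply]
  ring

end

end MHDFlow

namespace MHDFlow

variable {α β T : ℝ}

lemma mu_le (S : MHDFlow α β T) (hα : 0 ≤ α) {C x t : ℝ} (hC : 0 < C) (h : 1 ≤ C * S.v x t) :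
    S.mu x t ≤ visc α C⁻¹ := by
  have h1 : C⁻¹ ≤ S.v x t := by
    rw [inv_le_iff_one_le_mul₀ hC]
    linarith
  have := Real.rpow_le_rpow_of_nonpos (inv_pos.2 hC) h1 (neg_nonpos.2 hα)
  unfold mu visc
  gcongr

lemma eff_mul_pressx_le (S : MHDFlow α β T) (hα : 0 ≤ α) (x t : ℝ) :
    S.eff x t * S.pressx x t ≤ 1 / 2 * (S.mu x t * (S.θ.fx x t ^ 2 / (S.v x t * S.θ.f x t)))
      + 1 / 2 * (S.θ.f x t * S.u.f x t ^ 2 / (S.mu x t * S.v x t))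
      + S.bsq x t * (1 / 2 * S.eff x t ^ 2) + 1 / 2 * (S.b₁.fx x t ^ 2 + S.b₂.fx x t ^ 2) := by
  have hv := S.v_pos x t
  have hθ := S.θ_pos x t
  have hμ := S.one_le_mu hα x t
  have hμ0 : 0 < S.mu x t := by linarith
  have e0 : S.vx x t = S.v x t * (S.eff x t + S.u.f x t) / S.mu x t := by
    unfold eff
    field_simp
    ring
  unfold pressx bsq
  rw [e0]
  set z := S.eff x t
  set u := S.u.f x t
  set m := S.mu x t
  set v := S.v x t
  set θ := S.θ.f x t
  set p := S.θ.fx x t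
  set b₁ := S.b₁.f x t
  set b₂ := S.b₂.f x t
  set q₁ := S.b₁.fx x t
  set q₂ := S.b₂.fx x t
  have h1 : 0 ≤ (m * p - θ * z) ^ 2 / (m * v * θ) := by positivity
  have h2 : 0 ≤ θ * (z + u) ^ 2 / (m * v) := by positivity
  have e1 : (m * p - θ * z) ^ 2 / (m * v * θ) = m * (p ^ 2 / (v * θ)) - 2 * (z * (p / v))
      + θ * z ^ 2 / (m * v) := by
    field_simp
    ring
  have e2 : θ * (z + u) ^ 2 / (m * v) = θ * z ^ 2 / (m * v) + 2 * (θ * z * u / (m * v))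
      + θ * u ^ 2 / (m * v) := by
    field_simp
    ring
  have e3 : z * (p / v - θ * (v * (z + u) / m) / v ^ 2 + (b₁ * q₁ + b₂ * q₂))
      = z * (p / v) - θ * z ^ 2 / (m * v) - θ * z * u / (m * v) + z * b₁ * q₁ + z * b₂ * q₂ := by
    field_simp
    ring
  rw [e3]
  nlinarith [sq_nonneg (z * b₁ - q₁), sq_nonneg (z * b₂ - q₂)]

lemma theta_grad_le_dth (S : MHDFlow α β T) (x t : ℝ) :
    S.θ.fx x t ^ 2 / (S.v x t * S.θ.f x t) ≤ S.dth x t := by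
  have hv := S.v_pos x t
  have hθ := S.θ_pos x t
  have e : S.θ.fx x t ^ 2 / (S.v x t * S.θ.f x t)
      = S.thp (-1) x t * S.θ.fx x t ^ 2 / S.v x t := by
    unfold thp
    rw [Real.rpow_neg_one]
    field_simp
  have h : 0 ≤ S.thp (β / 2 - 1) x t * S.θ.fx x t ^ 2 / S.v x t := by
    have := S.thp_pos (β / 2 - 1) x t
    positivity
  rw [e, dth]
  linarith

lemma grad_div_le_diss (S : MHDFlow α β T) (hα : 0 ≤ α) (x t : ℝ) :
    S.grad x t / S.v x t ≤ S.diss x t := by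
  have hv := S.v_pos x t
  have hμ := S.one_le_mu hα x t
  unfold grad diss
  gcongr
  nlinarith [sq_nonneg (S.u.fx x t)]

lemma grad_le (S : MHDFlow α β T) (hα : 0 ≤ α) {C x t : ℝ} (h : S.v x t ≤ C) :
    S.grad x t ≤ C * S.diss x t := by
  have hv := S.v_pos x t
  have h1 := S.grad_div_le_diss hα x t
  rw [div_le_iff₀ hv] at h1
  have := mul_le_mul_of_nonneg_left h (S.diss_nonneg hα x t)
  linarith

set_option maxHeartbeats 1000000 in
/-- The gradient of the specific volume is bounded in `L²`. -/
lemma exists_vx_bound (hα : 0 ≤ α) (hβ : 0 < β) (hT : 0 < T) {K δ : ℝ} (hK : 0 < K)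
    (hδ : 0 < δ) (hδ1 : δ ≤ 1) :
    ∃ C, 1 ≤ C ∧ ∀ S : MHDFlow α β T, S.Adm K δ → ∀ t ∈ Icc 0 T, ∀ a b, a ≤ b →
      ∫ x in a..b, S.vx x t ^ 2 ≤ C := by
  obtain ⟨E, hE1, hE⟩ := exists_entropy_bound (β := β) hα hT hK hδ
  obtain ⟨C, hC1, hC⟩ := exists_v_le (α := α) (β := β) hα hβ hT hK hδ hδ1
  obtain ⟨L, hL1, hL⟩ := exists_pointwise_le (α := α) (β := β) hα hβ hT hK hδ
  obtain ⟨I, hI1, hI⟩ := exists_gradient_bound (α := α) (β := β) hα hβ hT hK hδ hδ1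
  have hC0 : 0 < C := by linarith
  set m := visc α C⁻¹ with hm
  have hm1 : 1 ≤ m := one_le_visc hα (inv_pos.2 hC0)
  set R := m + C + C * L * E + L with hR
  have hR0 : 0 < R := by positivity
  set I₀ := (m ^ 2 * C ^ 2 + 1) * K ^ 2 with hI₀
  set M := (1 + I₀) * Real.exp (R * (T + I)) with hM
  have hI₀0 : 0 ≤ I₀ := by positivity
  have hM0 : 0 ≤ M := by positivity
  refine ⟨1 + 4 * C ^ 2 * (M + E), ?_, ?_⟩
  · have : 0 ≤ 4 * C ^ 2 * (M + E) := by positivity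
    linarith
  intro S hS t ht a b hab
  have hab1 : a ≤ b + 1 := by linarith
  have hdn := S.diss_nonneg hα
  have hcG : Continuous fun s => ∫ z in a..(b + 1), (S.diss z s + S.dth z s) :=
    continuous_integral_left (by fun_prop)
  have hG0 : ∀ s, 0 ≤ ∫ z in a..(b + 1), (S.diss z s + S.dth z s) := fun s =>
    integral_nonneg_Icc hab1 fun z _ => add_nonneg (hdn z s) (S.dth_nonneg z s)
  have main := gronwall_dissipative (M := R * (T + I)) hT.le
    (y := fun s => ∫ x in a..b, 1 / 2 * S.eff x s ^ 2) (d := fun _ => 0)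
    (g := fun s => R * (1 + ∫ z in a..(b + 1), (S.diss z s + S.dth z s)))
    (continuous_integral_left (by fun_prop)) (by fun_prop) (by fun_prop) (fun _ => le_rfl)
    (fun s => by have := hG0 s; positivity)
    (fun s => integral_nonneg_Icc hab fun x _ => by positivity) (fun s hs => by
      have hs' : s ∈ Icc 0 T := ⟨hs.1.le, hs.2.le⟩
      refine ⟨∫ x in a..b, S.eff x s * S.pressx x s,
        hasDerivAt_integral_param (f := fun x s => 1 / 2 * S.eff x s ^ 2)
          (ft := fun x s => S.eff x s * S.pressx x s) (by fun_prop) (by fun_prop) hs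
          fun x r hr => (((S.hasDerivAt_eff x hr).pow 2).const_mul (1 / 2)).congr_deriv (by
            simp only [Nat.cast_ofNat, Nat.add_one_sub_one, pow_one]
            ring), ?_⟩
      set D := ∫ z in a..(b + 1), (S.diss z s + S.dth z s) with hD
      set Y := ∫ x in a..b, 1 / 2 * S.eff x s ^ 2 with hY
      have hD0 : 0 ≤ D := hG0 s
      have hY0 : 0 ≤ Y := integral_nonneg_Icc hab fun x _ => by positivity
      have e1 : ∫ x in a..b, S.eff x s * S.pressx x s ≤ ∫ x in a..b, (0 - 0
          + (m + C) * (S.diss x s + S.dth x s) + (C * (L * (1 + D))) * S.ent x s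
          + L * (1 + D) * (1 / 2 * S.eff x s ^ 2)) := by
        refine integral_mono_cont hab (by fun_prop) (by fun_prop) fun x hx => ?_
        obtain ⟨f1, f2⟩ := hL S hS s hs' x
        obtain ⟨f3, f4⟩ := hC S hS s hs' x
        have f5 := S.eff_mul_pressx_le hα x s
        have f6 := S.mu_le hα hC0 f3
        have f7 := S.theta_grad_le_dth x s
        have f8 := S.grad_le hα f4
        have f9 := S.one_le_mu hα x s
        have hv := S.v_pos x s
        have hθ := S.θ_pos x s
        have hd1 := hdn x s
        have hd2 := S.dth_nonneg x s
        have f10 : ∫ z in x..(x + 1), (S.diss z s + S.dth z s) ≤ D :=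
          integral_mono_domain hx.1 (by linarith) (by linarith [hx.2]) (by fun_prop)
            fun z => add_nonneg (hdn z s) (S.dth_nonneg z s)
        have f11 : L * (1 + ∫ z in x..(x + 1), (S.diss z s + S.dth z s)) ≤ L * (1 + D) := by
          gcongr
        have g1 : S.mu x s * (S.θ.fx x s ^ 2 / (S.v x s * S.θ.f x s)) ≤ m * S.dth x s := by
          gcongr
        have g2 : S.θ.f x s * S.u.f x s ^ 2 / (S.mu x s * S.v x s)
            ≤ C * (L * (1 + D)) * (2 * S.ent x s) := by
          have i1 : 1 / (S.mu x s * S.v x s) ≤ C := by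
            rw [div_le_iff₀ (by positivity)]
            have : C * S.v x s * 1 ≤ C * S.v x s * S.mu x s := by gcongr
            linarith
          have i2 := S.u_sq_le x s
          have i3 := f1.trans f11
          calc _ = 1 / (S.mu x s * S.v x s) * S.θ.f x s * S.u.f x s ^ 2 := by ring
            _ ≤ _ := by gcongr
        have g3 : S.bsq x s * (1 / 2 * S.eff x s ^ 2) ≤ L * (1 + D) * (1 / 2 * S.eff x s ^ 2) := by
          gcongr
          linarith
        have g4 : S.b₁.fx x s ^ 2 + S.b₂.fx x s ^ 2 ≤ C * S.diss x s := by
          unfold grad at f8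
          nlinarith [sq_nonneg (S.u.fx x s), sq_nonneg (S.w₁.fx x s), sq_nonneg (S.w₂.fx x s)]
        have g5 : 0 ≤ m * S.diss x s := by positivity
        have g6 : 0 ≤ C * S.dth x s := by positivity
        have g7 : 0 ≤ m * S.dth x s := by positivity
        have g8 : 0 ≤ C * S.diss x s := by positivity
        linarith
      have e2 : ∫ x in a..b, (0 - 0
          + (m + C) * (S.diss x s + S.dth x s) + (C * (L * (1 + D))) * S.ent x s
          + L * (1 + D) * (1 / 2 * S.eff x s ^ 2))
          = (m + C) * (∫ x in a..b, (S.diss x s + S.dth x s))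
            + (C * (L * (1 + D))) * (∫ x in a..b, S.ent x s) + L * (1 + D) * Y := by
        rw [intervalIntegral.integral_add (Continuous.intervalIntegrable (by fun_prop) _ _)
          (Continuous.intervalIntegrable (by fun_prop) _ _),
          integral_sub_add_add (by fun_prop) (by fun_prop) (by fun_prop) (by fun_prop),
          intervalIntegral.integral_const_mul, intervalIntegral.integral_zero, sub_zero, zero_add]
      rw [e2] at e1
      have e3 : ∫ x in a..b, (S.diss x s + S.dth x s) ≤ D :=
        integral_mono_domain le_rfl hab (by linarith) (by fun_prop)
            fun z => add_nonneg (hdn z s) (S.dth_nonneg z s)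
      have e4 := hE S hS s hs' a b hab
      have e5 : (m + C) * (∫ x in a..b, (S.diss x s + S.dth x s)) ≤ (m + C) * D := by gcongr
      have e6 : (C * (L * (1 + D))) * (∫ x in a..b, S.ent x s) ≤ (C * (L * (1 + D))) * E := by
        gcongr
      have e7 : R * (1 + D) * (1 + Y) = (m + C) * D + (m + C) + C * (L * (1 + D)) * E
          + L * (1 + D) + (m + C + C * L * E) * (1 + D) * Y + L * (1 + D) * Y := by
        rw [hR]
        ring
      have e8 : 0 ≤ L * (1 + D) := by positivity
      have e9 : 0 ≤ (m + C + C * L * E) * (1 + D) * Y := by positivity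
      rw [e7, add_zero]
      linarith) (by
      rw [intervalIntegral.integral_const_mul, intervalIntegral.integral_add (by simp)
        (hcG.intervalIntegrable _ _), intervalIntegral.integral_const]
      simp only [sub_zero, smul_eq_mul, mul_one]
      gcongr
      exact hI S hS a (b + 1) hab1) t ht
  simp only [intervalIntegral.integral_zero, add_zero] at main
  have h0 : ∫ x in a..b, 1 / 2 * S.eff x 0 ^ 2 ≤ I₀ := by
    calc _ ≤ ∫ x in a..b, (m ^ 2 * C ^ 2 + 1) * ((S.v x 0 - 1) ^ 2 + S.u.f x 0 ^ 2
        + (S.θ.f x 0 - 1) ^ 2 + S.bsq x 0 + (S.w₁.f x 0 ^ 2 + S.w₂.f x 0 ^ 2) + S.vx x 0 ^ 2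
        + S.θ.fx x 0 ^ 2 + S.grad x 0) := by
          refine integral_mono_cont hab (by fun_prop) (by fun_prop) fun x _ => ?_
          obtain ⟨f3, f4⟩ := hC S hS 0 ⟨le_rfl, hT.le⟩ x
          have hv := S.v_pos x 0
          have f9 := S.one_le_mu hα x 0
          have f6 := S.mu_le hα hC0 f3
          have h5 := S.grad_nonneg x 0
          have h6 := S.bsq_nonneg x 0
          have i1 : S.mu x 0 / S.v x 0 ≤ m * C := by
            rw [div_le_iff₀ hv]
            calc S.mu x 0 ≤ m := f6
              _ = m * 1 := (mul_one m).symm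
              _ ≤ m * (C * S.v x 0) := by gcongr
              _ = _ := by ring
          have i2 : (S.mu x 0 / S.v x 0) ^ 2 ≤ (m * C) ^ 2 := by gcongr
          have i3 : (S.mu x 0 / S.v x 0 * S.vx x 0) ^ 2 ≤ m ^ 2 * C ^ 2 * S.vx x 0 ^ 2 := by
            rw [mul_pow, ← mul_pow m C]
            gcongr
          have i4 : 1 / 2 * S.eff x 0 ^ 2
              ≤ (S.mu x 0 / S.v x 0 * S.vx x 0) ^ 2 + S.u.f x 0 ^ 2 := by
            unfold eff
            nlinarith [sq_nonneg (S.mu x 0 / S.v x 0 * S.vx x 0 + S.u.f x 0)]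
          have i5 : 0 ≤ m ^ 2 * C ^ 2 * ((S.v x 0 - 1) ^ 2 + S.u.f x 0 ^ 2
            + (S.θ.f x 0 - 1) ^ 2 + S.bsq x 0 + (S.w₁.f x 0 ^ 2 + S.w₂.f x 0 ^ 2)
            + S.θ.fx x 0 ^ 2 + S.grad x 0) := by positivity
          have i6 : 0 ≤ (S.v x 0 - 1) ^ 2
            + (S.θ.f x 0 - 1) ^ 2 + S.bsq x 0 + (S.w₁.f x 0 ^ 2 + S.w₂.f x 0 ^ 2) + S.vx x 0 ^ 2
            + S.θ.fx x 0 ^ 2 + S.grad x 0 := by positivity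
          linarith
      _ ≤ I₀ := by
          rw [intervalIntegral.integral_const_mul, hI₀]
          gcongr
          exact hS.bound _ _ hab
  have h1 : ∫ x in a..b, 1 / 2 * S.eff x t ^ 2 ≤ M := main.trans (by rw [hM]; gcongr)
  have h2 : ∫ x in a..b, S.vx x t ^ 2 ≤ ∫ x in a..b, (0 - 0
      + 4 * C ^ 2 * (1 / 2 * S.eff x t ^ 2) + 4 * C ^ 2 * S.ent x t) := by
    refine integral_mono_cont hab (by fun_prop) (by fun_prop) fun x _ => ?_
    obtain ⟨f3, f4⟩ := hC S hS t ht x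
    have hv := S.v_pos x t
    have hμ := S.one_le_mu hα x t
    have i1 := S.u_sq_le x t
    have e0 : S.vx x t = S.v x t / S.mu x t * (S.eff x t + S.u.f x t) := by
      have : S.mu x t ≠ 0 := by linarith
      unfold eff
      field_simp
      ring
    have i2 : S.v x t / S.mu x t ≤ C := (div_le_self hv.le hμ).trans f4
    have i3 : 0 ≤ S.v x t / S.mu x t := by positivity
    have i4 : (S.eff x t + S.u.f x t) ^ 2 ≤ 2 * S.eff x t ^ 2 + 2 * (2 * S.ent x t) := by
      nlinarith [sq_nonneg (S.eff x t - S.u.f x t)]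
    calc S.vx x t ^ 2 = (S.v x t / S.mu x t) ^ 2 * (S.eff x t + S.u.f x t) ^ 2 := by
          rw [e0, mul_pow]
      _ ≤ C ^ 2 * (2 * S.eff x t ^ 2 + 2 * (2 * S.ent x t)) := by gcongr
      _ = _ := by ring
  rw [integral_sub_add_add (by fun_prop) (by fun_prop) (by fun_prop) (by fun_prop)] at h2
  simp only [intervalIntegral.integral_zero, sub_zero, zero_add] at h2
  have h3 := hE S hS t ht a b hab
  have h4 : 4 * C ^ 2 * (∫ x in a..b, 1 / 2 * S.eff x t ^ 2) ≤ 4 * C ^ 2 * M := by gcongr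
  have h5 : 4 * C ^ 2 * (∫ x in a..b, S.ent x t) ≤ 4 * C ^ 2 * E := by gcongr
  linarith

end MHDFlow

namespace SmoothField

variable {T : ℝ} (F : SmoothField T)

lemma sub_eq_integral (x : ℝ) {s t : ℝ} (hs : s ∈ Ioo 0 T) (ht : t ∈ Ioo 0 T) :
    F.f x s - F.f x t = (s - t) * ∫ r in (0:ℝ)..1, F.ft x (t + r * (s - t)) := by
  have h : ∀ r ∈ uIcc (0:ℝ) 1, HasDerivAt (fun r => F.f x (t + r * (s - t)))
      (F.ft x (t + r * (s - t)) * (s - t)) r := by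
    intro r hr
    rw [uIcc_of_le zero_le_one] at hr
    have hmem : t + r * (s - t) ∈ Ioo 0 T := by
      have := (convex_Ioo (0:ℝ) T).add_smul_sub_mem ht hs hr
      simpa using this
    have h1 : HasDerivAt (fun r => t + r * (s - t)) (s - t) r := by
      simpa using ((hasDerivAt_id r).mul_const (s - t)).const_add t
    exact (F.hasDerivAt_t x _ hmem).comp r h1
  have h2 := intervalIntegral.integral_eq_sub_of_hasDerivAt h
    (Continuous.intervalIntegrable (by fun_prop) _ _)
  rw [intervalIntegral.integral_mul_const] at h2
  simp only [one_mul, zero_mul, add_zero, add_sub_cancel] at h2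
  linarith

/-- Time derivative of a localized gradient energy; only first time derivatives are needed. -/
lemma hasDerivAt_grad_energy {ψ ψ' : ℝ → ℝ} (hψ : ∀ x, HasDerivAt ψ (ψ' x) x)
    (hψ' : Continuous ψ') {a b : ℝ} (ha : ψ a = 0) (hb : ψ b = 0) {t : ℝ} (ht : t ∈ Ioo 0 T) :
    HasDerivAt (fun s => ∫ x in a..b, ψ x * F.fx x s ^ 2)
      (-2 * ∫ x in a..b, F.ft x t * (ψ' x * F.fx x t + ψ x * F.fxx x t)) t := by
  have hψc : Continuous ψ := continuous_iff_continuousAt.2 fun x => (hψ x).continuousAt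
  set Q : ℝ → ℝ := fun s => -∫ x in a..b, (∫ r in (0:ℝ)..1, F.ft x (t + r * (s - t)))
    * (ψ' x * (F.fx x s + F.fx x t) + ψ x * (F.fxx x s + F.fxx x t)) with hQ
  have hq : Continuous fun p : ℝ × ℝ => ∫ r in (0:ℝ)..1, F.ft p.1 (t + r * (p.2 - t)) :=
    intervalIntegral.continuous_parametric_intervalIntegral_of_continuous'
      (f := fun (p : ℝ × ℝ) r => F.ft p.1 (t + r * (p.2 - t))) (by fun_prop) 0 1
  have hQc : Continuous Q := by
    refine (continuous_integral_left (f := fun x s => (∫ r in (0:ℝ)..1, F.ft x (t + r * (s - t)))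
      * (ψ' x * (F.fx x s + F.fx x t) + ψ x * (F.fxx x s + F.fxx x t))) ?_).neg
    exact hq.mul (by fun_prop)
  have hQt : Q t = -2 * ∫ x in a..b, F.ft x t * (ψ' x * F.fx x t + ψ x * F.fxx x t) := by
    simp only [hQ, sub_self, mul_zero, add_zero, intervalIntegral.integral_const, sub_zero,
      one_smul]
    rw [← intervalIntegral.integral_const_mul, ← intervalIntegral.integral_neg]
    congr 1
    ext x
    ring
  have key : ∀ s ∈ Ioo 0 T, (∫ x in a..b, ψ x * F.fx x s ^ 2) - ∫ x in a..b, ψ x * F.fx x t ^ 2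
      = (s - t) * Q s := by
    intro s hs
    have h1 : ∫ x in a..b, ((F.fx x s - F.fx x t) * (ψ x * (F.fx x s + F.fx x t))
        + (F.f x s - F.f x t) * (ψ' x * (F.fx x s + F.fx x t) + ψ x * (F.fxx x s + F.fxx x t)))
        = 0 := by
      have hd : ∀ x, HasDerivAt (fun x => (F.f x s - F.f x t) * (ψ x * (F.fx x s + F.fx x t)))
          ((F.fx x s - F.fx x t) * (ψ x * (F.fx x s + F.fx x t)) + (F.f x s - F.f x t)
            * (ψ' x * (F.fx x s + F.fx x t) + ψ x * (F.fxx x s + F.fxx x t))) x := fun x =>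
        ((F.hasDerivAt_x x s).sub (F.hasDerivAt_x x t)).mul ((hψ x).mul
          ((F.hasDerivAt_xx x s).add (F.hasDerivAt_xx x t)))
      rw [integral_of_hasDerivAt hd (by fun_prop), ha, hb]
      ring
    rw [intervalIntegral.integral_add (Continuous.intervalIntegrable (by fun_prop) _ _)
      (Continuous.intervalIntegrable (by fun_prop) _ _)] at h1
    have h2 : (∫ x in a..b, ψ x * F.fx x s ^ 2) - ∫ x in a..b, ψ x * F.fx x t ^ 2
        = ∫ x in a..b, (F.fx x s - F.fx x t) * (ψ x * (F.fx x s + F.fx x t)) := by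
      rw [← intervalIntegral.integral_sub (Continuous.intervalIntegrable (by fun_prop) _ _)
        (Continuous.intervalIntegrable (by fun_prop) _ _)]
      congr 1
      ext x
      ring
    have h3 : (s - t) * Q s = -∫ x in a..b, (F.f x s - F.f x t)
        * (ψ' x * (F.fx x s + F.fx x t) + ψ x * (F.fxx x s + F.fxx x t)) := by
      rw [hQ, mul_neg, ← intervalIntegral.integral_const_mul]
      congr 2
      ext x
      rw [F.sub_eq_integral x hs ht]
      ring
    linarith
  rw [← hQt, hasDerivAt_iff_tendsto_slope]
  refine (hQc.continuousAt.tendsto.mono_left nhdsWithin_le_nhds).congr' ?_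
  filter_upwards [nhdsWithin_le_nhds (Ioo_mem_nhds ht.1 ht.2), self_mem_nhdsWithin] with s hs hne
  have : s - t ≠ 0 := sub_ne_zero.2 hne
  rw [slope_def_field, key s hs]
  field_simp

/-- A localized Gagliardo–Nirenberg inequality for the derivative of a field. -/
lemma cutoff_sq_le {c₀ N : ℝ} (χ : Cutoff c₀ N) (hN : 0 ≤ N) {ε : ℝ} (hε : 0 < ε) (x t : ℝ) :
    χ.φ x ^ 2 * F.fx x t ^ 2 ≤ 2 * ε * (∫ z in (-(N + 1))..(N + 1), χ.φ z ^ 2 * F.fxx z t ^ 2)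
      + (2 * ε * c₀ ^ 2 + 1 / ε) * ∫ z in (-(N + 1))..(N + 1), F.fx z t ^ 2 := by
  have hχ := χ.cont
  have hχ' := χ.cont'
  have hpos : -(N + 1) ≤ N + 1 := by linarith
  have i1 : 0 ≤ ∫ z in (-(N + 1))..(N + 1), χ.φ z ^ 2 * F.fxx z t ^ 2 :=
    integral_nonneg_Icc hpos fun z _ => by positivity
  have i2 : 0 ≤ ∫ z in (-(N + 1))..(N + 1), F.fx z t ^ 2 :=
    integral_nonneg_Icc hpos fun z _ => by positivity
  rcases le_total (N + 1) |x| with h | h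
  · rw [χ.eq_zero x h]
    have : 0 ≤ (2 * ε * c₀ ^ 2 + 1 / ε) * ∫ z in (-(N + 1))..(N + 1), F.fx z t ^ 2 := by
      positivity
    have : 0 ≤ 2 * ε * ∫ z in (-(N + 1))..(N + 1), χ.φ z ^ 2 * F.fxx z t ^ 2 := by positivity
    simp only [ne_eq, OfNat.ofNat_ne_zero, not_false_eq_true, zero_pow, zero_mul]
    linarith
  obtain ⟨hx1, hx2⟩ := abs_le.1 h
  have hd : ∀ z, HasDerivAt (fun z => (χ.φ z * F.fx z t) ^ 2)
      (2 * (χ.φ z * F.fx z t) * (χ.φ' z * F.fx z t + χ.φ z * F.fxx z t)) z := fun z =>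
    (((χ.hasDerivAt z).mul (F.hasDerivAt_xx z t)).pow 2).congr_deriv (by simp)
  have h0 : χ.φ (-(N + 1)) = 0 := χ.eq_zero _ (by rw [abs_neg]; exact le_abs_self _)
  have h1 := integral_of_hasDerivAt (a := -(N + 1)) (b := x) hd (by fun_prop)
  rw [h0] at h1
  calc χ.φ x ^ 2 * F.fx x t ^ 2 = ∫ z in (-(N + 1))..x,
      2 * (χ.φ z * F.fx z t) * (χ.φ' z * F.fx z t + χ.φ z * F.fxx z t) := by
        rw [h1]
        ring
    _ ≤ ∫ z in (-(N + 1))..x, (2 * ε * (χ.φ z ^ 2 * F.fxx z t ^ 2)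
        + (2 * ε * c₀ ^ 2 + 1 / ε) * F.fx z t ^ 2) := by
        refine integral_mono_cont hx1 (by fun_prop) (by fun_prop) fun z _ => ?_
        have j1 : χ.φ' z ^ 2 ≤ c₀ ^ 2 := by
          rw [← sq_abs]
          exact pow_le_pow_left₀ (abs_nonneg _) (χ.deriv_le z) 2
        have j2 : χ.φ z ^ 2 ≤ 1 := pow_le_one₀ (χ.nonneg z) (χ.le_one z)
        have j3 : 0 ≤ (1 / ε) * (χ.φ z * F.fx z t
          - ε * (χ.φ' z * F.fx z t + χ.φ z * F.fxx z t)) ^ 2 := by positivity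
        have j4 : (1 / ε) * (χ.φ z * F.fx z t
          - ε * (χ.φ' z * F.fx z t + χ.φ z * F.fxx z t)) ^ 2
          = (1 / ε) * (χ.φ z ^ 2 * F.fx z t ^ 2)
          - 2 * (χ.φ z * F.fx z t) * (χ.φ' z * F.fx z t + χ.φ z * F.fxx z t)
          + ε * (χ.φ' z * F.fx z t + χ.φ z * F.fxx z t) ^ 2 := by
          field_simp
          ring
        have j5 : ε * (χ.φ' z * F.fx z t + χ.φ z * F.fxx z t) ^ 2
            ≤ ε * (2 * (χ.φ' z ^ 2 * F.fx z t ^ 2) + 2 * (χ.φ z ^ 2 * F.fxx z t ^ 2)) := by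
          gcongr
          nlinarith [sq_nonneg (χ.φ' z * F.fx z t - χ.φ z * F.fxx z t)]
        have j6 : ε * (2 * (χ.φ' z ^ 2 * F.fx z t ^ 2)) ≤ ε * (2 * (c₀ ^ 2 * F.fx z t ^ 2)) := by
          gcongr
        have j7 : (1 / ε) * (χ.φ z ^ 2 * F.fx z t ^ 2) ≤ (1 / ε) * (1 * F.fx z t ^ 2) := by
          gcongr
        linarith
    _ ≤ ∫ z in (-(N + 1))..(N + 1), (2 * ε * (χ.φ z ^ 2 * F.fxx z t ^ 2)
        + (2 * ε * c₀ ^ 2 + 1 / ε) * F.fx z t ^ 2) :=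
        integral_mono_domain le_rfl hx1 hx2 (by fun_prop) fun z => by positivity
    _ = _ := by
        rw [intervalIntegral.integral_add (Continuous.intervalIntegrable (by fun_prop) _ _)
          (Continuous.intervalIntegrable (by fun_prop) _ _),
          intervalIntegral.integral_const_mul, intervalIntegral.integral_const_mul]

end SmoothField

/-- Pointwise form of the localized second-order energy estimate for `f_t = a f_xx + s`. -/
lemma neg_mul_cutoff_le {a a₀ a₁ : ℝ} (h0 : 0 < a₀) (h1 : a₀ ≤ a) (h2 : a ≤ a₁)
    (r s p φ φ' : ℝ) :
    -((a * r + s) * (2 * φ * φ' * p + φ ^ 2 * r)) ≤ -(a₀ / 2) * (φ ^ 2 * r ^ 2)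
      + (4 * a₁ + 1) * (φ' ^ 2 * p ^ 2) + (1 + 2 / a₀) * (φ ^ 2 * s ^ 2) := by
  have ha : 0 < a := h0.trans_le h1
  have e1 : 0 ≤ a * (1 / 2 * (φ * r) + 2 * (φ' * p)) ^ 2 := by positivity
  have e2 : 0 ≤ (φ * s + φ' * p) ^ 2 := by positivity
  have e3 : 0 ≤ 2 / a₀ * (φ * s + a₀ / 4 * (φ * r)) ^ 2 := by positivity
  have e4 : 2 / a₀ * (φ * s + a₀ / 4 * (φ * r)) ^ 2 = 2 / a₀ * (φ ^ 2 * s ^ 2) + φ ^ 2 * s * r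
      + a₀ / 8 * (φ ^ 2 * r ^ 2) := by
    field_simp
    ring
  have e5 : a₀ * (φ ^ 2 * r ^ 2) ≤ a * (φ ^ 2 * r ^ 2) := by gcongr
  have e6 : a * (φ' ^ 2 * p ^ 2) ≤ a₁ * (φ' ^ 2 * p ^ 2) := by gcongr
  have e7 : 0 ≤ a₀ * (φ ^ 2 * r ^ 2) := by positivity
  linarith

namespace MHDFlow

variable {α β T : ℝ}

section

variable (S : MHDFlow α β T)

lemma transverse_aux {w b : SmoothField T} {x t : ℝ}
    (h : HasDerivAt (fun y => w.fx y t / S.v y t + b.f y t) (w.ft x t) x) :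
    w.ft x t = 1 / S.v x t * w.fxx x t + (-(S.vx x t * w.fx x t) / S.v x t ^ 2 + b.fx x t) := by
  have hv := (S.v_pos x t).ne'
  rw [h.unique (((w.hasDerivAt_xx x t).div (S.hasDerivAt_vx x t) hv).add (b.hasDerivAt_x x t))]
  field_simp
  ring

lemma magnetic_aux {w b : SmoothField T} {x t : ℝ}
    (h : HasDerivAt (fun y => b.fx y t / S.v y t + w.f y t)
      (S.u.fx x t * b.f x t + S.v x t * b.ft x t) x) :
    b.ft x t = 1 / S.v x t ^ 2 * b.fxx x t + (-(S.vx x t * b.fx x t) / S.v x t ^ 2 + w.fx x t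
      - S.u.fx x t * b.f x t) / S.v x t := by
  have hv := (S.v_pos x t).ne'
  have e := h.unique (((b.hasDerivAt_xx x t).div (S.hasDerivAt_vx x t) hv).add
    (w.hasDerivAt_x x t))
  have e2 : b.ft x t = ((b.fxx x t * S.v x t - b.fx x t * S.vx x t) / S.v x t ^ 2 + w.fx x t
      - S.u.fx x t * b.f x t) / S.v x t := by
    rw [← e]
    field_simp
    ring
  rw [e2]
  field_simp
  ring

/-- The sum of the squared second derivatives of the velocity and magnetic fields. -/
def hess (x t : ℝ) : ℝ := S.u.fxx x t ^ 2 + S.w₁.fxx x t ^ 2 + S.w₂.fxx x t ^ 2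
  + S.b₁.fxx x t ^ 2 + S.b₂.fxx x t ^ 2

/-- The lower-order terms in the second-order energy estimate. -/
def lower (x t : ℝ) : ℝ := S.vx x t ^ 2 * S.grad x t + S.grad x t + S.bsq x t * S.grad x t
  + S.θ.fx x t ^ 2 + S.θ.f x t ^ 2 * S.vx x t ^ 2

/-- The pairing of the time derivatives with the localized second derivatives. -/
def pairing {c₀ N : ℝ} (χ : Cutoff c₀ N) (x t : ℝ) : ℝ :=
  S.u.ft x t * (2 * χ.φ x * χ.φ' x * S.u.fx x t + χ.φ x ^ 2 * S.u.fxx x t)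
  + S.w₁.ft x t * (2 * χ.φ x * χ.φ' x * S.w₁.fx x t + χ.φ x ^ 2 * S.w₁.fxx x t)
  + S.w₂.ft x t * (2 * χ.φ x * χ.φ' x * S.w₂.fx x t + χ.φ x ^ 2 * S.w₂.fxx x t)
  + S.b₁.ft x t * (2 * χ.φ x * χ.φ' x * S.b₁.fx x t + χ.φ x ^ 2 * S.b₁.fxx x t)
  + S.b₂.ft x t * (2 * χ.φ x * χ.φ' x * S.b₂.fx x t + χ.φ x ^ 2 * S.b₂.fxx x t)

variable {X : Type*} [TopologicalSpace X] {g h : X → ℝ}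

@[fun_prop]
lemma continuous_hess (hg : Continuous g) (hh : Continuous h) :
    Continuous fun x => S.hess (g x) (h x) := by
  unfold hess
  fun_prop

@[fun_prop]
lemma continuous_lower (hg : Continuous g) (hh : Continuous h) :
    Continuous fun x => S.lower (g x) (h x) := by
  unfold lower
  fun_prop

lemma hess_nonneg (x t : ℝ) : 0 ≤ S.hess x t := by
  unfold hess
  positivity

lemma lower_nonneg (x t : ℝ) : 0 ≤ S.lower x t := by
  have := S.grad_nonneg x t
  have := S.bsq_nonneg x t
  unfold lower
  positivity

lemma continuous_pairing {c₀ N : ℝ} (χ : Cutoff c₀ N) (t : ℝ) :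
    Continuous fun x => S.pairing χ x t := by
  have hχ := χ.cont
  have hχ' := χ.cont'
  unfold pairing
  fun_prop

lemma hasDerivAt_grad_energy {c₀ N : ℝ} (χ : Cutoff c₀ N) {t : ℝ} (ht : t ∈ Ioo 0 T) :
    HasDerivAt (fun s => ∫ x in (-(N + 1))..(N + 1), χ.φ x ^ 2 * S.grad x s)
      (-2 * ∫ x in (-(N + 1))..(N + 1), S.pairing χ x t) t := by
  have hχ := χ.cont
  have hχ' := χ.cont'
  have hd : ∀ x, HasDerivAt (fun x => χ.φ x ^ 2) (2 * χ.φ x * χ.φ' x) x := fun x =>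
    ((χ.hasDerivAt x).pow 2).congr_deriv (by simp)
  have ha : χ.φ (-(N + 1)) ^ 2 = 0 := by
    rw [χ.eq_zero _ (by rw [abs_neg]; exact le_abs_self _)]
    simp
  have hb : χ.φ (N + 1) ^ 2 = 0 := by
    rw [χ.eq_zero _ (le_abs_self _)]
    simp
  have key := fun F : SmoothField T =>
    F.hasDerivAt_grad_energy hd (by fun_prop) (a := -(N + 1)) (b := N + 1) ha hb ht
  have h := ((((key S.u).add (key S.w₁)).add (key S.w₂)).add (key S.b₁)).add (key S.b₂)
  refine (h.congr_of_eventuallyEq (Eventually.of_forall fun s => ?_)).congr_deriv ?_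
  · simp only [Pi.add_apply]
    rw [← intervalIntegral.integral_add, ← intervalIntegral.integral_add,
      ← intervalIntegral.integral_add, ← intervalIntegral.integral_add]
    · congr 1
      ext x
      unfold grad
      ring
    all_goals exact Continuous.intervalIntegrable (by fun_prop) _ _
  · rw [← mul_add, ← mul_add, ← mul_add, ← mul_add, ← intervalIntegral.integral_add,
      ← intervalIntegral.integral_add, ← intervalIntegral.integral_add,
      ← intervalIntegral.integral_add]
    · rfl
    all_goals exact Continuous.intervalIntegrable (by fun_prop) _ _

set_option maxHeartbeats 1000000 in
lemma velocity_source_sq_le (hα : 0 ≤ α) {C m x t : ℝ} (hC : 1 ≤ C)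
    (h1 : 1 / S.v x t ≤ C) (hm : S.mu x t ≤ m) :
    (S.dmu x t * S.vx x t * S.u.fx x t - S.pressx x t) ^ 2
      ≤ 4 * (((1 + α) * m * C ^ 2) ^ 2 + C ^ 2 + C ^ 4 + 1) * S.lower x t := by
  have hv := S.v_pos x t
  have hμ := S.one_le_mu hα x t
  have hg := S.grad_nonneg x t
  have hb := S.bsq_nonneg x t
  have hi : 0 < 1 / S.v x t := by positivity
  have hμ0 : 0 < S.mu x t := by linarith
  have hm0 : 0 < m := by linarith
  have d1 : |S.dmu x t| ≤ (1 + α) * m * C ^ 2 := by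
    have e : S.dmu x t = -(α * (α * S.v x t ^ (-α)) + S.mu x t) * (1 / S.v x t) ^ 2 := by
      unfold dmu
      rw [Real.rpow_sub_one hv.ne']
      field_simp
      ring
    have p := Real.rpow_pos_of_pos hv (-α)
    have q : α * S.v x t ^ (-α) ≤ S.mu x t := by
      unfold mu visc
      linarith
    have q1 : α * (α * S.v x t ^ (-α)) ≤ α * S.mu x t := by gcongr
    rw [e, abs_mul, abs_neg, abs_of_nonneg (by positivity), abs_of_nonneg (by positivity)]
    have q2 : α * (α * S.v x t ^ (-α)) + S.mu x t ≤ (1 + α) * m := by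
      have : α * S.mu x t ≤ α * m := by gcongr
      linarith
    have : 0 ≤ (1 + α) * m := by positivity
    gcongr
  have d2 : S.dmu x t ^ 2 ≤ ((1 + α) * m * C ^ 2) ^ 2 := by
    rw [← sq_abs]
    gcongr
  have i2 : (1 / S.v x t) ^ 2 ≤ C ^ 2 := by gcongr
  have i4 : (1 / S.v x t) ^ 4 ≤ C ^ 4 := by gcongr
  have g1 : S.u.fx x t ^ 2 ≤ S.grad x t := by
    unfold grad
    nlinarith [sq_nonneg (S.w₁.fx x t), sq_nonneg (S.w₂.fx x t), sq_nonneg (S.b₁.fx x t),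
      sq_nonneg (S.b₂.fx x t)]
  have g2 : S.b₁.fx x t ^ 2 + S.b₂.fx x t ^ 2 ≤ S.grad x t := by
    unfold grad
    nlinarith [sq_nonneg (S.w₁.fx x t), sq_nonneg (S.w₂.fx x t), sq_nonneg (S.u.fx x t)]
  have k1 : S.dmu x t ^ 2 * (S.vx x t ^ 2 * S.u.fx x t ^ 2)
      ≤ ((1 + α) * m * C ^ 2) ^ 2 * (S.vx x t ^ 2 * S.grad x t) := by gcongr
  have k2 : (1 / S.v x t) ^ 2 * S.θ.fx x t ^ 2 ≤ C ^ 2 * S.θ.fx x t ^ 2 := by gcongr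
  have k3 : (1 / S.v x t) ^ 4 * (S.θ.f x t ^ 2 * S.vx x t ^ 2)
      ≤ C ^ 4 * (S.θ.f x t ^ 2 * S.vx x t ^ 2) := by gcongr
  have k4 : (S.b₁.f x t * S.b₁.fx x t + S.b₂.f x t * S.b₂.fx x t) ^ 2
      ≤ S.bsq x t * S.grad x t := by
    refine le_trans ?_ (mul_le_mul_of_nonneg_left g2 hb)
    unfold bsq
    nlinarith [sq_nonneg (S.b₁.f x t * S.b₂.fx x t - S.b₂.f x t * S.b₁.fx x t)]
  have k5 : (S.dmu x t * S.vx x t * S.u.fx x t - S.pressx x t) ^ 2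
      ≤ 4 * (S.dmu x t ^ 2 * (S.vx x t ^ 2 * S.u.fx x t ^ 2)
        + (1 / S.v x t) ^ 2 * S.θ.fx x t ^ 2
        + (1 / S.v x t) ^ 4 * (S.θ.f x t ^ 2 * S.vx x t ^ 2)
        + (S.b₁.f x t * S.b₁.fx x t + S.b₂.f x t * S.b₂.fx x t) ^ 2) := by
    have e : S.dmu x t * S.vx x t * S.u.fx x t - S.pressx x t
        = S.dmu x t * S.vx x t * S.u.fx x t + -(1 / S.v x t * S.θ.fx x t)
          + (1 / S.v x t) ^ 2 * (S.θ.f x t * S.vx x t)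
          + -(S.b₁.f x t * S.b₁.fx x t + S.b₂.f x t * S.b₂.fx x t) := by
      unfold pressx
      field_simp
      ring
    rw [e]
    have young : ∀ a b c d : ℝ, (a + b + c + d) ^ 2 ≤ 4 * (a ^ 2 + b ^ 2 + c ^ 2 + d ^ 2) := by
      intro a b c d
      nlinarith [sq_nonneg (a - b), sq_nonneg (a - c), sq_nonneg (a - d), sq_nonneg (b - c),
        sq_nonneg (b - d), sq_nonneg (c - d)]
    refine (young _ _ _ _).trans (le_of_eq ?_)
    ring
  have n1 : 0 ≤ ((1 + α) * m * C ^ 2) ^ 2 * (S.grad x t + S.bsq x t * S.grad x t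
    + S.θ.fx x t ^ 2 + S.θ.f x t ^ 2 * S.vx x t ^ 2) := by positivity
  have n2 : 0 ≤ C ^ 2 * (S.vx x t ^ 2 * S.grad x t + S.grad x t + S.bsq x t * S.grad x t
    + S.θ.f x t ^ 2 * S.vx x t ^ 2) := by positivity
  have n3 : 0 ≤ C ^ 4 * (S.vx x t ^ 2 * S.grad x t + S.grad x t + S.bsq x t * S.grad x t
    + S.θ.fx x t ^ 2) := by positivity
  have n4 : 0 ≤ S.vx x t ^ 2 * S.grad x t + S.grad x t
    + S.θ.fx x t ^ 2 + S.θ.f x t ^ 2 * S.vx x t ^ 2 := by positivity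
  unfold lower
  linarith only [k1, k2, k3, k4, k5, n1, n2, n3, n4]

lemma transverse_source_sq_le {C x t p q : ℝ} (hC : 1 ≤ C) (h1 : 1 / S.v x t ≤ C)
    (h : p ^ 2 + q ^ 2 ≤ S.grad x t) :
    (-(S.vx x t * p) / S.v x t ^ 2 + q) ^ 2 ≤ 2 * (C ^ 4 + 1) * S.lower x t := by
  have hv := S.v_pos x t
  have hg := S.grad_nonneg x t
  have hb := S.bsq_nonneg x t
  have hi : 0 < 1 / S.v x t := by positivity
  have i4 : (1 / S.v x t) ^ 4 ≤ C ^ 4 := by gcongr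
  have e : (-(S.vx x t * p) / S.v x t ^ 2 + q) ^ 2
      ≤ 2 * ((1 / S.v x t) ^ 4 * (S.vx x t ^ 2 * p ^ 2) + q ^ 2) := by
    have young : ∀ a b : ℝ, (-a + b) ^ 2 ≤ 2 * (a ^ 2 + b ^ 2) := by
      intro a b
      nlinarith [sq_nonneg (a + b)]
    rw [neg_div]
    refine (young _ _).trans (le_of_eq ?_)
    field_simp
  have k1 : (1 / S.v x t) ^ 4 * (S.vx x t ^ 2 * p ^ 2) ≤ C ^ 4 * (S.vx x t ^ 2 * S.grad x t) := by
    gcongr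
    nlinarith [sq_nonneg q]
  have k2 : q ^ 2 ≤ S.grad x t := by nlinarith [sq_nonneg p]
  have n1 : 0 ≤ C ^ 4 * (S.grad x t + S.bsq x t * S.grad x t
    + S.θ.fx x t ^ 2 + S.θ.f x t ^ 2 * S.vx x t ^ 2) := by positivity
  have n2 : 0 ≤ S.vx x t ^ 2 * S.grad x t + S.bsq x t * S.grad x t
    + S.θ.fx x t ^ 2 + S.θ.f x t ^ 2 * S.vx x t ^ 2 := by positivity
  unfold lower
  linarith

lemma magnetic_source_sq_le {C x t p q r : ℝ} (hC : 1 ≤ C) (h1 : 1 / S.v x t ≤ C)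
    (h : p ^ 2 + q ^ 2 ≤ S.grad x t) (hr : r ^ 2 ≤ S.bsq x t) :
    ((-(S.vx x t * p) / S.v x t ^ 2 + q - S.u.fx x t * r) / S.v x t) ^ 2
      ≤ C ^ 2 * (2 * (2 * (C ^ 4 + 1)) + 2) * S.lower x t := by
  have hv := S.v_pos x t
  have hg := S.grad_nonneg x t
  have hb := S.bsq_nonneg x t
  have hi : 0 < 1 / S.v x t := by positivity
  have i2 : (1 / S.v x t) ^ 2 ≤ C ^ 2 := by gcongr
  have g1 : S.u.fx x t ^ 2 ≤ S.grad x t := by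
    unfold grad
    nlinarith [sq_nonneg (S.w₁.fx x t), sq_nonneg (S.w₂.fx x t), sq_nonneg (S.b₁.fx x t),
      sq_nonneg (S.b₂.fx x t)]
  have k1 := S.transverse_source_sq_le hC h1 h
  have k2 : (S.u.fx x t * r) ^ 2 ≤ S.lower x t := by
    have : r ^ 2 * S.u.fx x t ^ 2 ≤ S.bsq x t * S.grad x t := by gcongr
    have n2 : 0 ≤ S.vx x t ^ 2 * S.grad x t + S.grad x t
      + S.θ.fx x t ^ 2 + S.θ.f x t ^ 2 * S.vx x t ^ 2 := by positivity
    unfold lower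
    linarith
  rw [div_eq_mul_one_div, mul_pow, mul_comm, mul_assoc]
  refine mul_le_mul i2 ?_ (sq_nonneg _) (sq_nonneg _)
  nlinarith [sq_nonneg (-(S.vx x t * p) / S.v x t ^ 2 + q + S.u.fx x t * r)]

/-- The constant in the second-order energy estimate. -/
def sourceConst (α m C : ℝ) : ℝ := 4 * (((1 + α) * m * C ^ 2) ^ 2 + C ^ 2 + C ^ 4 + 1)
  + C ^ 2 * (2 * (2 * (C ^ 4 + 1)) + 2)

set_option maxHeartbeats 1000000 in
lemma neg_pairing_le (hα : 0 ≤ α) {C m x t c₀ N : ℝ} (hC : 1 ≤ C) (h1 : 1 ≤ C * S.v x t)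
    (h2 : S.v x t ≤ C) (hm : S.mu x t ≤ m) (χ : Cutoff c₀ N) :
    -S.pairing χ x t ≤ -(1 / (2 * C ^ 2)) * (χ.φ x ^ 2 * S.hess x t)
      + (4 * (m * C ^ 2) + 1) * (χ.φ' x ^ 2 * S.grad x t)
      + (1 + 2 * C ^ 2) * (5 * sourceConst α m C) * (χ.φ x ^ 2 * S.lower x t) := by
  have hv := S.v_pos x t
  have hμ := S.one_le_mu hα x t
  have hm1 : 1 ≤ m := hμ.trans hm
  have hC2 : 1 ≤ C ^ 2 := one_le_pow₀ hC
  have hi : 1 / S.v x t ≤ C := by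
    rw [div_le_iff₀ hv]
    exact h1
  have hi' : 1 / C ≤ 1 / S.v x t := one_div_le_one_div_of_le hv h2
  have ha₀ : 0 < 1 / C ^ 2 := by positivity
  have hC0 : 0 < C := by linarith
  have hi0 : 0 < 1 / S.v x t := by positivity
  have hCC : 1 / C ^ 2 ≤ 1 / C := one_div_le_one_div_of_le hC0 (by nlinarith)
  have hC1 : C ≤ m * C ^ 2 := by
    calc C = 1 * (C * 1) := by ring
      _ ≤ m * (C * C) := by gcongr
      _ = _ := by ring
  have u1 : 1 / C ^ 2 ≤ S.mu x t / S.v x t := by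
    rw [div_eq_mul_one_div (S.mu x t)]
    nlinarith
  have u2 : S.mu x t / S.v x t ≤ m * C ^ 2 := by
    rw [div_eq_mul_one_div]
    have : S.mu x t * (1 / S.v x t) ≤ m * C := by gcongr
    nlinarith
  have b1 : 1 / C ^ 2 ≤ 1 / S.v x t ^ 2 := one_div_le_one_div_of_le (by positivity) (by gcongr)
  have b2 : 1 / S.v x t ^ 2 ≤ m * C ^ 2 := by
    have : (1 / S.v x t) ^ 2 ≤ C ^ 2 := by gcongr
    rw [one_div_pow] at this
    nlinarith
  have hl := S.lower_nonneg x t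
  have c1 : 4 * (((1 + α) * m * C ^ 2) ^ 2 + C ^ 2 + C ^ 4 + 1) ≤ sourceConst α m C := by
    have : 0 ≤ C ^ 2 * (2 * (2 * (C ^ 4 + 1)) + 2) := by positivity
    unfold sourceConst
    linarith
  have c3 : C ^ 2 * (2 * (2 * (C ^ 4 + 1)) + 2) ≤ sourceConst α m C := by
    have : 0 ≤ 4 * (((1 + α) * m * C ^ 2) ^ 2 + C ^ 2 + C ^ 4 + 1) := by positivity
    unfold sourceConst
    linarith
  have c2 : 2 * (C ^ 4 + 1) ≤ sourceConst α m C := by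
    refine le_trans ?_ c3
    have : 0 ≤ C ^ 4 := by positivity
    nlinarith
  have su := (S.velocity_source_sq_le hα hC hi hm).trans (mul_le_mul_of_nonneg_right c1 hl)
  have sw₁ := (S.transverse_source_sq_le (p := S.w₁.fx x t) (q := S.b₁.fx x t) hC hi (by
    unfold grad
    nlinarith [sq_nonneg (S.u.fx x t), sq_nonneg (S.w₂.fx x t), sq_nonneg (S.b₂.fx x t)])).trans
    (mul_le_mul_of_nonneg_right c2 hl)
  have sw₂ := (S.transverse_source_sq_le (p := S.w₂.fx x t) (q := S.b₂.fx x t) hC hi (by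
    unfold grad
    nlinarith [sq_nonneg (S.u.fx x t), sq_nonneg (S.w₁.fx x t), sq_nonneg (S.b₁.fx x t)])).trans
    (mul_le_mul_of_nonneg_right c2 hl)
  have sb₁ := (S.magnetic_source_sq_le (p := S.b₁.fx x t) (q := S.w₁.fx x t) (r := S.b₁.f x t)
    hC hi (by
    unfold grad
    nlinarith [sq_nonneg (S.u.fx x t), sq_nonneg (S.w₂.fx x t), sq_nonneg (S.b₂.fx x t)]) (by
    unfold bsq
    nlinarith [sq_nonneg (S.b₂.f x t)])).trans (mul_le_mul_of_nonneg_right c3 hl)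
  have sb₂ := (S.magnetic_source_sq_le (p := S.b₂.fx x t) (q := S.w₂.fx x t) (r := S.b₂.f x t)
    hC hi (by
    unfold grad
    nlinarith [sq_nonneg (S.u.fx x t), sq_nonneg (S.w₁.fx x t), sq_nonneg (S.b₁.fx x t)]) (by
    unfold bsq
    nlinarith [sq_nonneg (S.b₁.f x t)])).trans (mul_le_mul_of_nonneg_right c3 hl)
  have eu : S.u.ft x t = S.mu x t / S.v x t * S.u.fxx x t
      + (S.dmu x t * S.vx x t * S.u.fx x t - S.pressx x t) := by
    rw [S.ut_eq, pressx]
    ring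
  set R := sourceConst α m C
  have hφ : 0 ≤ (1 + 2 / (1 / C ^ 2)) * χ.φ x ^ 2 := by positivity
  have pu := neg_mul_cutoff_le ha₀ u1 u2 (S.u.fxx x t)
    (S.dmu x t * S.vx x t * S.u.fx x t - S.pressx x t) (S.u.fx x t) (χ.φ x) (χ.φ' x)
  have pw₁ := neg_mul_cutoff_le ha₀ (hCC.trans hi') (hi.trans hC1) (S.w₁.fxx x t)
    (-(S.vx x t * S.w₁.fx x t) / S.v x t ^ 2 + S.b₁.fx x t) (S.w₁.fx x t) (χ.φ x) (χ.φ' x)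
  have pw₂ := neg_mul_cutoff_le ha₀ (hCC.trans hi') (hi.trans hC1) (S.w₂.fxx x t)
    (-(S.vx x t * S.w₂.fx x t) / S.v x t ^ 2 + S.b₂.fx x t) (S.w₂.fx x t) (χ.φ x) (χ.φ' x)
  have pb₁ := neg_mul_cutoff_le ha₀ b1 b2 (S.b₁.fxx x t)
    ((-(S.vx x t * S.b₁.fx x t) / S.v x t ^ 2 + S.w₁.fx x t
      - S.u.fx x t * S.b₁.f x t) / S.v x t) (S.b₁.fx x t) (χ.φ x) (χ.φ' x)
  have pb₂ := neg_mul_cutoff_le ha₀ b1 b2 (S.b₂.fxx x t)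
    ((-(S.vx x t * S.b₂.fx x t) / S.v x t ^ 2 + S.w₂.fx x t
      - S.u.fx x t * S.b₂.f x t) / S.v x t) (S.b₂.fx x t) (χ.φ x) (χ.φ' x)
  rw [← eu] at pu
  rw [← S.transverse_aux (S.transverse₁ x t)] at pw₁
  rw [← S.transverse_aux (S.transverse₂ x t)] at pw₂
  rw [← S.magnetic_aux (S.magnetic₁ x t)] at pb₁
  rw [← S.magnetic_aux (S.magnetic₂ x t)] at pb₂
  have qu := mul_le_mul_of_nonneg_left su hφ
  have qw₁ := mul_le_mul_of_nonneg_left sw₁ hφ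
  have qw₂ := mul_le_mul_of_nonneg_left sw₂ hφ
  have qb₁ := mul_le_mul_of_nonneg_left sb₁ hφ
  have qb₂ := mul_le_mul_of_nonneg_left sb₂ hφ
  have ea : 1 / C ^ 2 / 2 = 1 / (2 * C ^ 2) := by
    field_simp
  have eb : 2 / (1 / C ^ 2) = 2 * C ^ 2 := by
    field_simp
  rw [ea, eb] at pu pw₁ pw₂ pb₁ pb₂
  rw [eb] at qu qw₁ qw₂ qb₁ qb₂
  simp only [pairing, hess, grad]
  linarith only [pu, pw₁, pw₂, pb₁, pb₂, qu, qw₁, qw₂, qb₁, qb₂]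

end

end MHDFlow

namespace MHDFlow

variable {α β T : ℝ}

lemma cutoff_grad_le (S : MHDFlow α β T) {c₀ N : ℝ} (χ : Cutoff c₀ N) (hN : 0 ≤ N) {ε : ℝ}
    (hε : 0 < ε) (x t : ℝ) :
    χ.φ x ^ 2 * S.grad x t ≤ 2 * ε * (∫ z in (-(N + 1))..(N + 1), χ.φ z ^ 2 * S.hess z t)
      + (2 * ε * c₀ ^ 2 + 1 / ε) * ∫ z in (-(N + 1))..(N + 1), S.grad z t := by
  have hχ := χ.cont
  have h := fun F : SmoothField T => F.cutoff_sq_le χ hN hε x t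
  have e1 : ∫ z in (-(N + 1))..(N + 1), χ.φ z ^ 2 * S.hess z t
      = (∫ z in (-(N + 1))..(N + 1), χ.φ z ^ 2 * S.u.fxx z t ^ 2)
      + (∫ z in (-(N + 1))..(N + 1), χ.φ z ^ 2 * S.w₁.fxx z t ^ 2)
      + (∫ z in (-(N + 1))..(N + 1), χ.φ z ^ 2 * S.w₂.fxx z t ^ 2)
      + (∫ z in (-(N + 1))..(N + 1), χ.φ z ^ 2 * S.b₁.fxx z t ^ 2)
      + ∫ z in (-(N + 1))..(N + 1), χ.φ z ^ 2 * S.b₂.fxx z t ^ 2 := by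
    rw [← intervalIntegral.integral_add, ← intervalIntegral.integral_add,
      ← intervalIntegral.integral_add, ← intervalIntegral.integral_add]
    · congr 1
      ext z
      unfold hess
      ring
    all_goals exact Continuous.intervalIntegrable (by fun_prop) _ _
  have e2 : ∫ z in (-(N + 1))..(N + 1), S.grad z t
      = (∫ z in (-(N + 1))..(N + 1), S.u.fx z t ^ 2)
      + (∫ z in (-(N + 1))..(N + 1), S.w₁.fx z t ^ 2)
      + (∫ z in (-(N + 1))..(N + 1), S.w₂.fx z t ^ 2)
      + (∫ z in (-(N + 1))..(N + 1), S.b₁.fx z t ^ 2)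
      + ∫ z in (-(N + 1))..(N + 1), S.b₂.fx z t ^ 2 := by
    rw [← intervalIntegral.integral_add, ← intervalIntegral.integral_add,
      ← intervalIntegral.integral_add, ← intervalIntegral.integral_add]
    · rfl
    all_goals exact Continuous.intervalIntegrable (by fun_prop) _ _
  rw [e1, e2]
  have h1 := h S.u
  have h2 := h S.w₁
  have h3 := h S.w₂
  have h4 := h S.b₁
  have h5 := h S.b₂
  unfold grad
  linarith only [h1, h2, h3, h4, h5]

lemma theta_grad_le (S : MHDFlow α β T) (hβ : 0 < β) (x t : ℝ) :
    S.θ.fx x t ^ 2 ≤ S.thp β x t * S.θ.fx x t ^ 2 + S.θ.fx x t ^ 2 / S.θ.f x t := by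
  have hθ := S.θ_pos x t
  have h1 := S.thp_pos β x t
  rcases le_total 1 (S.θ.f x t) with h | h
  · have : 1 ≤ S.thp β x t := Real.one_le_rpow h hβ.le
    have h2 : 0 ≤ S.θ.fx x t ^ 2 / S.θ.f x t := by positivity
    nlinarith [sq_nonneg (S.θ.fx x t)]
  · have h2 : S.θ.fx x t ^ 2 / 1 ≤ S.θ.fx x t ^ 2 / S.θ.f x t := by gcongr
    have : 0 ≤ S.thp β x t * S.θ.fx x t ^ 2 := by positivity
    linarith

/-- The square of the temperature is controlled by the local dissipation. -/
lemma exists_theta_sq_le (hα : 0 ≤ α) (hβ : 0 < β) (hT : 0 < T) {K δ : ℝ} (hK : 0 < K)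
    (hδ : 0 < δ) (hδ1 : δ ≤ 1) :
    ∃ C, 1 ≤ C ∧ ∀ S : MHDFlow α β T, S.Adm K δ → ∀ t ∈ Icc 0 T, ∀ x,
      S.θ.f x t ^ 2 ≤ C * (1 + ∫ z in x..(x + 1), (S.diss z t + S.dth z t)) := by
  obtain ⟨E, hE1, hE⟩ := exists_entropy_bound (β := β) hα hT hK hδ
  obtain ⟨C, hC1, hC⟩ := exists_v_le (α := α) (β := β) hα hβ hT hK hδ hδ1
  refine ⟨2 * (2 * E + 2) ^ 2 + 2 * C * (2 * E + 2), by nlinarith, ?_⟩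
  intro S hS t ht x
  have hx : x ≤ x + 1 := by linarith
  have hdn := S.diss_nonneg hα
  set G := ∫ z in x..(x + 1), (S.diss z t + S.dth z t) with hG
  have hG0 : 0 ≤ G := integral_nonneg_Icc hx fun z _ => add_nonneg (hdn z t) (S.dth_nonneg z t)
  have h1 : ∫ z in x..(x + 1), S.θ.f z t ≤ 2 * E + 2 :=
    integral_le_of_le_ent (by fun_prop) (hE S hS t ht x (x + 1) hx) fun z => S.theta_le z t
  have h0 : 0 ≤ ∫ z in x..(x + 1), S.θ.f z t :=
    integral_nonneg_Icc hx fun z _ => (S.θ_pos z t).le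
  obtain ⟨y, hy, hyb⟩ := exists_le_of_integral_le (by fun_prop) h1
  have h3 := sq_le_of_weighted (r := fun z => S.θ.f z t) (g := fun z => S.θ.f z t)
    (fun z => S.θ.hasDerivAt_x z t) (by fun_prop) (by fun_prop) (fun z => S.θ_pos z t)
    (x := x) ⟨le_rfl, hx⟩ hy
  have h5 : ∫ z in x..(x + 1), S.θ.fx z t ^ 2 / S.θ.f z t ≤ C * G := by
    rw [hG, ← intervalIntegral.integral_const_mul]
    refine integral_mono_cont hx (by fun_prop (disch := intro _; exact (S.θ_pos _ _).ne'))
      (by fun_prop) fun z _ => ?_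
    have e1 := S.theta_grad_le_dth z t
    have e3 := S.v_pos z t
    have e4 := (hC S hS t ht z).2
    have e5 := S.θ_pos z t
    calc S.θ.fx z t ^ 2 / S.θ.f z t
        = S.v z t * (S.θ.fx z t ^ 2 / (S.v z t * S.θ.f z t)) := by field_simp
      _ ≤ C * S.dth z t := by gcongr
      _ ≤ _ := by
        have := hdn z t
        gcongr
        linarith
  have h6 : (∫ z in x..(x + 1), S.θ.fx z t ^ 2 / S.θ.f z t) * (∫ z in x..(x + 1), S.θ.f z t)
      ≤ C * G * (2 * E + 2) := by gcongr
  have h7 : S.θ.f y t ^ 2 ≤ (2 * E + 2) ^ 2 := by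
    have := S.θ_pos y t
    gcongr
  have h8 : 0 ≤ 2 * (2 * E + 2) ^ 2 * G := by positivity
  have h9 : 0 ≤ 2 * C * (2 * E + 2) := by positivity
  linarith

set_option maxHeartbeats 1000000 in
/-- The second-order energy estimate for the velocity and magnetic fields. -/
lemma exists_neg_pairing_le (hα : 0 ≤ α) (hβ : 0 < β) (hT : 0 < T) {K δ : ℝ} (hK : 0 < K)
    (hδ : 0 < δ) (hδ1 : δ ≤ 1) (c₀ : ℝ) :
    ∃ P, 1 ≤ P ∧ ∀ S : MHDFlow α β T, S.Adm K δ → ∀ N, 0 ≤ N → ∀ χ : Cutoff c₀ N,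
      ∀ t ∈ Icc 0 T, -∫ x in (-(N + 1))..(N + 1), S.pairing χ x t
        ≤ P * (1 + ∫ x in (-(N + 1))..(N + 2), (S.diss x t + S.dth x t))
            * (1 + ∫ x in (-(N + 1))..(N + 1), χ.φ x ^ 2 * S.grad x t)
          + P * ∫ x in (-(N + 1))..(N + 1), χ.φ x ^ 2 * (S.thp β x t * S.θ.fx x t ^ 2) := by
  obtain ⟨C, hC1, hC⟩ := exists_v_le (α := α) (β := β) hα hβ hT hK hδ hδ1
  obtain ⟨L, hL1, hL⟩ := exists_pointwise_le (α := α) (β := β) hα hβ hT hK hδ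
  obtain ⟨B, hB1, hB⟩ := exists_theta_sq_le (α := α) (β := β) hα hβ hT hK hδ hδ1
  obtain ⟨M, hM1, hM⟩ := exists_vx_bound (α := α) (β := β) hα hβ hT hK hδ hδ1
  have hC0 : 0 < C := by linarith
  set m := visc α C⁻¹ with hm
  have hm1 : 1 ≤ m := one_le_visc hα (inv_pos.2 hC0)
  set A₁ := 4 * (m * C ^ 2) + 1 with hA₁
  set A₂ := (1 + 2 * C ^ 2) * (5 * sourceConst α m C) with hA₂
  have hA₂0 : 0 < A₂ := by
    rw [hA₂, sourceConst]
    positivity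
  have hA₁0 : 0 < A₁ := by positivity
  set ε := 1 / (4 * C ^ 2 * A₂ * M) with hε
  have hε0 : 0 < ε := by positivity
  set κ := 2 * ε * c₀ ^ 2 + 1 / ε with hκ
  have hκ0 : 0 < κ := by positivity
  refine ⟨1 + A₁ * c₀ ^ 2 * C + A₂ * (κ * C * M + B * M + C + L), ?_, ?_⟩
  · have : 0 ≤ A₁ * c₀ ^ 2 * C + A₂ * (κ * C * M + B * M + C + L) := by positivity
    linarith
  intro S hS N hN χ t ht
  have hχ := χ.cont
  have hχ' := χ.cont'
  have hp := S.continuous_pairing χ t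
  have hNpos : -(N + 1) ≤ N + 1 := by linarith
  have hdn := S.diss_nonneg hα
  have htn := S.dth_nonneg
  set D := ∫ x in (-(N + 1))..(N + 2), (S.diss x t + S.dth x t) with hD
  set Y := ∫ x in (-(N + 1))..(N + 1), χ.φ x ^ 2 * S.grad x t with hY
  set W := ∫ x in (-(N + 1))..(N + 1), χ.φ x ^ 2 * (S.thp β x t * S.θ.fx x t ^ 2) with hW
  set H := ∫ x in (-(N + 1))..(N + 1), χ.φ x ^ 2 * S.hess x t with hH
  have hY0 : 0 ≤ Y := integral_nonneg_Icc hNpos fun x _ => mul_nonneg (sq_nonneg _)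
    (S.grad_nonneg x t)
  have hW0 : 0 ≤ W := integral_nonneg_Icc hNpos fun x _ => by
    have := S.thp_pos β x t
    positivity
  have hD0 : 0 ≤ D := integral_nonneg_Icc (by linarith) fun z _ => add_nonneg (hdn z t) (htn z t)
  have hH0 : 0 ≤ H := integral_nonneg_Icc hNpos fun x _ => mul_nonneg (sq_nonneg _)
    (S.hess_nonneg x t)
  have hDD : ∫ x in (-(N + 1))..(N + 1), (S.diss x t + S.dth x t) ≤ D :=
    integral_mono_domain le_rfl hNpos (by linarith) (by fun_prop)
      fun z => add_nonneg (hdn z t) (htn z t)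
  have hgC : ∀ x, S.grad x t ≤ C * (S.diss x t + S.dth x t) := fun x => by
    have h1 := S.grad_le hα (hC S hS t ht x).2
    have h2 := mul_nonneg hC0.le (htn x t)
    linarith
  have hgD : ∫ x in (-(N + 1))..(N + 1), S.grad x t ≤ C * D := by
    refine (integral_mono_cont hNpos (by fun_prop) (by fun_prop) fun x _ => hgC x).trans ?_
    rw [intervalIntegral.integral_const_mul]
    gcongr
  have hφ1 : ∀ x, χ.φ x ^ 2 ≤ 1 := fun x => pow_le_one₀ (χ.nonneg x) (χ.le_one x)
  have e1 : -∫ x in (-(N + 1))..(N + 1), S.pairing χ x t ≤ ∫ x in (-(N + 1))..(N + 1),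
      (0 - 1 / (2 * C ^ 2) * (χ.φ x ^ 2 * S.hess x t) + A₁ * (χ.φ' x ^ 2 * S.grad x t)
        + A₂ * (χ.φ x ^ 2 * S.lower x t)) := by
    rw [← intervalIntegral.integral_neg]
    refine integral_mono_cont hNpos (by fun_prop) (by fun_prop) fun x _ => ?_
    obtain ⟨f3, f4⟩ := hC S hS t ht x
    have := S.neg_pairing_le hα hC1 f3 f4 (S.mu_le hα hC0 f3) χ
    linarith
  rw [integral_sub_add_add (by fun_prop) (by fun_prop) (by fun_prop) (by fun_prop),
    intervalIntegral.integral_const_mul, intervalIntegral.integral_zero] at e1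
  have e2 : ∫ x in (-(N + 1))..(N + 1), χ.φ' x ^ 2 * S.grad x t ≤ c₀ ^ 2 * (C * D) := by
    calc _ ≤ ∫ x in (-(N + 1))..(N + 1), c₀ ^ 2 * S.grad x t := by
          refine integral_mono_cont hNpos (by fun_prop) (by fun_prop) fun x _ => ?_
          have := S.grad_nonneg x t
          have : χ.φ' x ^ 2 ≤ c₀ ^ 2 := by
            rw [← sq_abs]
            exact pow_le_pow_left₀ (abs_nonneg _) (χ.deriv_le x) 2
          gcongr
      _ ≤ _ := by
          rw [intervalIntegral.integral_const_mul]
          gcongr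
  have e3 : ∫ x in (-(N + 1))..(N + 1), χ.φ x ^ 2 * S.lower x t ≤
      ∫ x in (-(N + 1))..(N + 1), (χ.φ x ^ 2 * (S.thp β x t * S.θ.fx x t ^ 2) - 0
        + (2 * ε * H + κ * (C * D) + B * (1 + D)) * S.vx x t ^ 2
        + 1 * (C * (S.diss x t + S.dth x t) + L * (1 + D) * (χ.φ x ^ 2 * S.grad x t))) := by
    refine integral_mono_cont hNpos (by fun_prop) (by fun_prop) fun x hx => ?_
    have f1 : ∫ z in x..(x + 1), (S.diss z t + S.dth z t) ≤ D :=
      integral_mono_domain hx.1 (by linarith) (by linarith [hx.2]) (by fun_prop)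
        fun z => add_nonneg (hdn z t) (htn z t)
    have f2 : S.bsq x t ≤ L * (1 + D) := (hL S hS t ht x).2.trans (by gcongr)
    have f3 : S.θ.f x t ^ 2 ≤ B * (1 + D) := (hB S hS t ht x).trans (by gcongr)
    have f4 : χ.φ x ^ 2 * S.grad x t ≤ 2 * ε * H + κ * (C * D) := by
      refine (S.cutoff_grad_le χ hN hε0 x t).trans ?_
      rw [← hκ, ← hH]
      gcongr
    have hv := S.v_pos x t
    have hθ := S.θ_pos x t
    have hg := S.grad_nonneg x t
    have f5 : χ.φ x ^ 2 * S.θ.fx x t ^ 2 ≤ χ.φ x ^ 2 * (S.thp β x t * S.θ.fx x t ^ 2)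
        + C * S.dth x t := by
      have g1 : S.θ.fx x t ^ 2 / S.θ.f x t ≤ C * S.dth x t := by
        calc S.θ.fx x t ^ 2 / S.θ.f x t
            = S.v x t * (S.θ.fx x t ^ 2 / (S.v x t * S.θ.f x t)) := by field_simp
          _ ≤ C * S.dth x t := by
            gcongr
            · exact (hC S hS t ht x).2
            · exact S.theta_grad_le_dth x t
      have g2 := mul_le_mul_of_nonneg_left (S.theta_grad_le hβ x t) (sq_nonneg (χ.φ x))
      have g3 : χ.φ x ^ 2 * (S.θ.fx x t ^ 2 / S.θ.f x t) ≤ 1 * (C * S.dth x t) := by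
        gcongr
        exact hφ1 x
      linarith
    have f6 : χ.φ x ^ 2 * S.grad x t ≤ 1 * (C * S.diss x t) := by
      gcongr
      · exact hφ1 x
      · exact S.grad_le hα (hC S hS t ht x).2
    have f7 : χ.φ x ^ 2 * (S.θ.f x t ^ 2 * S.vx x t ^ 2) ≤ 1 * (B * (1 + D) * S.vx x t ^ 2) := by
      gcongr
      exact hφ1 x
    have f8 := mul_le_mul_of_nonneg_left f4 (sq_nonneg (S.vx x t))
    have f9 : S.bsq x t * (χ.φ x ^ 2 * S.grad x t) ≤ L * (1 + D) * (χ.φ x ^ 2 * S.grad x t) := by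
      gcongr
    unfold lower
    linarith only [f5, f6, f7, f8, f9]
  have e4 : ∫ x in (-(N + 1))..(N + 1), (χ.φ x ^ 2 * (S.thp β x t * S.θ.fx x t ^ 2) - 0
        + (2 * ε * H + κ * (C * D) + B * (1 + D)) * S.vx x t ^ 2
        + 1 * (C * (S.diss x t + S.dth x t) + L * (1 + D) * (χ.φ x ^ 2 * S.grad x t)))
      ≤ W + (2 * ε * H + κ * (C * D) + B * (1 + D)) * M + (C * D + L * (1 + D) * Y) := by
    rw [integral_sub_add_add (by fun_prop) (by fun_prop) (by fun_prop) (by fun_prop),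
      intervalIntegral.integral_add (Continuous.intervalIntegrable (by fun_prop) _ _)
        (Continuous.intervalIntegrable (by fun_prop) _ _),
      intervalIntegral.integral_const_mul, intervalIntegral.integral_const_mul,
      intervalIntegral.integral_zero, sub_zero, one_mul]
    gcongr
    exact hM S hS t ht _ _ hNpos
  have e5 := mul_le_mul_of_nonneg_left (e3.trans e4) hA₂0.le
  have e6 := mul_le_mul_of_nonneg_left e2 hA₁0.le
  have e7 : A₂ * (2 * ε * H * M) = 1 / (2 * C ^ 2) * H := by
    rw [hε]
    field_simp
    ring
  have n1 : 0 ≤ (1 + A₁ * c₀ ^ 2 * C + A₂ * (κ * C * M + B * M + C)) * ((1 + D) * Y) := by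
    positivity
  have n2 : 0 ≤ (1 + A₁ * c₀ ^ 2 * C + A₂ * (κ * C * M + B * M + L)) * W := by positivity
  have n3 : A₂ * W ≤ A₂ * (C * W) := by
    gcongr
    nlinarith
  have n4 : 0 ≤ 1 + A₁ * c₀ ^ 2 * C + A₂ * (κ * C * M + C + L) + D + A₂ * L * D := by positivity
  linarith only [e1, e5, e6, e7, n1, n2, n3, n4]

end MHDFlow

namespace MHDFlow

variable {α β T : ℝ}

lemma diss_le_grad (S : MHDFlow α β T) {C m x t : ℝ} (hm : 1 ≤ m) (h1 : 1 ≤ C * S.v x t)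
    (hmu : S.mu x t ≤ m) : S.diss x t ≤ m * C * S.grad x t := by
  have hv := S.v_pos x t
  have hg := S.grad_nonneg x t
  unfold diss
  rw [div_le_iff₀ hv]
  have h2 : S.mu x t * S.u.fx x t ^ 2 + S.w₁.fx x t ^ 2 + S.w₂.fx x t ^ 2
      + S.b₁.fx x t ^ 2 + S.b₂.fx x t ^ 2 ≤ m * S.grad x t := by
    have e1 : S.mu x t * S.u.fx x t ^ 2 ≤ m * S.u.fx x t ^ 2 := by gcongr
    have e2 : 0 ≤ (m - 1) * (S.w₁.fx x t ^ 2 + S.w₂.fx x t ^ 2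
      + S.b₁.fx x t ^ 2 + S.b₂.fx x t ^ 2) := mul_nonneg (by linarith) (by positivity)
    unfold grad
    linarith
  have h3 : m * S.grad x t * 1 ≤ m * S.grad x t * (C * S.v x t) := by gcongr
  linarith

/-- Pointwise bound for the source terms in the energy identity for `(θ - 1)²`. -/
lemma temperature_source_le (S : MHDFlow α β T) (hα : 0 ≤ α) {C m Q x t : ℝ} (hC : 1 ≤ C)
    (hm : 1 ≤ m) (h1 : 1 ≤ C * S.v x t) (h2 : S.v x t ≤ C) (hmu : S.mu x t ≤ m)
    (hQ : S.θ.f x t ≤ Q) :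
    -S.u.fx x t * (0 * (1 - S.θ.f x t / S.v x t) + S.thf (fun y => y - 1) x t * S.θ.f x t / S.v x t
        - 0 * (1 - 1 / S.v x t))
      ≤ (0 - S.thf (fun y => y - 1) x t - 1 / (1 + S.θ.f x t)) * S.diss x t
        + 1 / 2 * (S.heat x t * (S.thf (fun _ => 1) x t * S.θ.fx x t))
        - 1 / (2 * C) * (S.thp β x t * S.θ.fx x t ^ 2)
        + C * (1 + m) * Q * (S.grad x t + (S.θ.f x t - 1) ^ 2) := by
  have hv := S.v_pos x t
  have hθ := S.θ_pos x t
  have hg := S.grad_nonneg x t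
  have hd := S.diss_nonneg hα x t
  have hdg := S.diss_le_grad hm h1 hmu
  have hW := S.thp_pos β x t
  have hC0 : 0 < C := by linarith
  have hvC : 1 / S.v x t ≤ C := by
    rw [div_le_iff₀ hv]
    exact h1
  have a1 : 1 / (2 * C) * (S.thp β x t * S.θ.fx x t ^ 2)
      ≤ 1 / 2 * (S.heat x t * (S.thf (fun _ => 1) x t * S.θ.fx x t)) := by
    have : 1 / C * (S.thp β x t * S.θ.fx x t ^ 2) ≤ 1 / S.v x t * (S.thp β x t * S.θ.fx x t ^ 2) := by
      gcongr
    calc _ = 1 / 2 * (1 / C * (S.thp β x t * S.θ.fx x t ^ 2)) := by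
          field_simp
      _ ≤ 1 / 2 * (1 / S.v x t * (S.thp β x t * S.θ.fx x t ^ 2)) := by gcongr
      _ = _ := by
          unfold heat thf
          field_simp
  have a2 : -(m * C * Q * S.grad x t)
      ≤ (0 - S.thf (fun y => y - 1) x t - 1 / (1 + S.θ.f x t)) * S.diss x t := by
    have b1 : 1 / (1 + S.θ.f x t) ≤ 1 := by
      rw [div_le_one (by linarith)]
      linarith
    have b2 : 0 ≤ (1 - 1 / (1 + S.θ.f x t)) * S.diss x t := mul_nonneg (by linarith) hd
    have b3 : S.θ.f x t * S.diss x t ≤ Q * (m * C * S.grad x t) := by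
      have : 0 ≤ Q := by linarith
      gcongr
    unfold thf
    linarith
  have a3 : -S.u.fx x t * (0 * (1 - S.θ.f x t / S.v x t)
      + S.thf (fun y => y - 1) x t * S.θ.f x t / S.v x t - 0 * (1 - 1 / S.v x t))
      ≤ C * Q * (S.grad x t + (S.θ.f x t - 1) ^ 2) := by
    have b1 : -S.u.fx x t * (S.θ.f x t - 1) ≤ S.grad x t + (S.θ.f x t - 1) ^ 2 := by
      have : 0 ≤ (S.u.fx x t + (S.θ.f x t - 1)) ^ 2 := sq_nonneg _
      have : S.u.fx x t ^ 2 ≤ S.grad x t := by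
        unfold grad
        linarith [sq_nonneg (S.w₁.fx x t), sq_nonneg (S.w₂.fx x t), sq_nonneg (S.b₁.fx x t),
          sq_nonneg (S.b₂.fx x t)]
      nlinarith
    calc _ = (1 / S.v x t) * S.θ.f x t * (-S.u.fx x t * (S.θ.f x t - 1)) := by
          unfold thf
          ring
      _ ≤ (1 / S.v x t) * S.θ.f x t * (S.grad x t + (S.θ.f x t - 1) ^ 2) := by gcongr
      _ ≤ _ := by gcongr
  have a4 : 0 ≤ m * C * Q * (S.θ.f x t - 1) ^ 2 := by
    have : 0 < Q := by linarith
    positivity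
  linarith

set_option maxHeartbeats 1000000 in
/-- The temperature is bounded in `L^∞(0, T; L²)`, and the heat flux in `L²`. -/
lemma exists_temperature_bound (hα : 0 ≤ α) (hβ : 0 < β) (hT : 0 < T) {K δ : ℝ} (hK : 0 < K)
    (hδ : 0 < δ) (hδ1 : δ ≤ 1) :
    ∃ C, 1 ≤ C ∧ ∀ S : MHDFlow α β T, S.Adm K δ → ∀ a b, a ≤ b →
      (∀ t ∈ Icc 0 T, ∫ x in a..b, (S.θ.f x t - 1) ^ 2 ≤ C) ∧
      ∫ t in (0:ℝ)..T, ∫ x in a..b, S.thp β x t * S.θ.fx x t ^ 2 ≤ C := by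
  obtain ⟨C, hC1, hC⟩ := exists_v_le (α := α) (β := β) hα hβ hT hK hδ hδ1
  obtain ⟨L, hL1, hL⟩ := exists_pointwise_le (α := α) (β := β) hα hβ hT hK hδ
  obtain ⟨I, hI1, hI⟩ := exists_gradient_bound (α := α) (β := β) hα hβ hT hK hδ hδ1
  obtain ⟨c₀, hc₀, hcut⟩ := exists_cutoff
  obtain ⟨P, hP1, hP⟩ := exists_neg_pairing_le (α := α) (β := β) hα hβ hT hK hδ hδ1 c₀
  have hk : ContinuousOn (fun y : ℝ => y - 1) (Ioi 0) := by fun_prop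
  have hk' : ContinuousOn (fun _ : ℝ => (1:ℝ)) (Ioi 0) := by fun_prop
  have hH : ContinuousOn (fun y : ℝ => (y - 1) ^ 2 / 2) (Ioi 0) := by fun_prop
  obtain ⟨C₀, hC₀0, hen⟩ := energy_inequality (β := β) hα c₀ (le_refl (0:ℝ)) 0
    (k := fun y => y - 1) (k' := fun _ => 1) (H := fun y => (y - 1) ^ 2 / 2)
    (fun y _ => (hasDerivAt_id y).sub_const 1) hk' (fun y _ => one_pos)
    (fun y _ => ((((hasDerivAt_id y).sub_const 1).pow 2).div_const 2).congr_deriv (by simp))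
  have hC0 : 0 < C := by linarith
  set m := visc α C⁻¹ with hm
  have hm1 : 1 ≤ m := one_le_visc hα (inv_pos.2 hC0)
  set Λ := 2 * C * (2 * P + 1) with hΛ
  have hΛ1 : 1 ≤ Λ := by nlinarith
  set J := C * (1 + m) * L with hJ
  have hJ0 : 0 ≤ J := by positivity
  set G := Λ * C₀ + 2 * Λ * J + 2 * P with hG
  have hG0 : 0 ≤ G := by positivity
  set R := (1 + (Λ + 1) * K ^ 2) * Real.exp (G * (T + I)) with hR
  have hR0 : 0 ≤ R := by positivity
  refine ⟨1 + 2 * R, by linarith, ?_⟩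
  intro S hS a b hab
  obtain ⟨N₀, hN₀, hfar⟩ := S.exists_farFrom
  set N := max N₀ (max |a| |b|) with hN
  have hNN : N₀ ≤ N := le_max_left _ _
  have hNpos : -(N + 1) ≤ N + 1 := by linarith
  have hNpos' : -(N + 1) ≤ N + 2 := by linarith
  obtain ⟨χ⟩ := hcut N (by linarith)
  have hχ := χ.cont
  have hdn := S.diss_nonneg hα
  have htn := S.dth_nonneg
  have hyn : ∀ s, 0 ≤ ∫ x in (-(N + 1))..(N + 1), χ.φ x ^ 2 * (0 / 2 * S.kin x s
      + S.thf (fun y => (y - 1) ^ 2 / 2) x s + 0 * (S.v x s - 1 - Real.log (S.v x s))) :=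
    fun s => integral_nonneg_Icc hNpos fun x _ => by
      unfold thf
      rw [zero_mul, add_zero, zero_div, zero_mul, zero_add]
      positivity
  have hgn : ∀ s, 0 ≤ ∫ x in (-(N + 1))..(N + 1), χ.φ x ^ 2 * S.grad x s := fun s =>
    integral_nonneg_Icc hNpos fun x _ => mul_nonneg (sq_nonneg _) (S.grad_nonneg x s)
  have hDn : ∀ s, 0 ≤ ∫ x in (-(N + 1))..(N + 2), (S.diss x s + S.dth x s) := fun s =>
    integral_nonneg_Icc hNpos' fun x _ => add_nonneg (hdn x s) (htn x s)
  have hWn : ∀ s, 0 ≤ ∫ x in (-(N + 1))..(N + 1), χ.φ x ^ 2 * (S.thp β x s * S.θ.fx x s ^ 2) :=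
    fun s => integral_nonneg_Icc hNpos fun x _ => by
      have := S.thp_pos β x s
      positivity
  have cy : Continuous fun s => ∫ x in (-(N + 1))..(N + 1), χ.φ x ^ 2 * (0 / 2 * S.kin x s
      + S.thf (fun y => (y - 1) ^ 2 / 2) x s + 0 * (S.v x s - 1 - Real.log (S.v x s))) :=
    continuous_integral_left (by fun_prop (disch := intro _; exact (S.v_pos _ _).ne'))
  have cg : Continuous fun s => ∫ x in (-(N + 1))..(N + 1), χ.φ x ^ 2 * S.grad x s :=
    continuous_integral_left (by fun_prop)
  have cD : Continuous fun s => ∫ x in (-(N + 1))..(N + 2), (S.diss x s + S.dth x s) :=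
    continuous_integral_left (by fun_prop)
  have cW : Continuous fun s => ∫ x in (-(N + 1))..(N + 1),
      χ.φ x ^ 2 * (S.thp β x s * S.θ.fx x s ^ 2) := continuous_integral_left (by fun_prop)
  have main := gronwall_dissipative (M := G * (T + I)) hT.le
    (y := fun s => Λ * (∫ x in (-(N + 1))..(N + 1), χ.φ x ^ 2 * (0 / 2 * S.kin x s
      + S.thf (fun y => (y - 1) ^ 2 / 2) x s + 0 * (S.v x s - 1 - Real.log (S.v x s))))
      + ∫ x in (-(N + 1))..(N + 1), χ.φ x ^ 2 * S.grad x s)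
    (d := fun s => ∫ x in (-(N + 1))..(N + 1), χ.φ x ^ 2 * (S.thp β x s * S.θ.fx x s ^ 2))
    (g := fun s => G * (1 + ∫ x in (-(N + 1))..(N + 2), (S.diss x s + S.dth x s)))
    ((continuous_const.mul cy).add cg) cW (continuous_const.mul (continuous_const.add cD)) hWn
    (fun s => mul_nonneg hG0 (by linarith [hDn s]))
    (fun s => add_nonneg (mul_nonneg (by linarith) (hyn s)) (hgn s))
    (fun s hs => by
      have hs' : s ∈ Icc 0 T := ⟨hs.1.le, hs.2.le⟩
      obtain ⟨y', h1, h2⟩ := hen T S N (by linarith) (hfar.mono (by linarith)) χ s hs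
      refine ⟨Λ * y' + -2 * ∫ x in (-(N + 1))..(N + 1), S.pairing χ x s,
        (h1.const_mul Λ).add (S.hasDerivAt_grad_energy χ hs), ?_⟩
      have hPs := hP S hS N (by linarith) χ s hs'
      have hYn := hyn s
      have hGn := hgn s
      have hDs := hDn s
      have hWs := hWn s
      set D := ∫ x in (-(N + 1))..(N + 2), (S.diss x s + S.dth x s) with hD
      set W := ∫ x in (-(N + 1))..(N + 1), χ.φ x ^ 2 * (S.thp β x s * S.θ.fx x s ^ 2) with hW
      have e1 := integral_mono_cont hNpos (f := fun x => χ.φ x ^ 2 * (-S.u.fx x s *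
          (0 * (1 - S.θ.f x s / S.v x s) + S.thf (fun y => y - 1) x s * S.θ.f x s / S.v x s
            - 0 * (1 - 1 / S.v x s))))
        (g := fun x => χ.φ x ^ 2 * ((0 - S.thf (fun y => y - 1) x s - 1 / (1 + S.θ.f x s))
            * S.diss x s + 1 / 2 * (S.heat x s * (S.thf (fun _ => 1) x s * S.θ.fx x s)))
          - 1 / (2 * C) * (χ.φ x ^ 2 * (S.thp β x s * S.θ.fx x s ^ 2))
          + J * (1 + D) * (χ.φ x ^ 2 * S.grad x s)
          + 2 * J * (1 + D) * (χ.φ x ^ 2 * (0 / 2 * S.kin x s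
            + S.thf (fun y => (y - 1) ^ 2 / 2) x s + 0 * (S.v x s - 1 - Real.log (S.v x s)))))
        (by fun_prop (disch := intro _; exact (S.v_pos _ _).ne'))
        (by fun_prop (disch := intro _; first | exact (S.v_pos _ _).ne' |
              exact (add_pos one_pos (S.θ_pos _ _)).ne')) fun x hx => by
          have f1 : ∫ z in x..(x + 1), (S.diss z s + S.dth z s) ≤ D :=
            integral_mono_domain hx.1 (by linarith) (by linarith [hx.2]) (by fun_prop)
              fun z => add_nonneg (hdn z s) (htn z s)
          have f2 : S.θ.f x s ≤ L * (1 + D) := (hL S hS s hs' x).1.trans (by gcongr)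
          obtain ⟨f3, f4⟩ := hC S hS s hs' x
          have f5 := mul_le_mul_of_nonneg_left (S.temperature_source_le hα hC1 hm1 f3 f4
            (S.mu_le hα hC0 f3) f2) (sq_nonneg (χ.φ x))
          have f6 : S.thf (fun y => (y - 1) ^ 2 / 2) x s = (S.θ.f x s - 1) ^ 2 / 2 := rfl
          rw [f6, hJ]
          linarith only [f5]
      rw [integral_sub_add_add
        (by fun_prop (disch := intro _; first | exact (S.v_pos _ _).ne' |
              exact (add_pos one_pos (S.θ_pos _ _)).ne')) (by fun_prop)
        (by fun_prop) (by fun_prop (disch := intro _; exact (S.v_pos _ _).ne')),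
        intervalIntegral.integral_const_mul] at e1
      set Y := ∫ x in (-(N + 1))..(N + 1), χ.φ x ^ 2 * (0 / 2 * S.kin x s
        + S.thf (fun y => (y - 1) ^ 2 / 2) x s + 0 * (S.v x s - 1 - Real.log (S.v x s))) with hY
      set Z := ∫ x in (-(N + 1))..(N + 1), χ.φ x ^ 2 * S.grad x s with hZ
      have e2 : y' + 1 / (2 * C) * W ≤ C₀ + J * (1 + D) * Z + 2 * J * (1 + D) * Y := by
        linarith only [h2, e1]
      have e3 := mul_le_mul_of_nonneg_left e2 (zero_le_one.trans hΛ1)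
      have e4 : Λ * (1 / (2 * C) * W) = (2 * P + 1) * W := by
        rw [hΛ]
        field_simp
      have n1 : 0 ≤ Λ * C₀ * (D + (1 + D) * (Λ * Y + Z)) := by positivity
      have n2 : 0 ≤ Λ * J * ((1 + D) * (2 + Z)) := by positivity
      have n3 : 0 ≤ 2 * Λ * J * ((1 + D) * ((Λ - 1) * Y)) := by
        have : 0 ≤ Λ - 1 := by linarith
        positivity
      have n4 : 0 ≤ 2 * P * ((1 + D) * (Λ * Y)) := by positivity
      rw [hG]
      linarith only [e3, e4, n1, n2, n3, n4, hPs]) (by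
      rw [intervalIntegral.integral_const_mul, intervalIntegral.integral_add
        (Continuous.intervalIntegrable (by fun_prop) _ _)
        (Continuous.intervalIntegrable cD _ _), intervalIntegral.integral_const]
      gcongr
      · simp
      · exact hI S hS _ _ hNpos')
  have ha : |a| ≤ N := (le_max_left _ _).trans (le_max_right _ _)
  have hb : |b| ≤ N := (le_max_right _ _).trans (le_max_right _ _)
  have h0 : Λ * (∫ x in (-(N + 1))..(N + 1), χ.φ x ^ 2 * (0 / 2 * S.kin x 0
      + S.thf (fun y => (y - 1) ^ 2 / 2) x 0 + 0 * (S.v x 0 - 1 - Real.log (S.v x 0))))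
      + (∫ x in (-(N + 1))..(N + 1), χ.φ x ^ 2 * S.grad x 0) ≤ (Λ + 1) * K ^ 2 := by
    have hle : ∀ x, 0 ≤ (S.v x 0 - 1) ^ 2 + S.u.f x 0 ^ 2 + S.bsq x 0
        + (S.w₁.f x 0 ^ 2 + S.w₂.f x 0 ^ 2) + S.vx x 0 ^ 2 + S.θ.fx x 0 ^ 2 := fun x => by
      have := S.bsq_nonneg x 0
      positivity
    have hφ1 : ∀ x, χ.φ x ^ 2 ≤ 1 := fun x => pow_le_one₀ (χ.nonneg x) (χ.le_one x)
    have k1 : ∫ x in (-(N + 1))..(N + 1), χ.φ x ^ 2 * (0 / 2 * S.kin x 0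
      + S.thf (fun y => (y - 1) ^ 2 / 2) x 0 + 0 * (S.v x 0 - 1 - Real.log (S.v x 0)))
      ≤ K ^ 2 := by
      refine (integral_mono_cont hNpos (by fun_prop (disch := intro _; exact (S.v_pos _ _).ne'))
        (by fun_prop) fun x _ => ?_).trans (hS.bound _ _ hNpos)
      have g0 := hle x
      have g1 := S.grad_nonneg x 0
      have g2 : χ.φ x ^ 2 * ((S.θ.f x 0 - 1) ^ 2 / 2) ≤ (S.θ.f x 0 - 1) ^ 2 / 2 :=
        mul_le_of_le_one_left (by positivity) (hφ1 x)
      have g3 := sq_nonneg (S.θ.f x 0 - 1)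
      unfold thf
      linarith
    have k2 : ∫ x in (-(N + 1))..(N + 1), χ.φ x ^ 2 * S.grad x 0 ≤ K ^ 2 := by
      refine (integral_mono_cont hNpos (by fun_prop) (by fun_prop) fun x _ => ?_).trans
        (hS.bound _ _ hNpos)
      have g0 := hle x
      have g2 : χ.φ x ^ 2 * S.grad x 0 ≤ S.grad x 0 :=
        mul_le_of_le_one_left (S.grad_nonneg x 0) (hφ1 x)
      have g3 := sq_nonneg (S.θ.f x 0 - 1)
      linarith
    have k3 := mul_le_mul_of_nonneg_left k1 (zero_le_one.trans hΛ1)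
    linarith
  have hR' := mul_le_mul_of_nonneg_right (add_le_add_right h0 1)
    (Real.exp_pos (G * (T + I))).le
  constructor
  · intro t ht
    have q1 := (main t ht).trans hR'
    have q2 : 0 ≤ ∫ s in (0:ℝ)..t, ∫ x in (-(N + 1))..(N + 1),
        χ.φ x ^ 2 * (S.thp β x s * S.θ.fx x s ^ 2) :=
      integral_nonneg_Icc ht.1 fun s _ => hWn s
    have q3 : ∫ x in a..b, (S.θ.f x t - 1) ^ 2 ≤ 2 * ∫ x in (-(N + 1))..(N + 1),
        χ.φ x ^ 2 * (0 / 2 * S.kin x t + S.thf (fun y => (y - 1) ^ 2 / 2) x t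
          + 0 * (S.v x t - 1 - Real.log (S.v x t))) := by
      rw [← intervalIntegral.integral_const_mul]
      refine (χ.integral_le_of_abs_le hab ha hb (by fun_prop) fun x => sq_nonneg _).trans_eq ?_
      refine intervalIntegral.integral_congr fun x _ => ?_
      simp only [thf]
      ring
    have q4 := hyn t
    have q5 := hgn t
    have q6 := mul_le_mul_of_nonneg_right hΛ1 q4
    have q7 : R = (1 + (Λ + 1) * K ^ 2) * Real.exp (G * (T + I)) := hR
    linarith
  · have q1 := (main T ⟨hT.le, le_rfl⟩).trans hR'
    have q3 : ∫ t in (0:ℝ)..T, ∫ x in a..b, S.thp β x t * S.θ.fx x t ^ 2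
        ≤ ∫ s in (0:ℝ)..T, ∫ x in (-(N + 1))..(N + 1),
          χ.φ x ^ 2 * (S.thp β x s * S.θ.fx x s ^ 2) := by
      refine integral_mono_cont hT.le (continuous_integral_left (by fun_prop)) cW fun t _ => ?_
      exact χ.integral_le_of_abs_le hab ha hb (by fun_prop) fun x => by
        have := S.thp_pos β x t
        positivity
    have q4 := hyn T
    have q5 := hgn T
    have q6 := mul_le_mul_of_nonneg_right hΛ1 q4
    have q7 : R = (1 + (Λ + 1) * K ^ 2) * Real.exp (G * (T + I)) := hR
    linarith

end MHDFlow

/-- A bound on the integrals of a nonnegative continuous function over strips `[a, b] × [0, T]`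
passes to the iterated integral over `ℝ × [0, T]`. -/
lemma integral_integral_le {F : ℝ → ℝ → ℝ} (hF : Continuous fun p : ℝ × ℝ => F p.1 p.2)
    (h0 : ∀ x t, 0 ≤ F x t) {T C : ℝ} (hT : 0 ≤ T) (hC : 0 ≤ C)
    (h : ∀ a b, a ≤ b → ∫ t in (0:ℝ)..T, ∫ x in a..b, F x t ≤ C) :
    ∫ s in (0:ℝ)..T, ∫ x, F x s ≤ C := by
  rw [intervalIntegral.integral_of_le hT]
  by_cases hi : Integrable (fun s => ∫ x, F x s) (volume.restrict (Ioc 0 T))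
  swap
  · rw [integral_undef hi]
    exact hC
  have hcont : ∀ n : ℕ, Continuous fun s => ∫ x in (-(n:ℝ))..n, F x s := fun n =>
    continuous_integral_left hF
  have hneg : ∀ n : ℕ, -(n:ℝ) ≤ n := fun n => by
    have : (0:ℝ) ≤ n := n.cast_nonneg
    linarith
  have hpos : ∀ (n : ℕ) s, 0 ≤ ∫ x in (-(n:ℝ))..n, F x s := fun n s =>
    integral_nonneg_Icc (hneg n) fun x _ => h0 x s
  rw [integral_eq_lintegral_of_nonneg_ae (Eventually.of_forall fun s => integral_nonneg
    fun x => h0 x s) hi.aestronglyMeasurable]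
  refine ENNReal.toReal_le_of_le_ofReal hC ?_
  calc ∫⁻ s in Ioc 0 T, ENNReal.ofReal (∫ x, F x s)
      ≤ ∫⁻ s in Ioc 0 T, liminf (fun n : ℕ => ENNReal.ofReal (∫ x in (-(n:ℝ))..n, F x s))
          atTop := by
        refine lintegral_mono fun s => ?_
        by_cases hs : Integrable fun x => F x s
        · have h1 : Tendsto (fun n : ℕ => ∫ x in (-(n:ℝ))..n, F x s) atTop (nhds (∫ x, F x s)) :=
            intervalIntegral_tendsto_integral hs
              (tendsto_neg_atTop_atBot.comp tendsto_natCast_atTop_atTop)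
              tendsto_natCast_atTop_atTop
          exact ((ENNReal.continuous_ofReal.tendsto _).comp h1).liminf_eq.ge
        · simp [integral_undef hs]
    _ ≤ liminf (fun n : ℕ => ∫⁻ s in Ioc 0 T, ENNReal.ofReal (∫ x in (-(n:ℝ))..n, F x s))
          atTop := lintegral_liminf_le fun n => (hcont n).measurable.ennreal_ofReal
    _ ≤ ENNReal.ofReal C := by
        refine (liminf_le_liminf (Eventually.of_forall fun n => ?_)).trans
          (liminf_const (f := atTop (α := ℕ)) (ENNReal.ofReal C)).le
        rw [← ofReal_integral_eq_lintegral_ofReal ((hcont n).integrableOn_Ioc)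
          (Eventually.of_forall (hpos n))]
        refine ENNReal.ofReal_le_ofReal ?_
        rw [← intervalIntegral.integral_of_le hT]
        exact h _ _ (hneg n)

/-- The projection of a time onto `[0, T]`. -/
def clamp (T t : ℝ) : ℝ := max 0 (min t T)

lemma continuous_clamp (T : ℝ) : Continuous (clamp T) := by
  unfold clamp
  fun_prop

lemma clamp_mem {T : ℝ} (hT : 0 ≤ T) (t : ℝ) : clamp T t ∈ Icc 0 T :=
  ⟨le_max_left _ _, max_le hT (min_le_right _ _)⟩

lemma clamp_eq {T t : ℝ} (ht : t ∈ Icc 0 T) : clamp T t = t := by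
  rw [clamp, min_eq_left ht.2, max_eq_right ht.1]

lemma continuous_comp_clamp {E : Type*} [TopologicalSpace E] {T : ℝ} (hT : 0 ≤ T) {g : ℝ → ℝ → E}
    (hg : ContinuousOn (fun p : ℝ × ℝ => g p.1 p.2) (univ ×ˢ Icc 0 T)) :
    Continuous fun p : ℝ × ℝ => g p.1 (clamp T p.2) :=
  hg.comp_continuous (f := fun p : ℝ × ℝ => (p.1, clamp T p.2))
    (continuous_fst.prodMk ((continuous_clamp T).comp continuous_snd))
    fun p => ⟨mem_univ _, clamp_mem hT p.2⟩

lemma hasDerivAt_comp_clamp {T t g' : ℝ} {g : ℝ → ℝ} (ht : t ∈ Ioo 0 T)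
    (hg : HasDerivWithinAt g g' (Icc 0 T) t) : HasDerivAt (fun s => g (clamp T s)) g' t := by
  refine (hg.hasDerivAt (Icc_mem_nhds ht.1 ht.2)).congr_of_eventuallyEq ?_
  filter_upwards [Icc_mem_nhds ht.1 ht.2] with s hs
  rw [clamp_eq hs]

/-- The extension of a smooth function on `ℝ × [0, T]` constant in time outside `[0, T]`. -/
def SmoothField.extend {T : ℝ} (hT : 0 ≤ T) (g gx gxx gt : ℝ → ℝ → ℝ)
    (c : ContinuousOn (fun p : ℝ × ℝ => g p.1 p.2) (univ ×ˢ Icc 0 T))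
    (cx : ContinuousOn (fun p : ℝ × ℝ => gx p.1 p.2) (univ ×ˢ Icc 0 T))
    (cxx : ContinuousOn (fun p : ℝ × ℝ => gxx p.1 p.2) (univ ×ˢ Icc 0 T))
    (ct : ContinuousOn (fun p : ℝ × ℝ => gt p.1 p.2) (univ ×ˢ Icc 0 T))
    (hx : ∀ x, ∀ t ∈ Icc 0 T, HasDerivAt (fun y => g y t) (gx x t) x)
    (hxx : ∀ x, ∀ t ∈ Icc 0 T, HasDerivAt (fun y => gx y t) (gxx x t) x)
    (ht : ∀ x, ∀ t ∈ Icc 0 T, HasDerivWithinAt (fun s => g x s) (gt x t) (Icc 0 T) t) :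
    SmoothField T where
  f x t := g x (clamp T t)
  fx x t := gx x (clamp T t)
  fxx x t := gxx x (clamp T t)
  ft x t := gt x (clamp T t)
  cont_f := continuous_comp_clamp hT c
  cont_fx := continuous_comp_clamp hT cx
  cont_fxx := continuous_comp_clamp hT cxx
  cont_ft := continuous_comp_clamp hT ct
  hasDerivAt_x x t := hx x _ (clamp_mem hT t)
  hasDerivAt_xx x t := hxx x _ (clamp_mem hT t)
  hasDerivAt_t x t h := by
    rw [clamp_eq ⟨h.1.le, h.2.le⟩]
    exact hasDerivAt_comp_clamp h (ht x t ⟨h.1.le, h.2.le⟩)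

namespace IsClassicalSolution

variable {α β T : ℝ} {v u θ : ℝ → ℝ → ℝ} {w b : ℝ → ℝ → ℝ × ℝ}
  {x t : ℝ}

lemma hasDerivAt_flux (h : IsClassicalSolution α β T v u θ w b)
    (ht : t ∈ Icc 0 T) :
    HasDerivAt (fun y => visc α (v y t) * pdx u y t / v y t - θ y t / v y t
      - ((b y t).1 ^ 2 + (b y t).2 ^ 2) / 2) (pdt T u x t) x := by
  have hv := (h.v_pos x t ht).ne'
  obtain ⟨d1, -, d3, -, d5⟩ := h.diff_x x t ht
  obtain ⟨e1, -⟩ := h.diff_xx x t ht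
  have d51 := d5.fst
  have d52 := d5.snd
  have f1 : DifferentiableAt ℝ (fun y => visc α (v y t) * pdx u y t / v y t) x := by
    have : DifferentiableAt ℝ (fun y => visc α (v y t)) x := by
      unfold visc
      exact ((d1.rpow_const (Or.inl hv)).const_mul α).const_add 1
    exact (this.mul e1).div d1 hv
  have f2 : DifferentiableAt ℝ (fun y => θ y t / v y t + sq2 (b y t) / 2) x := by
    unfold sq2
    exact (d3.div d1 hv).add (((d51.pow 2).add (d52.pow 2)).div_const 2)
  have e := h.eq_mom x t ht
  refine ((f1.hasDerivAt.sub f2.hasDerivAt).congr_of_eventuallyEq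
    (Eventually.of_forall fun y => ?_)).congr_deriv ?_
  · simp only [Pi.sub_apply, sq2]
    ring
  · unfold pdx at e ⊢
    linarith

lemma hasDerivAt_transverse (h : IsClassicalSolution α β T v u θ w b)
    (ht : t ∈ Icc 0 T) :
    HasDerivAt (fun y => (v y t)⁻¹ • pdx w y t + b y t) (pdt T w x t) x := by
  have hv := (h.v_pos x t ht).ne'
  obtain ⟨d1, -, -, -, d5⟩ := h.diff_x x t ht
  obtain ⟨-, -, e1, -⟩ := h.diff_xx x t ht
  refine (((d1.inv hv).smul e1).hasDerivAt.add d5.hasDerivAt).congr_deriv ?_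
  rw [← eq_sub_iff_add_eq]
  exact (h.eq_w x t ht).symm

lemma hasDerivAt_magnetic (h : IsClassicalSolution α β T v u θ w b)
    (hT : 0 < T) (ht : t ∈ Icc 0 T) :
    HasDerivAt (fun y => (v y t)⁻¹ • pdx b y t + w y t)
      (pdx u x t • b x t + v x t • pdt T b x t) x := by
  have hv := (h.v_pos x t ht).ne'
  obtain ⟨d1, -, -, d4, -⟩ := h.diff_x x t ht
  obtain ⟨-, -, -, e1⟩ := h.diff_xx x t ht
  obtain ⟨t1, -, -, -, t5⟩ := h.diff_t x t ht
  have k : pdt T (fun y s => v y s • b y s) x t = pdx u x t • b x t + v x t • pdt T b x t := by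
    rw [← h.eq_mass x t ht, add_comm]
    exact (t1.hasDerivWithinAt.smul t5.hasDerivWithinAt).derivWithin
      (uniqueDiffOn_Icc hT t ht)
  refine (((d1.inv hv).smul e1).hasDerivAt.add d4.hasDerivAt).congr_deriv ?_
  rw [← k, ← eq_sub_iff_add_eq]
  exact (h.eq_b x t ht).symm

lemma hasDerivAt_heat (h : IsClassicalSolution α β T v u θ w b)
    (ht : t ∈ Icc 0 T) :
    HasDerivAt (fun y => θ y t ^ β * pdx θ y t / v y t)
      (pdt T θ x t + θ x t / v x t * pdx u x t - (visc α (v x t) * pdx u x t ^ 2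
      + (pdx w x t).1 ^ 2 + (pdx w x t).2 ^ 2 + (pdx b x t).1 ^ 2 + (pdx b x t).2 ^ 2) / v x t)
      x := by
  have hv := (h.v_pos x t ht).ne'
  obtain ⟨d1, -, d3, -, -⟩ := h.diff_x x t ht
  obtain ⟨-, e1, -, -⟩ := h.diff_xx x t ht
  have f : DifferentiableAt ℝ (fun y => θ y t ^ β * pdx θ y t / v y t) x :=
    ((d3.rpow_const (Or.inl (h.θ_pos x t ht).ne')).mul e1).div d1 hv
  refine f.hasDerivAt.congr_deriv ?_
  have e := h.eq_temp x t ht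
  unfold sq2 at e
  rw [e]
  unfold pdx
  ring

/-- The flow in flux form associated with a classical solution. -/
def toFlow (h : IsClassicalSolution α β T v u θ w b) (hT : 0 < T) : MHDFlow α β T where
  v x t := v x (clamp T t)
  vx x t := pdx v x (clamp T t)
  u := .extend hT.le u (pdx u) (pdx (pdx u)) (pdt T u) h.cont.snd.fst h.cont_dx.snd.fst
    h.cont_dxx.fst h.cont_dt.snd.fst
    (fun x t ht => (h.diff_x x t ht).2.1.hasDerivAt)
    (fun x t ht => (h.diff_xx x t ht).1.hasDerivAt)
    (fun x t ht => (h.diff_t x t ht).2.1.hasDerivWithinAt)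
  θ := .extend hT.le θ (pdx θ) (pdx (pdx θ)) (pdt T θ) h.cont.snd.snd.fst h.cont_dx.snd.snd.fst
    h.cont_dxx.snd.fst h.cont_dt.snd.snd.fst
    (fun x t ht => (h.diff_x x t ht).2.2.1.hasDerivAt)
    (fun x t ht => (h.diff_xx x t ht).2.1.hasDerivAt)
    (fun x t ht => (h.diff_t x t ht).2.2.1.hasDerivWithinAt)
  w₁ := .extend hT.le (fun x t => (w x t).1) (fun x t => (pdx w x t).1)
    (fun x t => (pdx (pdx w) x t).1) (fun x t => (pdt T w x t).1)
    h.cont.snd.snd.snd.fst.fst h.cont_dx.snd.snd.snd.fst.fst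
    h.cont_dxx.snd.snd.fst.fst h.cont_dt.snd.snd.snd.fst.fst
    (fun x t ht => (h.diff_x x t ht).2.2.2.1.hasDerivAt.fst)
    (fun x t ht => (h.diff_xx x t ht).2.2.1.hasDerivAt.fst)
    (fun x t ht => (h.diff_t x t ht).2.2.2.1.hasDerivWithinAt.fst)
  w₂ := .extend hT.le (fun x t => (w x t).2) (fun x t => (pdx w x t).2)
    (fun x t => (pdx (pdx w) x t).2) (fun x t => (pdt T w x t).2)
    h.cont.snd.snd.snd.fst.snd h.cont_dx.snd.snd.snd.fst.snd
    h.cont_dxx.snd.snd.fst.snd h.cont_dt.snd.snd.snd.fst.snd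
    (fun x t ht => (h.diff_x x t ht).2.2.2.1.hasDerivAt.snd)
    (fun x t ht => (h.diff_xx x t ht).2.2.1.hasDerivAt.snd)
    (fun x t ht => (h.diff_t x t ht).2.2.2.1.hasDerivWithinAt.snd)
  b₁ := .extend hT.le (fun x t => (b x t).1) (fun x t => (pdx b x t).1)
    (fun x t => (pdx (pdx b) x t).1) (fun x t => (pdt T b x t).1)
    h.cont.snd.snd.snd.snd.fst h.cont_dx.snd.snd.snd.snd.fst
    h.cont_dxx.snd.snd.snd.fst h.cont_dt.snd.snd.snd.snd.fst
    (fun x t ht => (h.diff_x x t ht).2.2.2.2.hasDerivAt.fst)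
    (fun x t ht => (h.diff_xx x t ht).2.2.2.hasDerivAt.fst)
    (fun x t ht => (h.diff_t x t ht).2.2.2.2.hasDerivWithinAt.fst)
  b₂ := .extend hT.le (fun x t => (b x t).2) (fun x t => (pdx b x t).2)
    (fun x t => (pdx (pdx b) x t).2) (fun x t => (pdt T b x t).2)
    h.cont.snd.snd.snd.snd.snd h.cont_dx.snd.snd.snd.snd.snd
    h.cont_dxx.snd.snd.snd.snd h.cont_dt.snd.snd.snd.snd.snd
    (fun x t ht => (h.diff_x x t ht).2.2.2.2.hasDerivAt.snd)
    (fun x t ht => (h.diff_xx x t ht).2.2.2.hasDerivAt.snd)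
    (fun x t ht => (h.diff_t x t ht).2.2.2.2.hasDerivWithinAt.snd)
  cont_v := continuous_comp_clamp hT.le h.cont.fst
  cont_vx := continuous_comp_clamp hT.le h.cont_dx.fst
  v_pos x t := h.v_pos x _ (clamp_mem hT.le t)
  θ_pos x t := h.θ_pos x _ (clamp_mem hT.le t)
  hasDerivAt_vx x t := (h.diff_x x _ (clamp_mem hT.le t)).1.hasDerivAt
  hasDerivAt_vt x t ht := by
    have ht' : t ∈ Icc 0 T := ⟨ht.1.le, ht.2.le⟩
    refine (hasDerivAt_comp_clamp ht (h.diff_t x t ht').1.hasDerivWithinAt).congr_deriv ?_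
    simp only [SmoothField.extend]
    rw [clamp_eq ht']
    exact h.eq_mass x t ht'
  momentum x t := h.hasDerivAt_flux (clamp_mem hT.le t)
  transverse₁ x t := (h.hasDerivAt_transverse (clamp_mem hT.le t)).fst.congr_of_eventuallyEq
    (Eventually.of_forall fun y => by simp [SmoothField.extend, div_eq_inv_mul])
  transverse₂ x t := (h.hasDerivAt_transverse (clamp_mem hT.le t)).snd.congr_of_eventuallyEq
    (Eventually.of_forall fun y => by simp [SmoothField.extend, div_eq_inv_mul])
  magnetic₁ x t := (h.hasDerivAt_magnetic hT (clamp_mem hT.le t)).fst.congr_of_eventuallyEq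
    (Eventually.of_forall fun y => by simp [SmoothField.extend, div_eq_inv_mul])
  magnetic₂ x t := (h.hasDerivAt_magnetic hT (clamp_mem hT.le t)).snd.congr_of_eventuallyEq
    (Eventually.of_forall fun y => by simp [SmoothField.extend, div_eq_inv_mul])
  temperature x t := h.hasDerivAt_heat (clamp_mem hT.le t)
  far := by
    obtain ⟨M, hM⟩ := h.farfield (1 / 2) (by norm_num)
    refine ⟨max 1 M, le_max_left _ _, fun x t hx => ?_⟩
    obtain ⟨h1, h2, h3, h4, h5⟩ := hM x _ (clamp_mem hT.le t) ((le_max_right _ _).trans hx)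
    have key : ∀ p : ℝ × ℝ, √(sq2 p) < 1 / 2 → |p.1| ≤ 1 ∧ |p.2| ≤ 1 := fun p hp => by
      have q1 : |p.1| ≤ √(sq2 p) := Real.abs_le_sqrt (by unfold sq2; linarith [sq_nonneg p.2])
      have q2 : |p.2| ≤ √(sq2 p) := Real.abs_le_sqrt (by unfold sq2; linarith [sq_nonneg p.1])
      exact ⟨by linarith, by linarith⟩
    exact ⟨h1.le, h3.le, by simp only [SmoothField.extend]; linarith, (key _ h5).1, (key _ h5).2,
      (key _ h4).1, (key _ h4).2⟩

lemma adm_toFlow (h : IsClassicalSolution α β T v u θ w b)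
    (hT : 0 < T) {K δ : ℝ} (ha : Admissible K δ v u θ w b) :
    (h.toFlow hT).Adm K δ := by
  have hz : (0:ℝ) ∈ Icc 0 T := ⟨le_rfl, hT.le⟩
  have h0 := clamp_eq hz
  obtain ⟨i1, i2, i3, i4, i5, i6, i7, i8, i9, i10⟩ := h.sq_int 0 hz
  have hs : ∀ p, 0 ≤ sq2 p := fun p => by
    unfold sq2
    positivity
  refine ⟨fun a c hac => ?_, fun x => ?_, fun x => ?_⟩
  · refine le_trans ?_ ha.1
    rw [intervalIntegral.integral_of_le hac]
    refine (setIntegral_le_integral (s := Ioc a c) (((((((((i1.add i2).add i3).add i4).add i5).add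
      i6).add i7).add i8).add i9).add i10) (Eventually.of_forall fun x => ?_)).trans_eq' ?_
    · have := hs (b x 0)
      have := hs (w x 0)
      have := hs (pdx b x 0)
      have := hs (pdx w x 0)
      simp only [Pi.zero_apply, Pi.add_apply]
      positivity
    · refine integral_congr_ae (Eventually.of_forall fun x => ?_)
      simp only [toFlow, SmoothField.extend, MHDFlow.bsq, MHDFlow.grad, sq2, h0, Pi.add_apply]
      ring
  · simp only [toFlow, h0]
    exact ha.2.1 x
  · simp only [toFlow, SmoothField.extend, h0]
    exact ha.2.2 x

end IsClassicalSolution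

/-- (2.37) of the paper: bound for `(θ−2)₊` in `L^∞(0,T;L²)` and for the
space-time integral of `θ^β θ_x²`. -/
theorem theta_truncation_bound (α β T K δ : ℝ) (hα : 0 ≤ α) (hβ : 0 < β) (hT : 0 < T)
    (hK : 0 < K) (hδ₀ : 0 < δ) (hδ₁ : δ ≤ 1) :
    ∃ C : ℝ, 0 < C ∧
      ∀ (v u θ : ℝ → ℝ → ℝ) (w b : ℝ → ℝ → ℝ × ℝ),
        IsClassicalSolution α β T v u θ w b → Admissible K δ v u θ w b →
        ∀ t ∈ Icc (0:ℝ) T,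
          (∫ x : ℝ, (max (θ x t - 2) 0) ^ 2)
            + (∫ s in (0:ℝ)..T, ∫ x : ℝ, θ x s ^ β * (pdx θ x s) ^ 2) ≤ C := by
  obtain ⟨C, hC1, hC⟩ := MHDFlow.exists_temperature_bound hα hβ hT hK hδ₀ hδ₁
  refine ⟨C + C, by linarith, fun v u θ w b h ha t ht => ?_⟩
  have hb := hC (h.toFlow hT) (h.adm_toFlow hT ha)
  refine add_le_add ?_ ?_
  · have hi := (h.sq_int t ht).2.2.1
    refine (integral_mono_of_nonneg (Eventually.of_forall fun x => sq_nonneg _) hi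
      (Eventually.of_forall fun x => ?_)).trans ?_
    · rcases le_total (θ x t - 2) 0 with h2 | h2
      · simp only [max_eq_right h2]
        nlinarith [sq_nonneg (θ x t - 1)]
      · simp only [max_eq_left h2]
        nlinarith
    · refine le_of_tendsto (intervalIntegral_tendsto_integral hi tendsto_neg_atTop_atBot
        tendsto_id) ?_
      filter_upwards [eventually_ge_atTop 0] with r hr
      have := (hb (-r) r (by linarith)).1 t ht
      simpa only [IsClassicalSolution.toFlow, SmoothField.extend, clamp_eq ht, id] using this
  · have hc : ∀ S : MHDFlow α β T, Continuous fun p : ℝ × ℝ =>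
        S.thp β p.1 p.2 * S.θ.fx p.1 p.2 ^ 2 := fun S => by fun_prop
    have h1 := integral_integral_le (F := fun x s => (h.toFlow hT).thp β x s
      * (h.toFlow hT).θ.fx x s ^ 2) (hc _) (fun x s => by
        have := (h.toFlow hT).thp_pos β x s
        positivity) hT.le (by linarith) fun a c hac => (hb a c hac).2
    refine h1.trans_eq' (intervalIntegral.integral_congr fun s hs => ?_)
    rw [uIcc_of_le hT.le] at hs
    simp only [MHDFlow.thp, IsClassicalSolution.toFlow, SmoothField.extend, clamp_eq hs]
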